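/- Let 0 < s < 1 and p ∈ (1,∞). There exists a constant C = C(s,p) > 0 such that for all Schwartz functions f, g on ℝ, ‖Λˢ(fg) − f Λˢg − g Λˢf‖_{L^p(ℝ)} ≤ C ‖g‖_{L^∞(ℝ)} ‖Λˢf‖_{L^p(ℝ)}. -/

import Mathlib

open MeasureTheory Real

noncomputable section

/-- One-dimensional Fourier transform with normalization (2π)^{-1/2} ∫ u(x) e^{-i x ξ} dx. -/
def FT1 (u : ℝ → ℂ) (ξ : ℝ) : ℂ :=
  (((2 * π) ^ (-(1 : ℝ) / 2) : ℝ) : ℂ) *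
    ∫ x : ℝ, Complex.exp (-(Complex.I * ((x * ξ : ℝ) : ℂ))) * u x

/-- Λʳu = 𝓕⁻¹( |ξ|ʳ (𝓕u)(ξ) ) on ℝ. -/
def Lam1 (r : ℝ) (u : ℝ → ℂ) (x : ℝ) : ℂ :=
  (((2 * π) ^ (-(1 : ℝ) / 2) : ℝ) : ℂ) *
    ∫ ξ : ℝ, ((|ξ| ^ r : ℝ) : ℂ) * FT1 u ξ * Complex.exp (Complex.I * ((x * ξ : ℝ) : ℂ))

namespace KPV

/-- heat kernel -/
def hk (t x : ℝ) : ℝ := (√(4 * π * t))⁻¹ * exp (-(x ^ 2) / (4 * t))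

/-- spatial derivatives of the heat kernel (orders 0, 1, 2) -/
def K (n : ℕ) (t x : ℝ) : ℝ :=
  match n with
  | 0 => hk t x
  | 1 => -(x / (2 * t)) * hk t x
  | _ => (x ^ 2 / (4 * t ^ 2) - 1 / (2 * t)) * hk t x

lemma hk_pos {t : ℝ} (ht : 0 < t) (x : ℝ) : 0 < hk t x := by
  unfold hk; positivity

lemma hk_nonneg (t x : ℝ) : 0 ≤ hk t x := by
  unfold hk; positivity

lemma hk_neg (t x : ℝ) : hk t (-x) = hk t x := by
  unfold hk; simp

lemma hk_le {t : ℝ} (ht : 0 < t) (x : ℝ) : hk t x ≤ (√(4 * π * t))⁻¹ := by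
  unfold hk
  have : exp (-(x ^ 2) / (4 * t)) ≤ 1 := by
    apply exp_le_one_iff.2
    apply div_nonpos_of_nonpos_of_nonneg <;> nlinarith [sq_nonneg x]
  have h0 : 0 ≤ (√(4 * π * t))⁻¹ := by positivity
  nlinarith

lemma hk_two {t : ℝ} (ht : 0 < t) (x : ℝ) :
    hk t x = √2 * exp (-(x ^ 2 / (8 * t))) * hk (2 * t) x := by
  unfold hk
  have h1 : √(4 * π * (2 * t)) = √2 * √(4 * π * t) := by
    rw [← Real.sqrt_mul (by norm_num)]; ring_nf
  rw [h1]
  have h2 : -x ^ 2 / (4 * t) = -(x ^ 2 / (8 * t)) + -x ^ 2 / (4 * (2 * t)) := by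
    field_simp; ring
  rw [h2, Real.exp_add]
  have h3 : √2 ≠ 0 := by positivity
  have h4 : √(4 * π * t) ≠ 0 := by positivity
  field_simp

lemma K_bound {t : ℝ} (ht : 0 < t) {n : ℕ} (hn : n ≤ 2) (x : ℝ) :
    |K n t x| ≤ 2 * (√t)⁻¹ ^ n * hk (2 * t) x := by
  have hp := hk_pos (t := 2 * t) (by positivity) x
  set z := x ^ 2 / (8 * t) with hz
  have hz0 : 0 ≤ z := by positivity
  have hs2 : √2 ≤ 3 / 2 := by
    rw [Real.sqrt_le_left (by norm_num)]; norm_num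
  have hs20 : 0 ≤ √2 := by positivity
  have he : 0 < exp (-z) := exp_pos _
  have he1 : exp (-z) * (1 + z + z ^ 2 / 2) ≤ 1 := by
    have := Real.quadratic_le_exp_of_nonneg hz0
    calc exp (-z) * (1 + z + z ^ 2 / 2) ≤ exp (-z) * exp z := by gcongr
      _ = 1 := by rw [← exp_add]; simp
  have hx2 : x ^ 2 = 8 * t * z := by rw [hz]; field_simp
  have hst : √t ^ 2 = t := Real.sq_sqrt ht.le
  have hst0 : 0 < √t := Real.sqrt_pos.2 ht
  have key : ∀ q : ℝ, |q| * (√2 * exp (-z)) ≤ 2 * (√t)⁻¹ ^ n →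
      |q * hk t x| ≤ 2 * (√t)⁻¹ ^ n * hk (2 * t) x := by
    intro q hq
    rw [hk_two ht x, ← hz, abs_mul, abs_of_pos (show 0 < √2 * exp (-z) * hk (2 * t) x by positivity), ← mul_assoc]
    gcongr
  interval_cases n
  · have := key 1 ?_
    · simpa [K] using this
    · simp only [abs_one, pow_zero]
      nlinarith [mul_nonneg he.le hz0, mul_nonneg he.le (sq_nonneg z)]
  · apply key
    have h1 : |-(x / (2 * t))| * √t = √(2 * z) := by
      rw [abs_neg, abs_div, abs_of_pos (show 0 < 2 * t by positivity)]
      have : |x| = √(8 * t * z) := by rw [← hx2, Real.sqrt_sq_eq_abs]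
      rw [this, show 8 * t * z = (2 * t) ^ 2 * ((2 * z) / t) by field_simp; ring,
        Real.sqrt_mul (by positivity), Real.sqrt_sq (by positivity), Real.sqrt_div (by positivity)]
      field_simp
    have h2 : √(2 * z) ≤ 1 / 2 + z := by
      rw [Real.sqrt_le_left (by positivity)]; nlinarith [sq_nonneg (z - 1 / 2)]
    rw [pow_one, mul_comm 2 (√t)⁻¹, ← div_eq_inv_mul, le_div_iff₀ hst0]
    calc |-(x / (2 * t))| * (√2 * exp (-z)) * √t
        = √(2 * z) * (√2 * exp (-z)) := by rw [← h1]; ring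
      _ ≤ (1 / 2 + z) * (3 / 2 * exp (-z)) := by gcongr
      _ ≤ 2 := by nlinarith [mul_nonneg he.le hz0, mul_nonneg he.le (sq_nonneg z)]
  · apply key
    have h1 : x ^ 2 / (4 * t ^ 2) - 1 / (2 * t) = (2 * z - 1 / 2) / t := by
      rw [hx2]; field_simp; ring
    rw [h1, abs_div, abs_of_pos ht, inv_pow, hst]
    have h2 : |2 * z - 1 / 2| ≤ 2 * z + 1 / 2 := by
      rw [abs_le]; constructor <;> linarith
    rw [← div_eq_mul_inv, div_mul_eq_mul_div]
    apply div_le_div_of_nonneg_right _ ht.le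
    have h3 : exp (-z) * (1/2 + 2 * z) ≤ 4 / 3 := by
      by_cases hz1 : z ≤ 1 / 3
      · have : exp (-z) ≤ 1 := exp_le_one_iff.2 (by linarith)
        nlinarith
      · nlinarith [mul_nonneg he.le (sq_nonneg (z - 1)), mul_nonneg he.le hz0]
    calc |2 * z - 1 / 2| * (√2 * exp (-z)) ≤ (2 * z + 1 / 2) * (3 / 2 * exp (-z)) := by gcongr
      _ ≤ 2 := by nlinarith

lemma K_bound' {t : ℝ} (ht : 0 < t) {n : ℕ} (hn : n ≤ 2) (x : ℝ) :
    |K n t x| ≤ 2 * (√t)⁻¹ ^ n * (√t)⁻¹ := by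
  refine (K_bound ht hn x).trans ?_
  have h1 : hk (2 * t) x ≤ (√t)⁻¹ := by
    refine (hk_le (by positivity) x).trans ?_
    apply inv_anti₀ (by positivity)
    apply Real.sqrt_le_sqrt
    nlinarith [Real.pi_gt_three]
  gcongr

lemma hk_integral {t : ℝ} (ht : 0 < t) : ∫ x, hk t x = 1 := by
  unfold hk
  rw [integral_const_mul]
  have : ∀ x : ℝ, -(x ^ 2) / (4 * t) = -(1 / (4 * t)) * x ^ 2 := by intro x; ring
  simp_rw [this]
  rw [integral_gaussian]
  rw [show π / (1 / (4 * t)) = 4 * π * t by field_simp]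
  have h4 : √(4 * π * t) ≠ 0 := by positivity
  field_simp

lemma hk_integrable {t : ℝ} (ht : 0 < t) : Integrable (hk t) := by
  unfold hk
  have : ∀ x : ℝ, -(x ^ 2) / (4 * t) = -(1 / (4 * t)) * x ^ 2 := by intro x; ring
  simp_rw [this]
  exact (integrable_exp_neg_mul_sq (by positivity)).const_mul _

lemma hk_meas : Measurable (fun q : ℝ × ℝ => hk q.1 q.2) := by
  unfold hk; fun_prop

lemma K_meas (n : ℕ) : Measurable (fun q : ℝ × ℝ => K n q.1 q.2) := by
  have := hk_meas
  match n with
  | 0 => simpa [K] using this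
  | 1 => simp only [K]; fun_prop
  | (n + 2) => simp only [K]; fun_prop

lemma hk_contAt {t x : ℝ} (ht : 0 < t) : ContinuousAt (fun q : ℝ × ℝ => hk q.1 q.2) (t, x) := by
  unfold hk
  have h4 : √(4 * π * t) ≠ 0 := by positivity
  have h5 : 4 * t ≠ 0 := by positivity
  fun_prop (disch := assumption)

lemma K_contAt (n : ℕ) {t x : ℝ} (ht : 0 < t) :
    ContinuousAt (fun q : ℝ × ℝ => K n q.1 q.2) (t, x) := by
  have := hk_contAt (x := x) ht
  have h5 : 4 * t ^ 2 ≠ 0 := by positivity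
  have h6 : 2 * t ≠ 0 := by positivity
  match n with
  | 0 => simpa [K] using this
  | 1 => simp only [K]; fun_prop (disch := assumption)
  | (n + 2) => simp only [K]; fun_prop (disch := assumption)

lemma hk_dx {t : ℝ} (x : ℝ) : HasDerivAt (hk t) (-(x / (2 * t)) * hk t x) x := by
  unfold hk
  have h := ((((hasDerivAt_id x).pow 2).neg.div_const (4 * t)).exp).const_mul ((√(4 * π * t))⁻¹)
  refine h.congr_deriv ?_
  simp only [id, Pi.neg_apply, Pi.pow_apply]
  norm_num
  ring

lemma K_dx {n : ℕ} (hn : n ≤ 1) {t : ℝ} (x : ℝ) :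
    HasDerivAt (K n t) (K (n + 1) t x) x := by
  interval_cases n
  · exact hk_dx x
  · have h := (((hasDerivAt_id x).div_const (2 * t)).neg).mul (hk_dx (t := t) x)
    refine h.congr_deriv ?_
    simp only [K, id, Pi.neg_apply]
    ring

lemma K_dt {t : ℝ} (ht : 0 < t) (x : ℝ) :
    HasDerivAt (fun t => K 0 t x) (K 2 t x) t := by
  simp only [K]
  unfold hk
  have h4 : √(4 * π * t) ≠ 0 := by positivity
  have h1 := (((hasDerivAt_id t).const_mul (4 * π)).sqrt (by simp; positivity)).inv h4
  have h2 := (((hasDerivAt_const t (-(x ^ 2))).div ((hasDerivAt_id t).const_mul 4)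
    (by simp; positivity))).exp
  have h := h1.mul h2
  refine h.congr_deriv ?_
  simp only [id, Pi.inv_apply, Pi.div_apply]
  have h5 : √(4 * π * t) ^ 2 = 4 * π * t := Real.sq_sqrt (by positivity)
  rw [h5]
  field_simp
  ring

end KPV

namespace KPV

/-- bounded integrable measurable functions -/
structure Nice (h : ℝ → ℝ) : Prop where
  meas : Measurable h
  int : Integrable h
  bdd : ∃ B, ∀ x, |h x| ≤ B

/-- heat extension and its spatial derivatives -/
def P (n : ℕ) (h : ℝ → ℝ) (t x : ℝ) : ℝ := ∫ y, K n t (x - y) * h y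

lemma K_meas1 (n : ℕ) (t x : ℝ) : Measurable (fun y => K n t (x - y)) :=
  (K_meas n).comp (by fun_prop : Measurable (fun y : ℝ => (t, x - y)))

lemma P_ig {h : ℝ → ℝ} (hh : Integrable h) {n : ℕ} (hn : n ≤ 2) {t : ℝ} (ht : 0 < t) (x : ℝ) :
    Integrable (fun y => K n t (x - y) * h y) := by
  refine hh.bdd_mul (c := 2 * (√t)⁻¹ ^ n * (√t)⁻¹) (K_meas1 n t x).aestronglyMeasurable ?_
  exact Filter.Eventually.of_forall fun y => by simpa using K_bound' ht hn (x - y)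

lemma P_dx {h : ℝ → ℝ} (hh : Integrable h) {n : ℕ} (hn : n ≤ 1) {t : ℝ} (ht : 0 < t) (x : ℝ) :
    HasDerivAt (P n h t) (P (n + 1) h t x) x := by
  unfold P
  refine (hasDerivAt_integral_of_dominated_loc_of_deriv_le (s := Set.univ)
    (F := fun x y => K n t (x - y) * h y) (F' := fun x y => K (n + 1) t (x - y) * h y)
    (bound := fun y => 2 * (√t)⁻¹ ^ (n + 1) * (√t)⁻¹ * |h y|) Filter.univ_mem ?_ ?_ ?_ ?_ ?_ ?_).2
  · exact Filter.Eventually.of_forall fun x => (P_ig hh (by omega) ht x).aestronglyMeasurable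
  · exact P_ig hh (by omega) ht x
  · exact (P_ig hh (by omega) ht x).aestronglyMeasurable
  · refine Filter.Eventually.of_forall fun y x _ => ?_
    rw [norm_mul, norm_eq_abs, norm_eq_abs]
    gcongr
    exact K_bound' ht (by omega) _
  · exact hh.abs.const_mul _
  · refine Filter.Eventually.of_forall fun y x _ => ?_
    have := (K_dx hn (t := t) (x - y)).comp_sub_const x y
    exact this.mul_const _

lemma P_dt {h : ℝ → ℝ} (hh : Integrable h) {t : ℝ} (ht : 0 < t) (x : ℝ) :
    HasDerivAt (fun t => P 0 h t x) (P 2 h t x) t := by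
  unfold P
  refine (hasDerivAt_integral_of_dominated_loc_of_deriv_le (s := Set.Ioi (t / 2))
    (F := fun t y => K 0 t (x - y) * h y) (F' := fun t y => K 2 t (x - y) * h y)
    (bound := fun y => 2 * (√(t / 2))⁻¹ ^ 2 * (√(t / 2))⁻¹ * |h y|)
      (Ioi_mem_nhds (by linarith)) ?_ ?_ ?_ ?_ ?_ ?_).2
  · filter_upwards [Ioi_mem_nhds ht] with t ht
    exact (P_ig hh (by omega) ht x).aestronglyMeasurable
  · exact P_ig hh (by omega) ht x
  · exact (P_ig hh (by omega) ht x).aestronglyMeasurable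
  · refine Filter.Eventually.of_forall fun y r hr => ?_
    rw [norm_mul, norm_eq_abs, norm_eq_abs]
    gcongr
    have hr' : t / 2 < r := hr
    have hr0 : 0 < r := by linarith
    refine (K_bound' hr0 le_rfl _).trans ?_
    have : (√r)⁻¹ ≤ (√(t / 2))⁻¹ :=
      inv_anti₀ (Real.sqrt_pos.2 (by positivity)) (Real.sqrt_le_sqrt hr'.le)
    gcongr
  · exact hh.abs.const_mul _
  · refine Filter.Eventually.of_forall fun y r hr => ?_
    have hr' : t / 2 < r := hr
    exact (K_dt (by linarith : 0 < r) (x - y)).mul_const _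

lemma P_contAt {h : ℝ → ℝ} (hh : Integrable h) {n : ℕ} (hn : n ≤ 2) {t : ℝ} (ht : 0 < t) (x : ℝ) :
    ContinuousAt (fun q : ℝ × ℝ => P n h q.1 q.2) (t, x) := by
  unfold P
  have hev : ∀ᶠ q : ℝ × ℝ in nhds (t, x), t / 2 < q.1 :=
    continuousAt_fst.eventually (Ioi_mem_nhds (by simp; linarith))
  refine continuousAt_of_dominated
    (bound := fun y => 2 * (√(t / 2))⁻¹ ^ n * (√(t / 2))⁻¹ * |h y|) ?_ ?_ ?_ ?_
  · filter_upwards [hev] with q hq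
    exact (P_ig hh hn (by linarith) q.2).aestronglyMeasurable
  · filter_upwards [hev] with q hq
    refine Filter.Eventually.of_forall fun y => ?_
    rw [norm_mul, norm_eq_abs, norm_eq_abs]
    gcongr
    have hr0 : 0 < q.1 := by linarith
    refine (K_bound' hr0 hn _).trans ?_
    have : (√q.1)⁻¹ ≤ (√(t / 2))⁻¹ :=
      inv_anti₀ (Real.sqrt_pos.2 (by positivity)) (Real.sqrt_le_sqrt hq.le)
    gcongr
  · exact hh.abs.const_mul _
  · refine Filter.Eventually.of_forall fun y => ?_
    have h1 : ContinuousAt (fun q : ℝ × ℝ => K n q.1 q.2) (t, x - y) := K_contAt n ht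
    have h2 : ContinuousAt (fun q : ℝ × ℝ => (q.1, q.2 - y)) (t, x) := by fun_prop
    have h3 := ContinuousAt.comp (f := fun q : ℝ × ℝ => (q.1, q.2 - y)) (x := (t, x)) h1 h2
    exact h3.mul continuousAt_const

lemma P_contOn {h : ℝ → ℝ} (hh : Integrable h) {n : ℕ} (hn : n ≤ 2) :
    ContinuousOn (fun q : ℝ × ℝ => P n h q.1 q.2) (Set.Ioi 0 ×ˢ Set.univ) := by
  rintro ⟨t, x⟩ ⟨h1, -⟩
  exact (P_contAt hh hn h1 x).continuousWithinAt

lemma P_cont {h : ℝ → ℝ} (hh : Integrable h) {n : ℕ} (hn : n ≤ 2) {t : ℝ} (ht : 0 < t) :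
    Continuous (P n h t) := by
  rw [continuous_iff_continuousAt]
  intro x
  exact ContinuousAt.comp (f := fun x : ℝ => (t, x)) (g := fun q : ℝ × ℝ => P n h q.1 q.2)
    (P_contAt hh hn ht x) (by fun_prop)

lemma P_meas {h : ℝ → ℝ} (hh : Measurable h) (n : ℕ) :
    Measurable (fun q : ℝ × ℝ => P n h q.1 q.2) := by
  unfold P
  have h1 : Measurable (fun z : (ℝ × ℝ) × ℝ => K n z.1.1 (z.1.2 - z.2) * h z.2) := by
    have := (K_meas n).comp (by fun_prop : Measurable (fun z : (ℝ × ℝ) × ℝ => (z.1.1, z.1.2 - z.2)))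
    exact this.mul (hh.comp measurable_snd)
  exact (StronglyMeasurable.integral_prod_right (f := fun (q : ℝ × ℝ) y => K n q.1 (q.2 - y) * h y)
    h1.stronglyMeasurable).measurable

lemma P_nonneg {h : ℝ → ℝ} (hh : ∀ x, 0 ≤ h x) (t x : ℝ) : 0 ≤ P 0 h t x :=
  integral_nonneg fun y => mul_nonneg (hk_nonneg _ _) (hh y)

lemma P_abs_le {h : ℝ → ℝ} (hh : Integrable h) {n : ℕ} (hn : n ≤ 2) {t : ℝ} (ht : 0 < t) (x : ℝ) :
    |P n h t x| ≤ 2 * (√t)⁻¹ ^ n * P 0 (fun y => |h y|) (2 * t) x := by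
  unfold P
  rw [← integral_const_mul, ← norm_eq_abs]
  refine norm_integral_le_of_norm_le ((P_ig hh.abs (n := 0) (by omega) (by positivity) x).const_mul _) ?_
  refine Filter.Eventually.of_forall fun y => ?_
  rw [norm_mul, norm_eq_abs, norm_eq_abs, ← mul_assoc]
  gcongr
  exact K_bound ht hn _

lemma hk_sub_int {t : ℝ} (ht : 0 < t) (x : ℝ) : Integrable (fun y => hk t (x - y)) :=
  (hk_integrable ht).comp_sub_left x

lemma hk_sub_integral {t : ℝ} (ht : 0 < t) (x : ℝ) : ∫ y, hk t (x - y) = 1 := by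
  rw [integral_sub_left_eq_self (fun y => hk t y)]; exact hk_integral ht

lemma P0_abs_le {h : ℝ → ℝ} {B : ℝ} (hB : ∀ x, |h x| ≤ B) {t : ℝ} (ht : 0 < t) (x : ℝ) :
    |P 0 h t x| ≤ B := by
  unfold P
  rw [← norm_eq_abs]
  calc ‖∫ y, K 0 t (x - y) * h y‖ ≤ ∫ y, hk t (x - y) * B := by
        refine norm_integral_le_of_norm_le ((hk_sub_int ht x).mul_const _) ?_
        refine Filter.Eventually.of_forall fun y => ?_
        rw [norm_mul, norm_eq_abs, norm_eq_abs]
        simp only [K]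
        rw [abs_of_nonneg (hk_nonneg _ _)]
        exact mul_le_mul_of_nonneg_left (hB y) (hk_nonneg _ _)
    _ = B := by rw [integral_mul_const, hk_sub_integral ht, one_mul]

lemma Pn_abs_le {h : ℝ → ℝ} (hh : Integrable h) {B : ℝ} (hB : ∀ x, |h x| ≤ B) {n : ℕ} (hn : n ≤ 2)
    {t : ℝ} (ht : 0 < t) (x : ℝ) : |P n h t x| ≤ 2 * (√t)⁻¹ ^ n * B := by
  refine (P_abs_le hh hn ht x).trans ?_
  gcongr
  refine (le_abs_self _).trans (P0_abs_le (fun y => ?_) (by positivity) x)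
  simpa using hB y

/-- product integrability of the two-variable kernel integrand -/
lemma P_prod_int {h : ℝ → ℝ} (hh : Integrable h) {t : ℝ} (ht : 0 < t) :
    Integrable (fun z : ℝ × ℝ => hk t (z.1 - z.2) * h z.2) (volume.prod volume) := by
  have h1 := (Integrable.mul_prod (hk_integrable ht) hh)
  have hmp : MeasurePreserving (fun z : ℝ × ℝ => (z.1 - z.2, z.2))
      (volume.prod volume) (volume.prod volume) := measurePreserving_sub_prod volume volume
  exact (hmp.integrable_comp h1.aestronglyMeasurable).2 h1

lemma P0_int {h : ℝ → ℝ} (hh : Integrable h) {t : ℝ} (ht : 0 < t) : Integrable (P 0 h t) :=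
  (P_prod_int hh ht).integral_prod_left

lemma P0_integral {h : ℝ → ℝ} (hh : Integrable h) {t : ℝ} (ht : 0 < t) :
    ∫ x, P 0 h t x = ∫ x, h x := by
  have := integral_integral_swap (f := fun x y => hk t (x - y) * h y) (P_prod_int hh ht)
  unfold P
  simp only [K]
  rw [this]
  congr 1
  ext y
  rw [integral_mul_const, integral_sub_right_eq_self (fun x => hk t x), hk_integral ht, one_mul]

lemma Pn_int {h : ℝ → ℝ} (hh : Integrable h) {n : ℕ} (hn : n ≤ 2) {t : ℝ} (ht : 0 < t) :
    Integrable (P n h t) := by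
  refine ((P0_int hh.abs (t := 2 * t) (by positivity)).const_mul (2 * (√t)⁻¹ ^ n)).mono'
    (P_cont hh hn ht).aestronglyMeasurable ?_
  exact Filter.Eventually.of_forall fun x => P_abs_le hh hn ht x

lemma Pn_L1 {h : ℝ → ℝ} (hh : Integrable h) {n : ℕ} (hn : n ≤ 2) {t : ℝ} (ht : 0 < t) :
    ∫ x, |P n h t x| ≤ 2 * (√t)⁻¹ ^ n * ∫ x, |h x| := by
  rw [← P0_integral hh.abs (t := 2 * t) (by positivity), ← integral_const_mul]
  refine integral_mono (Pn_int hh hn ht).abs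
    ((P0_int hh.abs (t := 2 * t) (by positivity)).const_mul (2 * (√t)⁻¹ ^ n)) ?_
  intro x
  exact P_abs_le hh hn ht x

lemma P_nice {h : ℝ → ℝ} (hh : Nice h) {n : ℕ} (hn : n ≤ 2) {t : ℝ} (ht : 0 < t) :
    Nice (P n h t) := by
  obtain ⟨B, hB⟩ := hh.bdd
  exact ⟨(P_cont hh.int hn ht).measurable, Pn_int hh.int hn ht, _, Pn_abs_le hh.int hB hn ht⟩

lemma P_symm {f h : ℝ → ℝ} (hf : Integrable f) (hh : Nice h) {t : ℝ} (ht : 0 < t) :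
    ∫ x, h x * P 0 f t x = ∫ x, f x * P 0 h t x := by
  obtain ⟨B, hB⟩ := hh.bdd
  have h1 : Integrable (fun z : ℝ × ℝ => h z.1 * (hk t (z.1 - z.2) * f z.2))
      (volume.prod volume) := by
    refine (P_prod_int hf ht).bdd_mul (c := B) ?_ ?_
    · exact (hh.meas.comp measurable_fst).aestronglyMeasurable
    · exact Filter.Eventually.of_forall fun z => hB z.1
  have := integral_integral_swap (f := fun x y => h x * (hk t (x - y) * f y)) h1
  unfold P
  simp only [K]
  simp_rw [← integral_const_mul]
  rw [this]
  congr 1; ext y; congr 1; ext x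
  rw [← hk_neg t (x - y), neg_sub]
  ring

lemma hk_conv {r t : ℝ} (hr : 0 < r) (ht : 0 < t) (x : ℝ) :
    ∫ y, hk r (x - y) * hk t y = hk (r + t) x := by
  unfold hk
  have h1 : ∀ y : ℝ, (√(4 * π * r))⁻¹ * exp (-(x - y) ^ 2 / (4 * r)) *
      ((√(4 * π * t))⁻¹ * exp (-y ^ 2 / (4 * t)))
      = (√(4 * π * r))⁻¹ * (√(4 * π * t))⁻¹ * exp (-x ^ 2 / (4 * (r + t))) *
        exp (-((r + t) / (4 * r * t)) * (y - t * x / (r + t)) ^ 2) := by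
    intro y
    have : exp (-(x - y) ^ 2 / (4 * r)) * exp (-y ^ 2 / (4 * t)) =
        exp (-x ^ 2 / (4 * (r + t))) *
        exp (-((r + t) / (4 * r * t)) * (y - t * x / (r + t)) ^ 2) := by
      rw [← exp_add, ← exp_add]
      congr 1
      field_simp
      ring
    calc _ = (√(4 * π * r))⁻¹ * (√(4 * π * t))⁻¹ *
          (exp (-(x - y) ^ 2 / (4 * r)) * exp (-y ^ 2 / (4 * t))) := by ring
      _ = _ := by rw [this]; ring
  simp_rw [h1]
  rw [integral_const_mul, integral_sub_right_eq_self
    (fun y => exp (-((r + t) / (4 * r * t)) * y ^ 2)), integral_gaussian]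
  have h2 : √(π / ((r + t) / (4 * r * t))) = √(4 * π * r) * √(4 * π * t) * (√(4 * π * (r + t)))⁻¹ := by
    rw [← Real.sqrt_mul (by positivity), ← Real.sqrt_inv, ← Real.sqrt_mul (by positivity)]
    congr 1
    field_simp
  rw [h2]
  have h3 : √(4 * π * r) ≠ 0 := by positivity
  have h4 : √(4 * π * t) ≠ 0 := by positivity
  field_simp

lemma P_semi {h : ℝ → ℝ} (hh : Integrable h) {r t : ℝ} (hr : 0 < r) (ht : 0 < t) (x : ℝ) :
    P 0 (P 0 h t) r x = P 0 h (r + t) x := by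
  unfold P
  simp only [K]
  have h1 : Integrable (fun z : ℝ × ℝ => hk r (x - z.1) * (hk t (z.1 - z.2) * h z.2))
      (volume.prod volume) := by
    refine (P_prod_int hh ht).bdd_mul (c := (√(4 * π * r))⁻¹) ?_ ?_
    · exact ((K_meas1 0 r x).comp measurable_fst).aestronglyMeasurable
    · refine Filter.Eventually.of_forall fun z => ?_
      rw [norm_eq_abs, abs_of_nonneg (hk_nonneg _ _)]
      exact hk_le hr _
  have := integral_integral_swap (f := fun y z => hk r (x - y) * (hk t (y - z) * h z)) h1
  simp_rw [← integral_const_mul]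
  rw [this]
  congr 1; ext z
  simp_rw [← mul_assoc]
  rw [integral_mul_const]
  congr 1
  rw [← integral_add_right_eq_self _ z, ← hk_conv hr ht]
  congr 1; ext y
  congr 2 <;> ring

lemma P_semi1 {h : ℝ → ℝ} (hh : Integrable h) {r t : ℝ} (hr : 0 < r) (ht : 0 < t) (x : ℝ) :
    P 0 (P 1 h t) r x = P 1 h (r + t) x := by
  have h1 : HasDerivAt (fun x => P 0 (P 0 h t) r x) (P 1 h (r + t) x) x := by
    have := P_dx hh (n := 0) (by omega) (by positivity : 0 < r + t) x
    refine this.congr_of_eventuallyEq (Filter.Eventually.of_forall fun y => P_semi hh hr ht y)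
  have e : ∀ (g : ℝ → ℝ) (x : ℝ), P 0 g r x = ∫ z, hk r z * g (x - z) := by
    intro g x
    unfold P
    simp only [K]
    rw [← integral_sub_left_eq_self _ volume x]
    simp
  obtain ⟨B, hB⟩ : ∃ B, ∀ y, |P 1 h t y| ≤ B := by
    refine ⟨2 * (√t)⁻¹ ^ 1 * (√t)⁻¹ * ∫ y, |h y|, fun y => ?_⟩
    unfold P
    rw [← integral_const_mul, ← norm_eq_abs]
    refine norm_integral_le_of_norm_le (hh.abs.const_mul _) ?_
    refine Filter.Eventually.of_forall fun z => ?_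
    rw [norm_mul, norm_eq_abs, norm_eq_abs]
    gcongr
    exact K_bound' ht (by omega) _
  have hmk : Measurable (hk r) := hk_meas.comp (by fun_prop : Measurable (fun y : ℝ => (r, y)))
  have hI : ∀ n ≤ 1, ∀ x : ℝ, Integrable (fun z => hk r z * P n h t (x - z)) := by
    intro n hn x
    refine Integrable.bdd_mul (c := (√(4 * π * r))⁻¹)
      ((Pn_int hh (n := n) (by omega) ht).comp_sub_left x) hmk.aestronglyMeasurable ?_
    refine Filter.Eventually.of_forall fun z => ?_
    rw [norm_eq_abs, abs_of_nonneg (hk_nonneg _ _)]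
    exact hk_le hr _
  have h2 : HasDerivAt (fun x => P 0 (P 0 h t) r x) (P 0 (P 1 h t) r x) x := by
    simp_rw [e]
    refine (hasDerivAt_integral_of_dominated_loc_of_deriv_le (s := Set.univ)
      (F := fun x z => hk r z * P 0 h t (x - z)) (F' := fun x z => hk r z * P 1 h t (x - z))
      (bound := fun z => hk r z * B) Filter.univ_mem ?_ ?_ ?_ ?_ ?_ ?_).2
    · exact Filter.Eventually.of_forall fun x => (hI 0 (by omega) x).aestronglyMeasurable
    · exact hI 0 (by omega) x
    · exact (hI 1 (by omega) x).aestronglyMeasurable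
    · refine Filter.Eventually.of_forall fun z x _ => ?_
      rw [norm_mul, norm_eq_abs, norm_eq_abs, abs_of_nonneg (hk_nonneg _ _)]
      exact mul_le_mul_of_nonneg_left (hB _) (hk_nonneg _ _)
    · exact (hk_integrable hr).mul_const _
    · refine Filter.Eventually.of_forall fun z x _ => ?_
      exact ((P_dx hh (n := 0) (by omega) ht (x - z)).comp_sub_const x z).const_mul _
  exact h2.unique h1

lemma P_semi2 {h : ℝ → ℝ} (hh : Integrable h) {r t : ℝ} (hr : 0 < r) (ht : 0 < t) (x : ℝ) :
    P 1 (P 1 h t) r x = P 2 h (r + t) x := by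
  have h1 : HasDerivAt (fun x => P 0 (P 1 h t) r x) (P 2 h (r + t) x) x := by
    have := P_dx hh (n := 1) (by omega) (by positivity : 0 < r + t) x
    exact this.congr_of_eventuallyEq (Filter.Eventually.of_forall fun y => P_semi1 hh hr ht y)
  exact (P_dx (Pn_int hh (n := 1) (by omega) ht) (n := 0) (by omega) hr x).unique h1

lemma P_pos {h : ℝ → ℝ} (hh : Integrable h) (h0 : ∀ x, 0 ≤ h x) (hne : ¬ h =ᵐ[volume] 0)
    {t : ℝ} (ht : 0 < t) (x : ℝ) : 0 < P 0 h t x := by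
  unfold P
  refine (integral_pos_iff_support_of_nonneg (f := fun y => K 0 t (x - y) * h y)
    (fun y => mul_nonneg (hk_nonneg _ _) (h0 y)) (P_ig hh (by omega) ht x)).2 ?_
  have : Function.support (fun y => K 0 t (x - y) * h y) = Function.support h := by
    ext y
    simp only [Function.mem_support, ne_eq, mul_eq_zero, not_or, K]
    exact ⟨fun h => h.2, fun h => ⟨(hk_pos ht _).ne', h⟩⟩
  rw [this]
  rw [pos_iff_ne_zero]
  intro h1
  exact hne (by rw [Filter.EventuallyEq, ae_iff]; simpa [Function.support] using h1)

lemma P_sub {f g : ℝ → ℝ} (hf : Integrable f) (hg : Integrable g) {n : ℕ} (hn : n ≤ 2)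
    {t : ℝ} (ht : 0 < t) (x : ℝ) : P n (fun y => f y - g y) t x = P n f t x - P n g t x := by
  unfold P
  rw [← integral_sub (P_ig hf hn ht x) (P_ig hg hn ht x)]
  congr 1; ext y; ring

lemma P_smul {f : ℝ → ℝ} (c : ℝ) {n : ℕ} (t x : ℝ) :
    P n (fun y => c * f y) t x = c * P n f t x := by
  unfold P
  rw [← integral_const_mul]
  congr 1; ext y; ring

end KPV

namespace KPV

/-- open upper half plane (time first) -/
abbrev HP : Set (ℝ × ℝ) := Set.Ioi 0 ×ˢ Set.univ

/-- smooth-enough functions on the half plane with derivatives -/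
structure HC0 (F F1 F2 Ft : ℝ → ℝ → ℝ) : Prop where
  dx : ∀ t > 0, ∀ x, HasDerivAt (F t) (F1 t x) x
  dxx : ∀ t > 0, ∀ x, HasDerivAt (F1 t) (F2 t x) x
  dt : ∀ t > 0, ∀ x, HasDerivAt (fun t => F t x) (Ft t x) t
  c0 : ContinuousOn (fun q : ℝ × ℝ => F q.1 q.2) HP
  c1 : ContinuousOn (fun q : ℝ × ℝ => F1 q.1 q.2) HP
  c2 : ContinuousOn (fun q : ℝ × ℝ => F2 q.1 q.2) HP
  ct : ContinuousOn (fun q : ℝ × ℝ => Ft q.1 q.2) HP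

/-- `L` is the heat defect of `F`, with spatial derivative `F1` -/
def HC (F F1 L : ℝ → ℝ → ℝ) : Prop :=
  ∃ F2 Ft, HC0 F F1 F2 Ft ∧ ∀ t > 0, ∀ x, L t x = F2 t x - Ft t x

lemma HC.contL {F F1 L : ℝ → ℝ → ℝ} (h : HC F F1 L) :
    ContinuousOn (fun q : ℝ × ℝ => L q.1 q.2) HP := by
  obtain ⟨F2, Ft, h, hL⟩ := h
  refine (h.c2.sub h.ct).congr ?_
  rintro ⟨t, x⟩ ⟨ht, -⟩
  exact hL t ht x

lemma HC.congrL {F F1 L L' : ℝ → ℝ → ℝ} (h : HC F F1 L) (h' : ∀ t > 0, ∀ x, L' t x = L t x) :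
    HC F F1 L' := by
  obtain ⟨F2, Ft, h, hL⟩ := h
  exact ⟨F2, Ft, h, fun t ht x => by rw [h' t ht x, hL t ht x]⟩

lemma HC.heat {h : ℝ → ℝ} (hh : Integrable h) : HC (P 0 h) (P 1 h) (fun _ _ => 0) :=
  ⟨P 2 h, P 2 h,
    ⟨fun t ht x => P_dx hh (by omega) ht x, fun t ht x => P_dx hh (by omega) ht x,
      fun t ht x => P_dt hh ht x,
      P_contOn hh (by omega), P_contOn hh (by omega), P_contOn hh (by omega), P_contOn hh (by omega)⟩,
    fun t ht x => by simp⟩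

lemma HC.add {F F1 L G G1 M : ℝ → ℝ → ℝ} (hF : HC F F1 L) (hG : HC G G1 M) :
    HC (fun t x => F t x + G t x) (fun t x => F1 t x + G1 t x) (fun t x => L t x + M t x) := by
  obtain ⟨F2, Ft, f, hL⟩ := hF
  obtain ⟨G2, Gt, g, hM⟩ := hG
  refine ⟨fun t x => F2 t x + G2 t x, fun t x => Ft t x + Gt t x,
    ⟨fun t ht x => (f.dx t ht x).add (g.dx t ht x), fun t ht x => (f.dxx t ht x).add (g.dxx t ht x),
      fun t ht x => (f.dt t ht x).add (g.dt t ht x), f.c0.add g.c0, f.c1.add g.c1, f.c2.add g.c2,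
      f.ct.add g.ct⟩, fun t ht x => ?_⟩
  beta_reduce
  rw [hL t ht x, hM t ht x]; ring

lemma HC.const (c : ℝ) : HC (fun _ _ => c) (fun _ _ => 0) (fun _ _ => 0) :=
  ⟨fun _ _ => 0, fun _ _ => 0,
    ⟨fun t _ x => hasDerivAt_const x c, fun t _ x => hasDerivAt_const x 0,
      fun t _ x => hasDerivAt_const t c, continuousOn_const, continuousOn_const, continuousOn_const,
      continuousOn_const⟩, fun t ht x => by simp⟩

lemma HC.mul {F F1 L G G1 M : ℝ → ℝ → ℝ} (hF : HC F F1 L) (hG : HC G G1 M) :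
    HC (fun t x => F t x * G t x) (fun t x => F1 t x * G t x + F t x * G1 t x)
      (fun t x => L t x * G t x + F t x * M t x + 2 * (F1 t x * G1 t x)) := by
  obtain ⟨F2, Ft, f, hL⟩ := hF
  obtain ⟨G2, Gt, g, hM⟩ := hG
  refine ⟨fun t x => (F2 t x * G t x + F1 t x * G1 t x) + (F1 t x * G1 t x + F t x * G2 t x),
    fun t x => Ft t x * G t x + F t x * Gt t x,
    ⟨fun t ht x => (f.dx t ht x).mul (g.dx t ht x),
      fun t ht x => ((f.dxx t ht x).mul (g.dx t ht x)).add ((f.dx t ht x).mul (g.dxx t ht x)),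
      fun t ht x => (f.dt t ht x).mul (g.dt t ht x), f.c0.mul g.c0,
      (f.c1.mul g.c0).add (f.c0.mul g.c1),
      ((f.c2.mul g.c0).add (f.c1.mul g.c1)).add ((f.c1.mul g.c1).add (f.c0.mul g.c2)),
      (f.ct.mul g.c0).add (f.c0.mul g.ct)⟩, fun t ht x => ?_⟩
  beta_reduce
  rw [hL t ht x, hM t ht x]; ring

lemma HC.rpow {F F1 L : ℝ → ℝ → ℝ} (hF : HC F F1 L) (hpos : ∀ t > 0, ∀ x, 0 < F t x) (p : ℝ) :
    HC (fun t x => F t x ^ p) (fun t x => F1 t x * p * F t x ^ (p - 1))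
      (fun t x => p * F t x ^ (p - 1) * L t x + p * (p - 1) * F t x ^ (p - 2) * F1 t x ^ 2) := by
  obtain ⟨F2, Ft, f, hL⟩ := hF
  have hc : ∀ r : ℝ, ContinuousOn (fun q : ℝ × ℝ => F q.1 q.2 ^ r) HP := fun r =>
    f.c0.rpow_const (fun q hq => Or.inl (hpos q.1 hq.1 q.2).ne')
  refine ⟨fun t x => (F2 t x * p) * F t x ^ (p - 1) +
      (F1 t x * p) * (F1 t x * (p - 1) * F t x ^ (p - 1 - 1)),
    fun t x => Ft t x * p * F t x ^ (p - 1),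
    ⟨fun t ht x => (f.dx t ht x).rpow_const (Or.inl (hpos t ht x).ne'),
      fun t ht x => ((f.dxx t ht x).mul_const p).mul
        ((f.dx t ht x).rpow_const (Or.inl (hpos t ht x).ne')),
      fun t ht x => (f.dt t ht x).rpow_const (Or.inl (hpos t ht x).ne'), hc p,
      (f.c1.mul continuousOn_const).mul (hc _),
      ((f.c2.mul continuousOn_const).mul (hc _)).add ((f.c1.mul continuousOn_const).mul
        ((f.c1.mul continuousOn_const).mul (hc _))),
      (f.ct.mul continuousOn_const).mul (hc _)⟩, fun t ht x => ?_⟩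
  beta_reduce
  rw [hL t ht x, show p - 1 - 1 = p - 2 by ring]; ring

lemma box_int {Q : ℝ → ℝ → ℝ} (hQ : ContinuousOn (fun q : ℝ × ℝ => Q q.1 q.2) HP) {e T R : ℝ}
    (he : 0 < e) : Integrable (fun q : ℝ × ℝ => Q q.1 q.2)
      ((volume.restrict (Set.Icc e T)).prod (volume.restrict (Set.Icc (-R) R))) := by
  rw [Measure.prod_restrict]
  refine (hQ.mono ?_).integrableOn_compact (isCompact_Icc.prod isCompact_Icc)
  rintro ⟨t, x⟩ ⟨h1, -⟩
  exact ⟨he.trans_le h1.1, trivial⟩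

lemma ofReal_setInt_le {f : ℝ → ℝ} (hf0 : ∀ x, 0 ≤ f x) (hfc : Continuous f) {M : ℝ} (hM : 0 ≤ M)
    (h : ∫⁻ x, ENNReal.ofReal (f x) ≤ ENNReal.ofReal M) (R : ℝ) :
    ∫ x in Set.Icc (-R) R, f x ≤ M := by
  rw [← ENNReal.ofReal_le_ofReal_iff hM,
    ofReal_integral_eq_lintegral_ofReal hfc.continuousOn.integrableOn_Icc
      (Filter.Eventually.of_forall hf0)]
  exact (setLIntegral_le_lintegral _ _).trans h

lemma master_box {F F1 L : ℝ → ℝ → ℝ} (hF : HC F F1 L) (h0 : ∀ t > 0, ∀ x, 0 ≤ F t x)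
    (hL0 : ∀ t > 0, ∀ x, 0 ≤ L t x) {M : ℝ} (hM0 : 0 ≤ M)
    (hM : ∀ t > 0, ∫⁻ x, ENNReal.ofReal (F t x) ≤ ENNReal.ofReal M) {e T R : ℝ} (he : 0 < e)
    (heT : e ≤ T) (hR : 0 < R) :
    ∫⁻ q, ENNReal.ofReal ((1 - q.2 ^ 2 / R ^ 2) ^ 2 * L q.1 q.2)
      ∂((volume.restrict (Set.Icc e T)).prod (volume.restrict (Set.Icc (-R) R)))
      ≤ ENNReal.ofReal (8 / R ^ 2 * M * (T - e) + M) := by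
  have hLc := hF.contL
  obtain ⟨F2, Ft, f, hL⟩ := hF
  set χ : ℝ → ℝ := fun x => (1 - x ^ 2 / R ^ 2) ^ 2 with hχ
  set χ1 : ℝ → ℝ := fun x => -4 / R ^ 2 * x * (1 - x ^ 2 / R ^ 2) with hχ1
  set χ2 : ℝ → ℝ := fun x => -4 / R ^ 2 + 12 / R ^ 4 * x ^ 2 with hχ2
  have hcχ : Continuous χ := by simp only [hχ]; fun_prop
  have hcχ1 : Continuous χ1 := by simp only [hχ1]; fun_prop
  have hcχ2 : Continuous χ2 := by simp only [hχ2]; fun_prop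
  have hd1 : ∀ x, HasDerivAt χ (χ1 x) x := by
    intro x
    have := ((((hasDerivAt_id x).pow 2).div_const (R ^ 2)).const_sub 1).pow 2
    refine this.congr_deriv ?_
    simp [hχ1]; ring
  have hd2 : ∀ x, HasDerivAt χ1 (χ2 x) x := by
    intro x
    have := ((hasDerivAt_id x).const_mul (-4 / R ^ 2)).mul
      ((((hasDerivAt_id x).pow 2).div_const (R ^ 2)).const_sub 1)
    refine this.congr_deriv ?_
    simp [hχ2]; field_simp; ring
  have cm : ∀ {c : ℝ → ℝ} {Q : ℝ → ℝ → ℝ}, Continuous c →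
      ContinuousOn (fun q : ℝ × ℝ => Q q.1 q.2) HP →
      ContinuousOn (fun q : ℝ × ℝ => c q.2 * Q q.1 q.2) HP :=
    fun hc hQ => (hc.comp continuous_snd).continuousOn.mul hQ
  have cs : ∀ {Q : ℝ → ℝ → ℝ}, ContinuousOn (fun q : ℝ × ℝ => Q q.1 q.2) HP → ∀ t > 0,
      Continuous (Q t) := by
    intro Q hQ t ht
    have := hQ.comp_continuous (f := fun x : ℝ => (t, x)) (by fun_prop) (fun x => ⟨ht, trivial⟩)
    exact this
  have iL : Integrable (fun q : ℝ × ℝ => χ q.2 * L q.1 q.2)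
      ((volume.restrict (Set.Icc e T)).prod (volume.restrict (Set.Icc (-R) R))) :=
    box_int (Q := fun t x => χ x * L t x) (cm hcχ hLc) he
  have i2 : Integrable (fun q : ℝ × ℝ => χ q.2 * F2 q.1 q.2)
      ((volume.restrict (Set.Icc e T)).prod (volume.restrict (Set.Icc (-R) R))) :=
    box_int (Q := fun t x => χ x * F2 t x) (cm hcχ f.c2) he
  have it : Integrable (fun q : ℝ × ℝ => χ q.2 * Ft q.1 q.2)
      ((volume.restrict (Set.Icc e T)).prod (volume.restrict (Set.Icc (-R) R))) :=
    box_int (Q := fun t x => χ x * Ft t x) (cm hcχ f.ct) he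
  have hmem : ∀ᵐ q ∂((volume.restrict (Set.Icc e T)).prod (volume.restrict (Set.Icc (-R) R))),
      q ∈ Set.Icc e T ×ˢ Set.Icc (-R) R := by
    rw [Measure.prod_restrict]
    exact ae_restrict_mem (measurableSet_Icc.prod measurableSet_Icc)
  rw [← ofReal_integral_eq_lintegral_ofReal iL]
  swap
  · filter_upwards [hmem] with q hq
    exact mul_nonneg (sq_nonneg _) (hL0 q.1 (he.trans_le hq.1.1) q.2)
  apply ENNReal.ofReal_le_ofReal
  have e1 : ∫ q, χ q.2 * L q.1 q.2
      ∂((volume.restrict (Set.Icc e T)).prod (volume.restrict (Set.Icc (-R) R)))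
      = (∫ t in Set.Icc e T, ∫ x in Set.Icc (-R) R, χ x * F2 t x)
        - ∫ x in Set.Icc (-R) R, ∫ t in Set.Icc e T, χ x * Ft t x := by
    rw [← integral_prod _ i2, ← integral_prod_symm _ it, ← integral_sub i2 it]
    apply integral_congr_ae
    filter_upwards [hmem] with q hq
    rw [hL q.1 (he.trans_le hq.1.1) q.2]; ring
  rw [e1]
  have hR2 : R ^ 2 / R ^ 2 = 1 := by field_simp
  have e2 : ∀ t ∈ Set.Icc e T, ∫ x in Set.Icc (-R) R, χ x * F2 t x ≤ 8 / R ^ 2 * M := by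
    intro t ht
    have ht0 : 0 < t := he.trans_le ht.1
    have c2 := cs f.c2 t ht0
    have c0 := cs f.c0 t ht0
    have key : ∫ x in (-R)..R, (χ x * F2 t x - χ2 x * F t x) = 0 := by
      have := intervalIntegral.integral_eq_sub_of_hasDerivAt (a := -R) (b := R)
        (f := fun x => χ x * F1 t x - χ1 x * F t x)
        (f' := fun x => χ x * F2 t x - χ2 x * F t x) ?_ ?_
      · rw [this]
        simp only [hχ, hχ1, neg_sq, hR2]; ring
      · intro x _
        have := ((hd1 x).mul (f.dxx t ht0 x)).sub ((hd2 x).mul (f.dx t ht0 x))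
        refine this.congr_deriv ?_
        ring
      · exact ((hcχ.mul c2).sub (hcχ2.mul c0)).intervalIntegrable _ _
    have ii1 : IntervalIntegrable (fun x => χ x * F2 t x) volume (-R) R :=
      (hcχ.mul c2).intervalIntegrable _ _
    have ii2 : IntervalIntegrable (fun x => χ2 x * F t x) volume (-R) R :=
      (hcχ2.mul c0).intervalIntegrable _ _
    rw [intervalIntegral.integral_sub ii1 ii2, sub_eq_zero,
      intervalIntegral.integral_of_le (by linarith), intervalIntegral.integral_of_le (by linarith),
      ← integral_Icc_eq_integral_Ioc, ← integral_Icc_eq_integral_Ioc] at key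
    rw [key]
    calc ∫ x in Set.Icc (-R) R, χ2 x * F t x ≤ ∫ x in Set.Icc (-R) R, 8 / R ^ 2 * F t x := by
          refine setIntegral_mono_on (hcχ2.mul c0).continuousOn.integrableOn_Icc
            (continuous_const.mul c0).continuousOn.integrableOn_Icc measurableSet_Icc ?_
          intro x hx
          refine mul_le_mul_of_nonneg_right ?_ (h0 t ht0 x)
          have hx2 : x ^ 2 ≤ R ^ 2 := sq_le_sq' hx.1 hx.2
          simp only [hχ2]
          calc -4 / R ^ 2 + 12 / R ^ 4 * x ^ 2 ≤ -4 / R ^ 2 + 12 / R ^ 4 * R ^ 2 := by gcongr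
            _ = 8 / R ^ 2 := by field_simp; ring
      _ = 8 / R ^ 2 * ∫ x in Set.Icc (-R) R, F t x := integral_const_mul _ _
      _ ≤ 8 / R ^ 2 * M := by
          gcongr
          exact ofReal_setInt_le (h0 t ht0) c0 hM0 (hM t ht0) R
  have e3 : ∫ t in Set.Icc e T, ∫ x in Set.Icc (-R) R, χ x * F2 t x ≤ 8 / R ^ 2 * M * (T - e) := by
    calc _ ≤ ∫ t in Set.Icc e T, 8 / R ^ 2 * M := by
          refine setIntegral_mono_on i2.integral_prod_left
            continuous_const.continuousOn.integrableOn_Icc measurableSet_Icc e2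
      _ = _ := by simp [heT]; ring
  have hT0 : 0 < T := he.trans_le heT
  have e4 : ∀ x, ∫ t in Set.Icc e T, χ x * Ft t x = χ x * F T x - χ x * F e x := by
    intro x
    rw [integral_Icc_eq_integral_Ioc, ← intervalIntegral.integral_of_le heT]
    refine intervalIntegral.integral_eq_sub_of_hasDerivAt (f := fun t => χ x * F t x) ?_ ?_
    · intro t ht
      rw [Set.uIcc_of_le heT] at ht
      exact (f.dt t (he.trans_le ht.1) x).const_mul _
    · apply ContinuousOn.intervalIntegrable
      rw [Set.uIcc_of_le heT]
      refine continuousOn_const.mul ?_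
      exact f.ct.comp (f := fun t : ℝ => (t, x)) (by fun_prop)
        (fun t ht => ⟨he.trans_le ht.1, trivial⟩)
  have e5 : -∫ x in Set.Icc (-R) R, ∫ t in Set.Icc e T, χ x * Ft t x ≤ M := by
    simp_rw [e4]
    rw [← integral_neg]
    refine le_trans ?_ (ofReal_setInt_le (h0 e he) (cs f.c0 e he) hM0 (hM e he) R)
    refine setIntegral_mono_on ?_ (cs f.c0 e he).continuousOn.integrableOn_Icc measurableSet_Icc ?_
    · exact (((hcχ.mul (cs f.c0 T hT0)).sub (hcχ.mul (cs f.c0 e he))).neg).continuousOn.integrableOn_Icc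
    · intro x hx
      have h1 := h0 e he x
      have h2 := h0 T hT0 x
      have hx2 : x ^ 2 / R ^ 2 ≤ 1 := by
        rw [div_le_one (by positivity)]; exact sq_le_sq' hx.1 hx.2
      have hx3 : 0 ≤ x ^ 2 / R ^ 2 := by positivity
      have h3 : χ x ≤ 1 := by simp only [hχ]; nlinarith
      have h4 : 0 ≤ χ x := sq_nonneg _
      nlinarith [mul_nonneg h4 h2]
  linarith

lemma master {F F1 L : ℝ → ℝ → ℝ} (hF : HC F F1 L) (h0 : ∀ t > 0, ∀ x, 0 ≤ F t x)
    (hL0 : ∀ t > 0, ∀ x, 0 ≤ L t x) {M : ℝ} (hM0 : 0 ≤ M)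
    (hM : ∀ t > 0, ∫⁻ x, ENNReal.ofReal (F t x) ≤ ENNReal.ofReal M) :
    ∫⁻ t in Set.Ioi (0:ℝ), ∫⁻ x, ENNReal.ofReal (L t x) ≤ ENNReal.ofReal M := by
  have hLc := hF.contL
  have hμ : (volume.restrict (Set.Ioi (0:ℝ))).prod (volume : Measure ℝ)
      = (volume.prod volume).restrict HP := by
    rw [← Measure.prod_restrict, Measure.restrict_univ]
  have hms : MeasurableSet HP := measurableSet_Ioi.prod MeasurableSet.univ
  have hLm : AEMeasurable (fun q : ℝ × ℝ => L q.1 q.2)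
      ((volume.restrict (Set.Ioi (0:ℝ))).prod (volume : Measure ℝ)) := by
    rw [hμ]; exact hLc.aemeasurable hms
  rw [← lintegral_prod (fun q : ℝ × ℝ => ENNReal.ofReal (L q.1 q.2)) hLm.ennreal_ofReal]
  set N : ℕ → ℝ := fun n => (n : ℝ) + 1 with hN
  have hN1 : ∀ n, 1 ≤ N n := fun n => by simp [hN]
  set B : ℕ → Set (ℝ × ℝ) := fun n => Set.Icc (N n)⁻¹ (N n) ×ˢ Set.Icc (-(N n)) (N n) with hB
  have hBm : ∀ n, MeasurableSet (B n) := fun n => measurableSet_Icc.prod measurableSet_Icc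
  set fn : ℕ → ℝ × ℝ → ENNReal := fun n => (B n).indicator
    (fun q => ENNReal.ofReal ((1 - q.2 ^ 2 / (N n) ^ 2) ^ 2 * L q.1 q.2)) with hfn
  have hNt : Filter.Tendsto N Filter.atTop Filter.atTop :=
    Filter.tendsto_atTop_add_const_right _ _ tendsto_natCast_atTop_atTop
  have lim : ∀ q ∈ HP, Filter.Tendsto (fun n => fn n q) Filter.atTop
      (nhds (ENNReal.ofReal (L q.1 q.2))) := by
    rintro ⟨t, x⟩ ⟨ht, -⟩
    have ht : 0 < t := ht
    have hev : ∀ᶠ n in Filter.atTop, fn n (t, x)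
        = ENNReal.ofReal ((1 - x ^ 2 / (N n) ^ 2) ^ 2 * L t x) := by
      filter_upwards [hNt.eventually_ge_atTop t, hNt.eventually_ge_atTop t⁻¹,
        hNt.eventually_ge_atTop |x|] with n h1 h2 h3
      simp only [hfn]
      rw [Set.indicator_of_mem]
      refine ⟨⟨?_, h1⟩, abs_le.1 h3⟩
      exact inv_le_of_inv_le₀ ht h2
    refine Filter.Tendsto.congr' (Filter.EventuallyEq.symm hev) ?_
    apply ENNReal.tendsto_ofReal
    have h1 : Filter.Tendsto (fun n => x ^ 2 / (N n) ^ 2) Filter.atTop (nhds 0) :=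
      Filter.Tendsto.div_atTop tendsto_const_nhds
        ((Filter.tendsto_pow_atTop (by norm_num)).comp hNt)
    have := (((h1.const_sub 1).pow 2).mul_const (L t x))
    simpa using this
  have hmem : ∀ᵐ q ∂((volume.restrict (Set.Ioi (0:ℝ))).prod (volume : Measure ℝ)), q ∈ HP := by
    rw [hμ]; exact ae_restrict_mem hms
  calc ∫⁻ q, ENNReal.ofReal (L q.1 q.2) ∂((volume.restrict (Set.Ioi (0:ℝ))).prod volume)
      = ∫⁻ q, Filter.liminf (fun n => fn n q) Filter.atTop
        ∂((volume.restrict (Set.Ioi (0:ℝ))).prod volume) := by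
        apply lintegral_congr_ae
        filter_upwards [hmem] with q hq
        exact (lim q hq).liminf_eq.symm
    _ ≤ Filter.liminf (fun n => ∫⁻ q, fn n q ∂((volume.restrict (Set.Ioi (0:ℝ))).prod volume))
        Filter.atTop := by
        apply lintegral_liminf_le'
        intro n
        refine AEMeasurable.indicator ?_ (hBm n)
        apply AEMeasurable.ennreal_ofReal
        exact AEMeasurable.mul (by fun_prop) hLm
    _ ≤ Filter.liminf (fun n => ENNReal.ofReal (8 / (N n) * M + M)) Filter.atTop := by
        refine Filter.liminf_le_liminf (Filter.Eventually.of_forall fun n => ?_)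
        have hn := hN1 n
        have hn0 : 0 < N n := by linarith
        have hinv : (N n)⁻¹ ≤ N n := (inv_le_one_of_one_le₀ hn).trans hn
        simp only [hfn]
        rw [lintegral_indicator (hBm n), hμ, Measure.restrict_restrict (hBm n),
          Set.inter_eq_self_of_subset_left, ← Measure.prod_restrict]
        · refine (master_box hF h0 hL0 hM0 hM (e := (N n)⁻¹) (T := N n) (R := N n)
            (by positivity) hinv hn0).trans ?_
          apply ENNReal.ofReal_le_ofReal
          have : N n - (N n)⁻¹ ≤ N n := by have : 0 < (N n)⁻¹ := by positivity
                                           linarith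
          have h8 : 8 / (N n) ^ 2 * M * (N n - (N n)⁻¹) ≤ 8 / (N n) ^ 2 * M * N n := by gcongr
          have h9 : 8 / (N n) ^ 2 * M * N n = 8 / (N n) * M := by field_simp
          linarith
        · rintro ⟨t, x⟩ ⟨h1, -⟩
          exact ⟨lt_of_lt_of_le (by positivity) h1.1, trivial⟩
    _ = ENNReal.ofReal M := by
        apply Filter.Tendsto.liminf_eq
        apply ENNReal.tendsto_ofReal
        have h1 : Filter.Tendsto (fun n => 8 / (N n)) Filter.atTop (nhds 0) :=
          Filter.Tendsto.div_atTop tendsto_const_nhds hNt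
        simpa using (h1.mul_const M).add_const M

end KPV

namespace KPV

/-- p-th power of the L^p norm -/
def Np (p : ℝ) (f : ℝ → ℝ) : ENNReal := ∫⁻ x, ENNReal.ofReal |f x| ^ p

lemma jensen {α : Type*} [MeasurableSpace α] {μ : Measure α} {w f : α → ENNReal}
    (hw : Measurable w) (hf : Measurable f) {p : ℝ} (hp : 1 ≤ p) :
    (∫⁻ a, w a * f a ∂μ) ^ p ≤ (∫⁻ a, w a ∂μ) ^ (p - 1) * ∫⁻ a, w a * f a ^ p ∂μ := by
  have hp0 : 0 < p := by linarith
  have h := ENNReal.lintegral_mul_norm_pow_le (μ := μ) (f := w) (g := fun a => w a * f a ^ p)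
    hw.aemeasurable (hw.mul (hf.pow_const p)).aemeasurable (p := 1 - 1 / p) (q := 1 / p)
    (by rw [sub_nonneg, div_le_one hp0]; exact hp) (by positivity) (by ring)
  have h2 : ∀ a, w a * f a = w a ^ (1 - 1 / p) * (w a * f a ^ p) ^ (1 / p) := by
    intro a
    rw [ENNReal.mul_rpow_of_nonneg _ _ (by positivity), ← mul_assoc,
      ← ENNReal.rpow_add_of_nonneg _ _ (by rw [sub_nonneg, div_le_one hp0]; exact hp)
        (by positivity), ← ENNReal.rpow_mul, mul_one_div_cancel hp0.ne']
    simp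
  simp_rw [h2]
  calc _ ≤ ((∫⁻ a, w a ∂μ) ^ (1 - 1 / p) * (∫⁻ a, w a * f a ^ p ∂μ) ^ (1 / p)) ^ p := by gcongr
    _ = _ := by
      rw [ENNReal.mul_rpow_of_nonneg _ _ hp0.le, ← ENNReal.rpow_mul, ← ENNReal.rpow_mul,
        one_div_mul_cancel hp0.ne', ENNReal.rpow_one, sub_mul, one_div_mul_cancel hp0.ne', one_mul]

lemma lint_hk {t : ℝ} (ht : 0 < t) : ∫⁻ x, ENNReal.ofReal (hk t x) = 1 := by
  rw [← ofReal_integral_eq_lintegral_ofReal (hk_integrable ht)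
    (Filter.Eventually.of_forall (hk_nonneg t)), hk_integral ht, ENNReal.ofReal_one]

lemma lint_hk_sub {t : ℝ} (ht : 0 < t) (x : ℝ) : ∫⁻ y, ENNReal.ofReal (hk t (x - y)) = 1 := by
  rw [lintegral_sub_left_eq_self (fun y => ENNReal.ofReal (hk t y))]; exact lint_hk ht

lemma lint_hk_sub' {t : ℝ} (ht : 0 < t) (y : ℝ) : ∫⁻ x, ENNReal.ofReal (hk t (x - y)) = 1 := by
  rw [lintegral_sub_right_eq_self (fun y => ENNReal.ofReal (hk t y))]; exact lint_hk ht

lemma hk_meas_ofReal (t : ℝ) : Measurable (fun q : ℝ × ℝ => ENNReal.ofReal (hk t (q.1 - q.2))) :=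
  (hk_meas.comp (by fun_prop : Measurable (fun q : ℝ × ℝ => (t, q.1 - q.2)))).ennreal_ofReal

lemma P_ofReal_le (n : ℕ) (h : ℝ → ℝ) (t x : ℝ) :
    ENNReal.ofReal |P n h t x| ≤ ∫⁻ y, ENNReal.ofReal |K n t (x - y)| * ENNReal.ofReal |h y| := by
  unfold P
  rw [← Real.enorm_eq_ofReal_abs]
  refine (enorm_integral_le_lintegral_enorm _).trans (lintegral_mono fun y => ?_)
  beta_reduce
  rw [Real.enorm_eq_ofReal_abs, abs_mul, ENNReal.ofReal_mul (abs_nonneg _)]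

lemma P0_ofReal_le (h : ℝ → ℝ) (t x : ℝ) :
    ENNReal.ofReal |P 0 h t x| ≤ ∫⁻ y, ENNReal.ofReal (hk t (x - y)) * ENNReal.ofReal |h y| := by
  refine (P_ofReal_le 0 h t x).trans (le_of_eq ?_)
  simp only [K, abs_of_nonneg (hk_nonneg _ _)]

lemma P0_ofReal {h : ℝ → ℝ} (hh : Integrable h) (h0 : ∀ x, 0 ≤ h x) {t : ℝ} (ht : 0 < t) (x : ℝ) :
    ENNReal.ofReal (P 0 h t x) = ∫⁻ y, ENNReal.ofReal (hk t (x - y)) * ENNReal.ofReal (h y) := by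
  unfold P
  rw [ofReal_integral_eq_lintegral_ofReal (f := fun y => K 0 t (x - y) * h y)
    (P_ig hh (by omega) ht x)
    (Filter.Eventually.of_forall fun y => mul_nonneg (hk_nonneg _ _) (h0 y))]
  congr 1; ext y
  exact ENNReal.ofReal_mul (hk_nonneg _ _)

lemma Np_contr {h : ℝ → ℝ} (hm : Measurable h) {p : ℝ} (hp : 1 ≤ p) {t : ℝ} (ht : 0 < t) :
    Np p (P 0 h t) ≤ Np p h := by
  unfold Np
  have hmk : ∀ x, Measurable (fun y => ENNReal.ofReal (hk t (x - y))) := fun x =>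
    Measurable.ennreal_ofReal (K_meas1 0 t x)
  have hma : Measurable (fun y => ENNReal.ofReal |h y|) := hm.abs.ennreal_ofReal
  calc ∫⁻ x, ENNReal.ofReal |P 0 h t x| ^ p
      ≤ ∫⁻ x, ∫⁻ y, ENNReal.ofReal (hk t (x - y)) * ENNReal.ofReal |h y| ^ p := by
        refine lintegral_mono fun x => ?_
        refine (ENNReal.rpow_le_rpow (P0_ofReal_le h t x) (by linarith)).trans ?_
        have hj := jensen (μ := volume) (hmk x) hma hp
        rw [lint_hk_sub ht, ENNReal.one_rpow, one_mul] at hj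
        exact hj
    _ = ∫⁻ y, ∫⁻ x, ENNReal.ofReal (hk t (x - y)) * ENNReal.ofReal |h y| ^ p := by
        apply lintegral_lintegral_swap
        refine Measurable.aemeasurable ?_
        exact (hk_meas_ofReal t).mul ((hma.pow_const p).comp measurable_snd)
    _ = ∫⁻ y, ENNReal.ofReal |h y| ^ p := by
        congr 1; ext y
        rw [lintegral_mul_const, lint_hk_sub' ht, one_mul]
        exact Measurable.ennreal_ofReal (hk_meas.comp
          (by fun_prop : Measurable (fun x : ℝ => (t, x - y))))

lemma Np_fin {h : ℝ → ℝ} (hh : Nice h) {p : ℝ} (hp : 1 ≤ p) : Np p h ≠ ⊤ := by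
  obtain ⟨B, hB⟩ := hh.bdd
  have hB0 : 0 ≤ B := (abs_nonneg _).trans (hB 0)
  have h1 : ∀ x, ENNReal.ofReal |h x| ^ p ≤ ENNReal.ofReal B ^ (p - 1) * ENNReal.ofReal |h x| := by
    intro x
    have : ENNReal.ofReal |h x| ^ p = ENNReal.ofReal |h x| ^ (p - 1) * ENNReal.ofReal |h x| := by
      conv_lhs => rw [show p = (p - 1) + 1 by ring]
      rw [ENNReal.rpow_add_of_nonneg _ _ (by linarith) zero_le_one, ENNReal.rpow_one]
    rw [this]
    gcongr
    exact hB x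
  refine ne_top_of_le_ne_top ?_ (lintegral_mono h1)
  rw [lintegral_const_mul _ (by have := hh.meas; fun_prop)]
  refine ENNReal.mul_ne_top (ENNReal.rpow_ne_top_of_nonneg (by linarith) ENNReal.ofReal_ne_top) ?_
  have := hh.int.abs.lintegral_lt_top
  exact this.ne

lemma Np_nonneg_eq {h : ℝ → ℝ} (h0 : ∀ x, 0 ≤ h x) {p : ℝ} (hp : 0 ≤ p) :
    ∫⁻ x, ENNReal.ofReal (h x ^ p) = Np p h := by
  unfold Np
  congr 1; ext x
  rw [abs_of_nonneg (h0 x), ENNReal.ofReal_rpow_of_nonneg (h0 x) hp]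

lemma P_ae_zero {h : ℝ → ℝ} (h0 : h =ᵐ[volume] 0) (n : ℕ) (t x : ℝ) : P n h t x = 0 := by
  unfold P
  rw [integral_eq_zero_of_ae]
  filter_upwards [h0] with y hy
  simp [hy]

lemma master' {F F1 L : ℝ → ℝ → ℝ} (hF : HC F F1 L) (h0 : ∀ t > 0, ∀ x, 0 ≤ F t x)
    {D : ℝ → ℝ → ℝ} {c : ℝ} (hc : 0 < c) (hD : ∀ t > 0, ∀ x, 0 ≤ D t x)
    (hL0 : ∀ t > 0, ∀ x, c * D t x ≤ L t x) {M : ENNReal}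
    (hM : ∀ t > 0, ∫⁻ x, ENNReal.ofReal (F t x) ≤ M) :
    ∫⁻ t in Set.Ioi (0:ℝ), ∫⁻ x, ENNReal.ofReal (D t x) ≤ ENNReal.ofReal c⁻¹ * M := by
  by_cases hMt : M = ⊤
  · rw [hMt, ENNReal.mul_top]
    · exact le_top
    · simpa using hc
  have h1 := master hF h0 (fun t ht x => (mul_nonneg hc.le (hD t ht x)).trans (hL0 t ht x))
    (M := M.toReal) ENNReal.toReal_nonneg (by rw [ENNReal.ofReal_toReal hMt]; exact hM)
  rw [ENNReal.ofReal_toReal hMt] at h1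
  calc ∫⁻ t in Set.Ioi (0:ℝ), ∫⁻ x, ENNReal.ofReal (D t x)
      ≤ ∫⁻ t in Set.Ioi (0:ℝ), ∫⁻ x, ENNReal.ofReal c⁻¹ * ENNReal.ofReal (L t x) := by
        refine setLIntegral_mono' measurableSet_Ioi fun t ht => lintegral_mono fun x => ?_
        rw [← ENNReal.ofReal_mul (by positivity)]
        apply ENNReal.ofReal_le_ofReal
        rw [← div_eq_inv_mul, le_div_iff₀ hc, mul_comm]
        exact hL0 t ht x
    _ = ENNReal.ofReal c⁻¹ * ∫⁻ t in Set.Ioi (0:ℝ), ∫⁻ x, ENNReal.ofReal (L t x) := by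
        simp_rw [lintegral_const_mul' _ _ ENNReal.ofReal_ne_top]
    _ ≤ _ := by gcongr

lemma bell1 {φ : ℝ → ℝ} (hφ : Nice φ) (h0 : ∀ x, 0 ≤ φ x) {p : ℝ} (hp : 1 < p) :
    ∫⁻ t in Set.Ioi (0:ℝ), ∫⁻ x, ENNReal.ofReal (P 0 φ t x ^ (p - 2) * P 1 φ t x ^ 2)
      ≤ ENNReal.ofReal (p * (p - 1))⁻¹ * Np p φ := by
  by_cases hz : φ =ᵐ[volume] 0
  · simp [P_ae_zero hz]
  have hpos : ∀ t > 0, ∀ x, 0 < P 0 φ t x := fun t ht x => P_pos hφ.int h0 hz ht x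
  have hc : 0 < p * (p - 1) := by nlinarith
  refine master' ((HC.heat hφ.int).rpow hpos p) (fun t ht x => ?_) hc (fun t ht x => ?_)
    (fun t ht x => ?_) (fun t ht => ?_)
  · have := hpos t ht x; positivity
  · have := hpos t ht x; positivity
  · apply le_of_eq; ring
  · rw [Np_nonneg_eq (P_nonneg h0 t) (by linarith)]
    exact Np_contr hφ.meas hp.le ht

lemma bell2 {w g : ℝ → ℝ} (hw : Nice w) (h0 : ∀ x, 0 ≤ w x) (hg : Integrable g)
    (hg1 : ∀ x, |g x| ≤ 1) {p : ℝ} (hp : 1 < p) :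
    ∫⁻ t in Set.Ioi (0:ℝ), ∫⁻ x, ENNReal.ofReal (P 0 w t x ^ p * P 1 g t x ^ 2)
      ≤ ENNReal.ofReal (4 * p / (p - 1) + 1) * Np p w := by
  by_cases hz : w =ᵐ[volume] 0
  · have : p ≠ 0 := by linarith
    simp [P_ae_zero hz, this]
  have hpos : ∀ t > 0, ∀ x, 0 < P 0 w t x := fun t ht x => P_pos hw.int h0 hz ht x
  have hp1 : 0 < p - 1 := by linarith
  set A := 4 * p / (p - 1) with hA
  have hA0 : 0 < A := by positivity
  have hAp : A * (p * (p - 1)) = 4 * p ^ 2 := by rw [hA]; field_simp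
  have key := ((HC.heat hw.int).rpow hpos p).mul
    ((HC.const A).add ((HC.heat hg).mul (HC.heat hg)))
  have := master' (c := 1) (M := ENNReal.ofReal (A + 1) * Np p w)
    (D := fun t x => P 0 w t x ^ p * P 1 g t x ^ 2) key (fun t ht x => ?_) one_pos
    (fun t ht x => ?_) (fun t ht x => ?_) (fun t ht => ?_)
  · simpa using this
  · have := hpos t ht x
    have h2 := mul_self_nonneg (P 0 g t x)
    exact mul_nonneg (by positivity) (by positivity)
  · have := hpos t ht x; positivity
  · beta_reduce
    have hw0 := hpos t ht x
    set W := P 0 w t x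
    set W1 := P 1 w t x
    set G := P 0 g t x
    set G1 := P 1 g t x
    have e1 : W ^ p = W ^ (p - 2) * W ^ 2 := by
      rw [← Real.rpow_natCast, ← Real.rpow_add hw0]; norm_num
    have e2 : W ^ (p - 1) = W ^ (p - 2) * W := by
      conv_rhs => rw [← Real.rpow_one W, ← Real.rpow_mul hw0.le, ← Real.rpow_add hw0]
      congr 1; ring
    rw [e1, e2]
    have hV : 0 < W ^ (p - 2) := Real.rpow_pos_of_pos hw0 _
    set V := W ^ (p - 2)
    have : (p * (V * W) * 0 + p * (p - 1) * V * W1 ^ 2) * (A + G * G) +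
        V * W ^ 2 * (0 + (0 * G + G * 0 + 2 * (G1 * G1))) +
        2 * (W1 * p * (V * W) * (0 + (G1 * G + G * G1))) - 1 * (V * W ^ 2 * G1 ^ 2)
        = V * ((W * G1 + 2 * p * W1 * G) ^ 2 + p * (p - 1) * W1 ^ 2 * G ^ 2
          + 4 * p ^ 2 * W1 ^ 2 * (1 - G ^ 2)) := by
      linear_combination (V * W1 ^ 2) * hAp
    have hG : G ^ 2 ≤ 1 := by
      have := P0_abs_le hg1 ht x
      rw [← sq_abs]
      exact pow_le_one₀ (abs_nonneg _) this
    have h3 : 0 ≤ 4 * p ^ 2 * W1 ^ 2 * (1 - G ^ 2) := mul_nonneg (by positivity) (by linarith)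
    have h4 : 0 ≤ p * (p - 1) * W1 ^ 2 * G ^ 2 := by positivity
    have h5 : 0 ≤ V * ((W * G1 + 2 * p * W1 * G) ^ 2 + p * (p - 1) * W1 ^ 2 * G ^ 2
          + 4 * p ^ 2 * W1 ^ 2 * (1 - G ^ 2)) := by positivity
    linarith
  · calc ∫⁻ x, ENNReal.ofReal (P 0 w t x ^ p * (A + P 0 g t x * P 0 g t x))
        ≤ ∫⁻ x, ENNReal.ofReal (A + 1) * ENNReal.ofReal (P 0 w t x ^ p) := by
          refine lintegral_mono fun x => ?_
          beta_reduce
          rw [← ENNReal.ofReal_mul (by positivity), mul_comm (A + 1)]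
          apply ENNReal.ofReal_le_ofReal
          have hw0 := hpos t ht x
          have hG : P 0 g t x * P 0 g t x ≤ 1 := by
            have := P0_abs_le hg1 ht x
            rw [← abs_mul_abs_self]
            exact mul_le_one₀ this (abs_nonneg _) this
          gcongr
      _ = ENNReal.ofReal (A + 1) * Np p (P 0 w t) := by
          rw [lintegral_const_mul' _ _ ENNReal.ofReal_ne_top,
            Np_nonneg_eq (P_nonneg h0 t) (by linarith)]
      _ ≤ _ := by
          gcongr
          exact Np_contr hw.meas hp.le ht

end KPV

namespace KPV

lemma rpow_split2 {a : ℝ} (ha : 0 < a) (p : ℝ) : a ^ p = a ^ (p - 2) * a ^ 2 := by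
  rw [← Real.rpow_natCast, ← Real.rpow_add ha]; norm_num

lemma rpow_split1 {a : ℝ} (ha : 0 < a) (p : ℝ) : a ^ (p - 1) = a ^ (p - 2) * a := by
  conv_rhs => rw [← Real.rpow_one a, ← Real.rpow_mul ha.le, ← Real.rpow_add ha]
  congr 1; ring

lemma bell3_alg {u ux m mx Lm S σ C0 : ℝ} (hS : 0 < S) (hLm : 0 ≤ Lm) (hC : 0 ≤ C0)
    (hm : 0 < m) (h1 : u ^ 2 * (S * m) ≤ 1) (h2 : mx ^ 2 ≤ C0 * m * Lm) (hσ0 : 0 < σ) (hσ1 : σ < 1) :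
    ux ^ 2 * (S * m ^ 2) ≤
      (0 * u + u * 0 + 2 * (ux * ux)) * (S * m ^ 2) +
        u * u * (σ * (S * m) * Lm + σ * (σ - 1) * S * mx ^ 2) +
        2 * ((ux * u + u * ux) * (mx * σ * (S * m))) + 5 * C0 * Lm := by
  have h3 : u ^ 2 * S * mx ^ 2 ≤ C0 * Lm := by
    calc u ^ 2 * S * mx ^ 2 ≤ u ^ 2 * S * (C0 * m * Lm) := by gcongr
      _ = (u ^ 2 * (S * m)) * (C0 * Lm) := by ring
      _ ≤ 1 * (C0 * Lm) := by gcongr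
      _ = _ := one_mul _
  have h4 : 0 ≤ S * (ux * m + 2 * u * σ * mx) ^ 2 := by positivity
  have h5 : 0 ≤ u ^ 2 * (σ * (S * m) * Lm) := by positivity
  have h6 : (4 * σ ^ 2 + σ * (1 - σ)) * (u ^ 2 * S * mx ^ 2) ≤ 5 * (C0 * Lm) := by
    have : 0 ≤ u ^ 2 * S * mx ^ 2 := by positivity
    have h7 : 4 * σ ^ 2 + σ * (1 - σ) ≤ 5 := by nlinarith
    have h8 : 0 ≤ 4 * σ ^ 2 + σ * (1 - σ) := by nlinarith
    exact mul_le_mul h7 h3 this (by norm_num)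
  nlinarith

lemma bell3 {φ ψ : ℝ → ℝ} (hφ : Nice φ) (h0 : ∀ x, 0 ≤ φ x) (hψ : Nice ψ) (h0' : ∀ x, 0 ≤ ψ x)
    {p r : ℝ} (hp : 2 < p) (hr : r = p / (p - 2)) :
    ∃ C : ℝ, C = 1 + 5 * (2 * (p / (p - 1) + r / (r - 1))) ∧
    ∫⁻ t in Set.Ioi (0:ℝ), ∫⁻ x, ENNReal.ofReal (P 1 φ t x ^ 2 * P 0 ψ t x)
      ≤ ENNReal.ofReal C * (Np p φ + Np r ψ) := by
  refine ⟨_, rfl, ?_⟩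
  by_cases hz : φ =ᵐ[volume] 0
  · simp [P_ae_zero hz]
  by_cases hz' : ψ =ᵐ[volume] 0
  · simp [P_ae_zero hz']
  have hpos : ∀ t > 0, ∀ x, 0 < P 0 φ t x := fun t ht x => P_pos hφ.int h0 hz ht x
  have hpos' : ∀ t > 0, ∀ x, 0 < P 0 ψ t x := fun t ht x => P_pos hψ.int h0' hz' ht x
  have hp2 : 0 < p - 2 := by linarith
  have hp1 : 0 < p - 1 := by linarith
  have hr1 : 0 < r - 1 := by
    rw [hr, sub_pos, lt_div_iff₀ hp2]; linarith
  have hr0 : 0 < r := by linarith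
  set C0 := 2 * (p / (p - 1) + r / (r - 1)) with hC0
  have hC0p : 0 < C0 := by positivity
  set σ : ℝ := 1 / r with hσ
  have hσ0 : 0 < σ := by positivity
  have hσ1 : σ < 1 := by rw [hσ, div_lt_one hr0]; linarith
  have hσ2 : p * (1 - σ) = 2 := by rw [hσ, hr]; field_simp; ring
  have hm : HC _ _ _ := ((HC.heat hφ.int).rpow hpos p).add ((HC.heat hψ.int).rpow hpos' r)
  have hmpos : ∀ t > 0, ∀ x, 0 < P 0 φ t x ^ p + P 0 ψ t x ^ r := fun t ht x => by
    have := hpos t ht x; have := hpos' t ht x; positivity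
  have key := (((HC.heat hφ.int).mul (HC.heat hφ.int)).mul (hm.rpow hmpos σ)).add
    ((HC.const (5 * C0)).mul hm)
  have hu2 : ∀ t > 0, ∀ x, P 0 φ t x ^ 2 * (P 0 φ t x ^ p + P 0 ψ t x ^ r) ^ (σ - 1) ≤ 1 := by
    intro t ht x
    have h1 := hpos t ht x
    have h2 := hpos' t ht x
    have h3 := hmpos t ht x
    have h4 : P 0 φ t x ^ 2 = (P 0 φ t x ^ p) ^ (1 - σ) := by
      rw [← Real.rpow_mul h1.le, hσ2, Real.rpow_two]
    have h5 : 0 < P 0 ψ t x ^ r := Real.rpow_pos_of_pos h2 _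
    calc P 0 φ t x ^ 2 * (P 0 φ t x ^ p + P 0 ψ t x ^ r) ^ (σ - 1)
        ≤ (P 0 φ t x ^ p + P 0 ψ t x ^ r) ^ (1 - σ) *
          (P 0 φ t x ^ p + P 0 ψ t x ^ r) ^ (σ - 1) := by
          rw [h4]; gcongr
          linarith
      _ = 1 := by rw [← Real.rpow_add h3]; simp
  have := master' (c := 1) (M := ENNReal.ofReal (1 + 5 * C0) * (Np p φ + Np r ψ))
    (D := fun t x => P 1 φ t x ^ 2 * P 0 ψ t x) key (fun t ht x => ?_) one_pos
    (fun t ht x => ?_) (fun t ht x => ?_) (fun t ht => ?_)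
  · simpa using this
  · have h1 := hpos t ht x
    have h2 := hmpos t ht x
    positivity
  · have := hpos' t ht x; positivity
  · beta_reduce
    have hu := hpos t ht x
    have hv := hpos' t ht x
    have hmp := hmpos t ht x
    have h1 := hu2 t ht x
    rw [rpow_split1 hmp] at h1
    rw [rpow_split2 hmp σ, rpow_split1 hmp]
    have hvm : P 0 ψ t x ≤ (P 0 φ t x ^ p + P 0 ψ t x ^ r) ^ (σ - 2) *
        (P 0 φ t x ^ p + P 0 ψ t x ^ r) ^ 2 := by
      rw [← rpow_split2 hmp]
      calc P 0 ψ t x = (P 0 ψ t x ^ r) ^ σ := by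
            rw [← Real.rpow_mul hv.le, hσ, mul_one_div_cancel hr0.ne', Real.rpow_one]
        _ ≤ _ := by gcongr; have := Real.rpow_pos_of_pos hu p; linarith
    set u := P 0 φ t x
    set v := P 0 ψ t x
    set ux := P 1 φ t x
    set vx := P 1 ψ t x
    have hS : 0 < (u ^ p + v ^ r) ^ (σ - 2) := Real.rpow_pos_of_pos hmp _
    set S := (u ^ p + v ^ r) ^ (σ - 2)
    have hLm : 0 ≤ p * u ^ (p - 1) * 0 + p * (p - 1) * u ^ (p - 2) * ux ^ 2 +
      (r * v ^ (r - 1) * 0 + r * (r - 1) * v ^ (r - 2) * vx ^ 2) := by positivity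
    have hmx : (ux * p * u ^ (p - 1) + vx * r * v ^ (r - 1)) ^ 2 ≤ C0 * (u ^ p + v ^ r) *
        (p * u ^ (p - 1) * 0 + p * (p - 1) * u ^ (p - 2) * ux ^ 2 +
      (r * v ^ (r - 1) * 0 + r * (r - 1) * v ^ (r - 2) * vx ^ 2)) := by
      rw [rpow_split1 hu, rpow_split1 hv, rpow_split2 hu p, rpow_split2 hv r]
      have hV : 0 < u ^ (p - 2) := Real.rpow_pos_of_pos hu _
      have hV' : 0 < v ^ (r - 2) := Real.rpow_pos_of_pos hv _
      set V := u ^ (p - 2)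
      set V' := v ^ (r - 2)
      set X := p * (p - 1) * V * ux ^ 2 with hX
      set Y := r * (r - 1) * V' * vx ^ 2 with hY
      have hXp : 0 ≤ X := by positivity
      have hYp : 0 ≤ Y := by positivity
      have e1 : (ux * p * (V * u)) ^ 2 = p / (p - 1) * (V * u ^ 2) * X := by
        rw [hX]; field_simp
      have e2 : (vx * r * (V' * v)) ^ 2 = r / (r - 1) * (V' * v ^ 2) * Y := by
        rw [hY]; field_simp
      have a1 : 0 ≤ p / (p - 1) := by positivity
      have a2 : 0 ≤ r / (r - 1) := by positivity
      have b1 : 0 ≤ V * u ^ 2 := by positivity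
      have b2 : 0 ≤ V' * v ^ 2 := by positivity
      set aa := p / (p - 1)
      set bb := r / (r - 1)
      set cc := V * u ^ 2
      set dd := V' * v ^ 2
      have f1 := sq_nonneg (ux * p * (V * u) - vx * r * (V' * v))
      have g1 : 0 ≤ aa * cc * Y := by positivity
      have g2 : 0 ≤ aa * dd * Y := by positivity
      have g3 : 0 ≤ aa * dd * X := by positivity
      have g4 : 0 ≤ bb * cc * Y := by positivity
      have g5 : 0 ≤ bb * cc * X := by positivity
      have g6 : 0 ≤ bb * dd * X := by positivity
      simp only [mul_zero, zero_add]
      rw [hC0]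
      nlinarith
    have := bell3_alg (ux := ux) hS hLm hC0p.le hmp h1 hmx hσ0 hσ1
    have h9 : 1 * (ux ^ 2 * v) ≤ ux ^ 2 * (S * (u ^ p + v ^ r) ^ 2) := by
      rw [one_mul]; gcongr
    refine h9.trans (this.trans (le_of_eq ?_))
    ring
  · calc ∫⁻ x, ENNReal.ofReal (P 0 φ t x * P 0 φ t x * (P 0 φ t x ^ p + P 0 ψ t x ^ r) ^ σ
          + 5 * C0 * (P 0 φ t x ^ p + P 0 ψ t x ^ r))
        ≤ ∫⁻ x, ENNReal.ofReal (1 + 5 * C0) *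
          (ENNReal.ofReal (P 0 φ t x ^ p) + ENNReal.ofReal (P 0 ψ t x ^ r)) := by
          refine lintegral_mono fun x => ?_
          have hu := hpos t ht x
          have hv := hpos' t ht x
          have hmp := hmpos t ht x
          have h1 := hu2 t ht x
          rw [← ENNReal.ofReal_add (by positivity) (by positivity),
            ← ENNReal.ofReal_mul (by positivity)]
          apply ENNReal.ofReal_le_ofReal
          have h2 : (P 0 φ t x ^ p + P 0 ψ t x ^ r) ^ σ =
            (P 0 φ t x ^ p + P 0 ψ t x ^ r) ^ (σ - 1) * (P 0 φ t x ^ p + P 0 ψ t x ^ r) := by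
            conv_rhs => rw [mul_comm]
            rw [← Real.rpow_one_add' hmp.le (by simpa using hσ0.ne')]; congr 1; ring
          rw [h2]
          have h3 : P 0 φ t x * P 0 φ t x * ((P 0 φ t x ^ p + P 0 ψ t x ^ r) ^ (σ - 1) * (P 0 φ t x ^ p + P 0 ψ t x ^ r)) = (P 0 φ t x ^ 2 * (P 0 φ t x ^ p + P 0 ψ t x ^ r) ^ (σ - 1)) * (P 0 φ t x ^ p + P 0 ψ t x ^ r) := by ring
          rw [h3, add_mul]
          gcongr
      _ = ENNReal.ofReal (1 + 5 * C0) * (Np p (P 0 φ t) + Np r (P 0 ψ t)) := by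
          rw [lintegral_const_mul' _ _ ENNReal.ofReal_ne_top, lintegral_add_left,
            Np_nonneg_eq (P_nonneg h0 t) (by linarith), Np_nonneg_eq (P_nonneg h0' t) (by linarith)]
          exact ((P_cont hφ.int (by omega) ht).measurable.pow_const p).ennreal_ofReal
      _ ≤ _ := by
          gcongr
          · exact Np_contr hφ.meas (by linarith) ht
          · exact Np_contr hψ.meas (by linarith) ht

end KPV

namespace KPV

lemma lint_scale (F : ℝ → ENNReal) {a : ℝ} (ha : 0 < a) :
    ∫⁻ t in Set.Ioi (0:ℝ), F (a * t) = ENNReal.ofReal a⁻¹ * ∫⁻ t in Set.Ioi (0:ℝ), F t := by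
  rw [← lintegral_indicator measurableSet_Ioi, ← lintegral_indicator measurableSet_Ioi]
  have h1 : ∀ t, (Set.Ioi (0:ℝ)).indicator (fun t => F (a * t)) t
      = (Set.Ioi (0:ℝ)).indicator F (a * t) := by
    intro t
    by_cases ht : 0 < t
    · rw [Set.indicator_of_mem (by exact ht), Set.indicator_of_mem (by exact mul_pos ha ht)]
    · rw [Set.indicator_of_notMem (by exact ht), Set.indicator_of_notMem]
      intro h
      exact ht ((mul_pos_iff_of_pos_left ha).1 h)
  simp_rw [h1]
  have h2 := (Homeomorph.mulLeft₀ a ha.ne').measurableEmbedding.lintegral_map (μ := volume)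
    ((Set.Ioi (0:ℝ)).indicator F)
  have h3 : (Homeomorph.mulLeft₀ a ha.ne' : ℝ → ℝ) = fun t => a * t := rfl
  rw [h3, Real.map_volume_mul_left ha.ne', lintegral_smul_measure,
    abs_of_pos (inv_pos.2 ha)] at h2
  exact h2.symm

lemma avg_sq {W : ℝ → ℝ} (hW : Measurable W) {r : ℝ} (hr : 0 < r) (x : ℝ) :
    ENNReal.ofReal (P 0 (fun y => |W y|) r x ^ 2) ≤
      ∫⁻ y, ENNReal.ofReal (hk r (x - y)) * ENNReal.ofReal (W y ^ 2) := by
  have h0 : 0 ≤ P 0 (fun y => |W y|) r x := P_nonneg (fun y => abs_nonneg _) r x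
  have h1 := P0_ofReal_le (fun y => |W y|) r x
  have hmk : Measurable (fun y => ENNReal.ofReal (hk r (x - y))) :=
    Measurable.ennreal_ofReal (K_meas1 0 r x)
  have hma : Measurable (fun y => ENNReal.ofReal |W y|) := hW.abs.ennreal_ofReal
  have hj := jensen (μ := volume) hmk hma (p := 2) (by norm_num)
  rw [lint_hk_sub hr, ENNReal.one_rpow, one_mul] at hj
  rw [abs_of_nonneg h0] at h1
  simp only [abs_abs] at h1
  rw [ENNReal.ofReal_pow h0]
  calc _ ≤ (∫⁻ y, ENNReal.ofReal (hk r (x - y)) * ENNReal.ofReal |W y|) ^ (2:ℝ) := by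
        rw [ENNReal.rpow_two]; gcongr
    _ ≤ _ := hj
    _ = _ := by
        congr 1; ext y
        rw [ENNReal.rpow_two, ← ENNReal.ofReal_pow (abs_nonneg _), sq_abs]

lemma avg_dom {w : ℝ → ℝ} (hw : Integrable w) {j : ℕ} (hj1 : 1 ≤ j) (hj2 : j ≤ 2)
    {t : ℝ} (ht : 0 < t) (x : ℝ) :
    ENNReal.ofReal (t ^ (j - 1) * P j w t x ^ 2) ≤ ENNReal.ofReal 40 *
      ∫⁻ y, ENNReal.ofReal (hk (t / 5) (x - y)) * ENNReal.ofReal (P 1 w (9 / 10 * t) y ^ 2) := by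
  have hr : 0 < t / 10 := by positivity
  have hs : 0 < 9 / 10 * t := by positivity
  have hW := P_cont hw (n := 1) (by omega) hs
  have hWi := Pn_int hw (n := 1) (by omega) hs
  have h1 : P j w t x = P (j - 1) (P 1 w (9 / 10 * t)) (t / 10) x := by
    have e : t / 10 + 9 / 10 * t = t := by ring
    obtain rfl | rfl : j = 1 ∨ j = 2 := by omega
    · rw [P_semi1 hw hr hs, e]
    · rw [P_semi2 hw hr hs, e]
  have h2 := P_abs_le hWi (n := j - 1) (by omega) hr x
  rw [← h1, show 2 * (t / 10) = t / 5 by ring] at h2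
  have h3 := avg_sq hW.measurable (r := t / 5) (by positivity) x
  have h4 : t ^ (j - 1) * P j w t x ^ 2 ≤
      40 * P 0 (fun y => |P 1 w (9 / 10 * t) y|) (t / 5) x ^ 2 := by
    have h5 : P j w t x ^ 2 ≤ (2 * (√(t / 10))⁻¹ ^ (j - 1) *
        P 0 (fun y => |P 1 w (9 / 10 * t) y|) (t / 5) x) ^ 2 := by
      rw [← sq_abs]; gcongr
    have h6 : (√(t / 10))⁻¹ ^ 2 = 10 / t := by
      rw [inv_pow, Real.sq_sqrt hr.le]; field_simp
    calc t ^ (j - 1) * P j w t x ^ 2 ≤ t ^ (j - 1) * (2 * (√(t / 10))⁻¹ ^ (j - 1) *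
        P 0 (fun y => |P 1 w (9 / 10 * t) y|) (t / 5) x) ^ 2 := by gcongr
      _ = 4 * (t * (√(t / 10))⁻¹ ^ 2) ^ (j - 1) *
        P 0 (fun y => |P 1 w (9 / 10 * t) y|) (t / 5) x ^ 2 := by
          rw [mul_pow t, ← pow_mul]; ring
      _ ≤ _ := by
          rw [h6]
          have : t * (10 / t) = 10 := by field_simp
          rw [this]
          gcongr
          obtain rfl | rfl : j = 1 ∨ j = 2 := by omega
          · norm_num
          · norm_num
  refine (ENNReal.ofReal_le_ofReal h4).trans ?_
  rw [ENNReal.ofReal_mul (by norm_num)]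
  gcongr

lemma avg_int {w : ℝ → ℝ} (hw : Integrable w) {j : ℕ} (hj1 : 1 ≤ j) (hj2 : j ≤ 2)
    {V V' : ℝ → ℝ → ENNReal} (hV : ∀ t > 0, Measurable (V t)) {C : ENNReal} (hC : C ≠ ⊤)
    (h : ∀ t > 0, ∀ y, ∫⁻ x, ENNReal.ofReal (hk (t / 5) (x - y)) * V t x ≤ C * V' (9 / 10 * t) y) :
    ∫⁻ t in Set.Ioi (0:ℝ), ∫⁻ x, ENNReal.ofReal (t ^ (j - 1) * P j w t x ^ 2) * V t x ≤
      ENNReal.ofReal 50 * C *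
        ∫⁻ t in Set.Ioi (0:ℝ), ∫⁻ x, ENNReal.ofReal (P 1 w t x ^ 2) * V' t x := by
  have hstep : ∀ t > 0, ∫⁻ x, ENNReal.ofReal (t ^ (j - 1) * P j w t x ^ 2) * V t x ≤
      ENNReal.ofReal 40 * ∫⁻ y, C *
        (ENNReal.ofReal (P 1 w (9 / 10 * t) y ^ 2) * V' (9 / 10 * t) y) := by
    intro t ht
    have hs : 0 < 9 / 10 * t := by positivity
    have hW := (P_cont hw (n := 1) (by omega) hs).measurable
    calc _ ≤ ∫⁻ x, ENNReal.ofReal 40 * ∫⁻ y, ENNReal.ofReal (hk (t / 5) (x - y)) *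
          ENNReal.ofReal (P 1 w (9 / 10 * t) y ^ 2) * V t x := by
          refine lintegral_mono fun x => ?_
          rw [lintegral_mul_const _ (by
            exact (Measurable.ennreal_ofReal (K_meas1 0 (t / 5) x)).mul
              (hW.pow_const 2).ennreal_ofReal), ← mul_assoc]
          gcongr
          exact avg_dom hw hj1 hj2 ht x
      _ = ENNReal.ofReal 40 * ∫⁻ x, ∫⁻ y, ENNReal.ofReal (hk (t / 5) (x - y)) *
          ENNReal.ofReal (P 1 w (9 / 10 * t) y ^ 2) * V t x :=
          lintegral_const_mul' _ _ ENNReal.ofReal_ne_top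
      _ = ENNReal.ofReal 40 * ∫⁻ y, ∫⁻ x, ENNReal.ofReal (hk (t / 5) (x - y)) *
          ENNReal.ofReal (P 1 w (9 / 10 * t) y ^ 2) * V t x := by
          congr 1
          apply lintegral_lintegral_swap
          refine Measurable.aemeasurable ?_
          exact ((hk_meas_ofReal (t / 5)).mul
            ((hW.pow_const 2).ennreal_ofReal.comp measurable_snd)).mul
              ((hV t ht).comp measurable_fst)
      _ ≤ _ := by
          gcongr with y
          calc _ = ∫⁻ x, ENNReal.ofReal (P 1 w (9 / 10 * t) y ^ 2) *
                (ENNReal.ofReal (hk (t / 5) (x - y)) * V t x) := by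
                congr 1; ext x; ring
            _ = ENNReal.ofReal (P 1 w (9 / 10 * t) y ^ 2) *
                ∫⁻ x, ENNReal.ofReal (hk (t / 5) (x - y)) * V t x :=
                lintegral_const_mul' _ _ ENNReal.ofReal_ne_top
            _ ≤ ENNReal.ofReal (P 1 w (9 / 10 * t) y ^ 2) * (C * V' (9 / 10 * t) y) := by
                gcongr; exact h t ht y
            _ = _ := by ring
  calc _ ≤ ∫⁻ t in Set.Ioi (0:ℝ), ENNReal.ofReal 40 * (C * ∫⁻ y,
        (ENNReal.ofReal (P 1 w (9 / 10 * t) y ^ 2) * V' (9 / 10 * t) y)) := by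
        refine setLIntegral_mono' measurableSet_Ioi fun t ht => ?_
        refine (hstep t ht).trans (le_of_eq ?_)
        rw [lintegral_const_mul' _ _ hC]
    _ = ENNReal.ofReal 40 * (C * ∫⁻ t in Set.Ioi (0:ℝ), ∫⁻ y,
        (ENNReal.ofReal (P 1 w (9 / 10 * t) y ^ 2) * V' (9 / 10 * t) y)) := by
        rw [lintegral_const_mul' _ _ ENNReal.ofReal_ne_top, lintegral_const_mul' _ _ hC]
    _ ≤ _ := by
        rw [lint_scale (fun t => ∫⁻ y, (ENNReal.ofReal (P 1 w t y ^ 2) * V' t y)) (by norm_num)]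
        calc _ = (ENNReal.ofReal 40 * ENNReal.ofReal (9 / 10)⁻¹) * C *
              ∫⁻ t in Set.Ioi (0:ℝ), ∫⁻ x, ENNReal.ofReal (P 1 w t x ^ 2) * V' t x := by ring
          _ ≤ _ := by
              rw [← ENNReal.ofReal_mul (by norm_num)]
              gcongr; norm_num

lemma hk_harnack {t1 t2 : ℝ} (h1 : 0 < t1) (h2 : t1 < t2) (a b : ℝ) :
    hk t1 a ≤ √(t2 / t1) * exp (b ^ 2 / (4 * (t2 - t1))) * hk t2 (a + b) := by
  unfold hk
  have h3 : 0 < t2 := h1.trans h2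
  have h4 : 0 < t2 - t1 := by linarith
  have e1 : √(4 * π * t2) = √(t2 / t1) * √(4 * π * t1) := by
    rw [← Real.sqrt_mul (by positivity)]; congr 1; field_simp
  have e2 : (√(4 * π * t1))⁻¹ = √(t2 / t1) * (√(4 * π * t2))⁻¹ := by
    rw [e1]; field_simp
  rw [e2]
  have e3 : -a ^ 2 / (4 * t1) ≤ b ^ 2 / (4 * (t2 - t1)) + -(a + b) ^ 2 / (4 * t2) := by
    have : b ^ 2 / (4 * (t2 - t1)) + -(a + b) ^ 2 / (4 * t2) - -a ^ 2 / (4 * t1)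
        = (a * (t2 - t1) - b * t1) ^ 2 / (4 * t1 * t2 * (t2 - t1)) := by
      field_simp; ring
    have h0 : 0 ≤ (a * (t2 - t1) - b * t1) ^ 2 / (4 * t1 * t2 * (t2 - t1)) := by positivity
    linarith
  calc √(t2 / t1) * (√(4 * π * t2))⁻¹ * exp (-a ^ 2 / (4 * t1))
      ≤ √(t2 / t1) * (√(4 * π * t2))⁻¹ *
        exp (b ^ 2 / (4 * (t2 - t1)) + -(a + b) ^ 2 / (4 * t2)) := by gcongr
    _ = _ := by rw [exp_add]; ring

lemma harnack {h : ℝ → ℝ} (hh : Integrable h) (h0 : ∀ x, 0 ≤ h x) {t1 t2 : ℝ} (h1 : 0 < t1)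
    (h2 : t1 < t2) (x y : ℝ) :
    P 0 h t1 y ≤ √(t2 / t1) * exp ((x - y) ^ 2 / (4 * (t2 - t1))) * P 0 h t2 x := by
  unfold P
  rw [← integral_const_mul]
  refine integral_mono (P_ig hh (by omega) h1 y)
    ((P_ig hh (n := 0) (by omega) (h1.trans h2) x).const_mul _) fun z => ?_
  have := hk_harnack h1 h2 (y - z) (x - y)
  rw [show y - z + (x - y) = x - z by ring] at this
  calc hk t1 (y - z) * h z ≤ _ := mul_le_mul_of_nonneg_right this (h0 z)
    _ = _ := by rw [mul_assoc]; rfl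

lemma harnackA {h : ℝ → ℝ} (hh : Integrable h) (h0 : ∀ x, 0 ≤ h x) {t : ℝ} (ht : 0 < t) (x y : ℝ) :
    P 0 h (9 / 10 * t) y ≤ 3 * exp (5 * (x - y) ^ 2 / (16 * t)) * P 0 h (2 * t) x := by
  refine (harnack hh h0 (t2 := 2 * t) (by positivity) (by linarith) x y).trans ?_
  have := P_nonneg h0 (2 * t) x
  have he : (x - y) ^ 2 / (4 * (2 * t - 9 / 10 * t)) ≤ 5 * (x - y) ^ 2 / (16 * t) := by
    rw [div_le_div_iff₀ (by linarith) (by positivity)]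
    nlinarith [mul_nonneg (sq_nonneg (x - y)) ht.le]
  have hq : √(2 * t / (9 / 10 * t)) ≤ 3 := by
    rw [Real.sqrt_le_left (by norm_num), div_le_iff₀ (by positivity)]; linarith
  have he' := exp_le_exp.2 he
  have := mul_le_mul hq he' (exp_pos _).le (by norm_num)
  gcongr

lemma harnackB {h : ℝ → ℝ} (hh : Integrable h) (h0 : ∀ x, 0 ≤ h x) {t : ℝ} (ht : 0 < t) (x y : ℝ) :
    P 0 h (1 / 10 * t) x ≤ 3 * exp (5 * (x - y) ^ 2 / (16 * t)) * P 0 h (9 / 10 * t) y := by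
  refine (harnack hh h0 (t2 := 9 / 10 * t) (by positivity) (by linarith) y x).trans ?_
  have := P_nonneg h0 (9 / 10 * t) y
  have he : (y - x) ^ 2 / (4 * (9 / 10 * t - 1 / 10 * t)) ≤ 5 * (x - y) ^ 2 / (16 * t) := by
    rw [div_le_div_iff₀ (by linarith) (by positivity)]
    nlinarith [mul_nonneg (sq_nonneg (x - y)) ht.le]
  have hq : √(9 / 10 * t / (1 / 10 * t)) ≤ 3 := by
    rw [Real.sqrt_le_left (by norm_num), div_le_iff₀ (by positivity)]; linarith
  have he' := exp_le_exp.2 he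
  have := mul_le_mul hq he' (exp_pos _).le (by norm_num)
  gcongr

lemma hk_exp {t : ℝ} (ht : 0 < t) (z : ℝ) :
    hk (t / 5) z * exp (5 * z ^ 2 / (8 * t)) ≤ 3 * hk (9 / 10 * t) z := by
  unfold hk
  have e1 : √(4 * π * (9 / 10 * t)) ≤ 3 * √(4 * π * (t / 5)) := by
    rw [Real.sqrt_le_left (by positivity), mul_pow, Real.sq_sqrt (by positivity)]
    have := mul_pos pi_pos ht
    nlinarith
  have e2 : (√(4 * π * (t / 5)))⁻¹ ≤ 3 * (√(4 * π * (9 / 10 * t)))⁻¹ := by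
    rw [← div_eq_mul_inv, le_div_iff₀ (by positivity), inv_mul_le_iff₀ (by positivity)]
    linarith
  have e3 : -z ^ 2 / (4 * (t / 5)) + 5 * z ^ 2 / (8 * t) ≤ -z ^ 2 / (4 * (9 / 10 * t)) := by
    have : -z ^ 2 / (4 * (9 / 10 * t)) - (-z ^ 2 / (4 * (t / 5)) + 5 * z ^ 2 / (8 * t))
      = (25 / 72) * z ^ 2 / t := by field_simp; ring
    have : 0 ≤ (25 / 72) * z ^ 2 / t := by positivity
    linarith
  rw [mul_assoc, ← exp_add]
  calc _ ≤ (3 * (√(4 * π * (9 / 10 * t)))⁻¹) * exp (-z ^ 2 / (4 * (9 / 10 * t))) := by gcongr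
    _ = _ := by ring

lemma hk_exp' {t : ℝ} (ht : 0 < t) (z : ℝ) : hk (t / 5) z ≤ 3 * hk (9 / 10 * t) z := by
  refine le_trans ?_ (hk_exp ht z)
  have : 1 ≤ exp (5 * z ^ 2 / (8 * t)) := Real.one_le_exp (by positivity)
  nlinarith [hk_nonneg (t / 5) z]

end KPV

namespace KPV

/-- Hardy–Littlewood maximal function over dyadic radii -/
def MM (F : ℝ → ENNReal) (x : ℝ) : ENNReal :=
  ⨆ k : ℤ, ENNReal.ofReal (((2:ℝ) ^ k)⁻¹) * ∫⁻ y in Metric.closedBall x ((2:ℝ) ^ k), F y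

lemma MM_meas {F : ℝ → ENNReal} (hF : Measurable F) : Measurable (MM F) := by
  unfold MM
  refine Measurable.iSup fun k => Measurable.const_mul ?_ _
  have h1 : ∀ x, ∫⁻ y in Metric.closedBall x ((2:ℝ) ^ k), F y
      = ∫⁻ y, {z : ℝ × ℝ | dist z.2 z.1 ≤ (2:ℝ) ^ k}.indicator (fun z => F z.2) (x, y) := by
    intro x
    rw [← lintegral_indicator measurableSet_closedBall]
    rfl
  simp_rw [h1]
  refine Measurable.lintegral_prod_right' (f := {z : ℝ × ℝ | dist z.2 z.1 ≤ (2:ℝ) ^ k}.indicator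
    (fun z => F z.2)) ?_
  refine (hF.comp measurable_snd).indicator ?_
  exact measurableSet_le (by fun_prop) measurable_const

lemma MM_weak {F : ℝ → ENNReal} {l : ℝ} (hl : 0 < l) :
    volume {x | ENNReal.ofReal l < MM F x} ≤ ENNReal.ofReal (10 / l) * ∫⁻ x, F x := by
  by_cases hI : ∫⁻ x, F x = ⊤
  · rw [hI, ENNReal.mul_top (by simpa using hl)]; exact le_top
  set I := ∫⁻ x, F x
  set t : Set (ℝ × ℤ) := {a | ENNReal.ofReal (l * (2:ℝ) ^ a.2) ≤
    ∫⁻ y in Metric.closedBall a.1 ((2:ℝ) ^ a.2), F y} with ht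
  have hpos : ∀ k : ℤ, (0:ℝ) < 2 ^ k := fun k => by positivity
  obtain ⟨u, hut, hud, huc⟩ := Vitali.exists_disjoint_subfamily_covering_enlargement_closedBall
    t (fun a => a.1) (fun a => (2:ℝ) ^ a.2) (I.toReal / l) (by
      intro a ha
      have h1 : ENNReal.ofReal (l * (2:ℝ) ^ a.2) ≤ I := ha.trans (setLIntegral_le_lintegral _ _)
      rw [ENNReal.ofReal_le_iff_le_toReal hI] at h1
      rw [le_div_iff₀ hl]; linarith) 5 (by norm_num)
  have hucount : u.Countable := hud.countable_of_nonempty_interior (by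
    intro a _
    exact ⟨a.1, Metric.ball_subset_interior_closedBall (Metric.mem_ball_self (hpos _))⟩)
  have hsub : {x | ENNReal.ofReal l < MM F x} ⊆
      ⋃ b ∈ u, Metric.closedBall b.1 (5 * (2:ℝ) ^ b.2) := by
    intro x hx
    have hx' : ENNReal.ofReal l < MM F x := hx
    unfold MM at hx'
    obtain ⟨k, hk⟩ := lt_iSup_iff.1 hx'
    have ha : (x, k) ∈ t := by
      have : ENNReal.ofReal (l * (2:ℝ) ^ k) = ENNReal.ofReal ((2:ℝ) ^ k) * ENNReal.ofReal l := by
        rw [← ENNReal.ofReal_mul (hpos k).le, mul_comm]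
      simp only [ht, Set.mem_ofPred_eq]
      rw [this]
      calc _ ≤ ENNReal.ofReal ((2:ℝ) ^ k) * (ENNReal.ofReal (((2:ℝ) ^ k)⁻¹) *
            ∫⁻ y in Metric.closedBall x ((2:ℝ) ^ k), F y) := by gcongr
        _ = _ := by
            rw [← mul_assoc, ← ENNReal.ofReal_mul (hpos k).le, mul_inv_cancel₀ (hpos k).ne']; simp
    obtain ⟨b, hb, hbs⟩ := huc _ ha
    simp only [Set.mem_iUnion]
    exact ⟨b, hb, hbs (Metric.mem_closedBall_self (hpos _).le)⟩
  calc volume {x | ENNReal.ofReal l < MM F x}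
      ≤ volume (⋃ b ∈ u, Metric.closedBall b.1 (5 * (2:ℝ) ^ b.2)) := measure_mono hsub
    _ ≤ ∑' b : u, volume (Metric.closedBall (b : ℝ × ℤ).1 (5 * (2:ℝ) ^ (b : ℝ × ℤ).2)) :=
        measure_biUnion_le _ hucount _
    _ ≤ ∑' b : u, ENNReal.ofReal (10 / l) *
        ∫⁻ y in Metric.closedBall (b : ℝ × ℤ).1 ((2:ℝ) ^ (b : ℝ × ℤ).2), F y := by
        refine ENNReal.tsum_le_tsum fun b => ?_
        rw [Real.volume_closedBall]
        have := hut b.2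
        calc _ = ENNReal.ofReal (10 / l) * ENNReal.ofReal (l * (2:ℝ) ^ (b : ℝ × ℤ).2) := by
              rw [← ENNReal.ofReal_mul (by positivity)]; congr 1; field_simp; ring
          _ ≤ _ := by gcongr; exact this
    _ = ENNReal.ofReal (10 / l) *
        ∫⁻ y in ⋃ b ∈ u, Metric.closedBall b.1 ((2:ℝ) ^ b.2), F y := by
        rw [ENNReal.tsum_mul_left,
          lintegral_biUnion hucount (fun _ _ => measurableSet_closedBall) hud]
    _ ≤ _ := by gcongr; exact setLIntegral_le_lintegral _ _

lemma MM_le_add {F G : ℝ → ENNReal} (hG : Measurable G) {c : ℝ}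
    (h : ∀ x, F x ≤ G x + ENNReal.ofReal c) (x : ℝ) : MM F x ≤ MM G x + ENNReal.ofReal (2 * c) := by
  unfold MM
  refine iSup_le fun k => ?_
  have hpos : (0:ℝ) < 2 ^ k := by positivity
  calc ENNReal.ofReal (((2:ℝ) ^ k)⁻¹) * ∫⁻ y in Metric.closedBall x ((2:ℝ) ^ k), F y
      ≤ ENNReal.ofReal (((2:ℝ) ^ k)⁻¹) *
        ∫⁻ y in Metric.closedBall x ((2:ℝ) ^ k), (G y + ENNReal.ofReal c) := by
        gcongr with y; exact h y
    _ = ENNReal.ofReal (((2:ℝ) ^ k)⁻¹) * (∫⁻ y in Metric.closedBall x ((2:ℝ) ^ k), G y) +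
        ENNReal.ofReal (2 * c) := by
        rw [lintegral_add_left hG, mul_add, setLIntegral_const, Real.volume_closedBall]
        congr 1
        rw [← ENNReal.ofReal_mul' (by positivity), ← ENNReal.ofReal_mul (by positivity)]
        congr 1; field_simp
    _ ≤ _ := by
        gcongr
        exact le_iSup (fun k : ℤ => ENNReal.ofReal (((2:ℝ) ^ k)⁻¹) *
          ∫⁻ y in Metric.closedBall x ((2:ℝ) ^ k), G y) k

lemma MM_zero (x : ℝ) : MM (fun _ => 0) x = 0 := by simp [MM]

lemma lint_rpow_Ioo {p a : ℝ} (hp : 1 < p) (ha : 0 ≤ a) :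
    ∫⁻ t in Set.Ioo 0 a, ENNReal.ofReal (t ^ (p - 2)) = ENNReal.ofReal (a ^ (p - 1) / (p - 1)) := by
  have h1 : ∫ t in (0:ℝ)..a, t ^ (p - 2) = a ^ (p - 1) / (p - 1) := by
    rw [integral_rpow (Or.inl (by linarith)), show p - 2 + 1 = p - 1 by ring,
      Real.zero_rpow (by linarith), sub_zero]
  have h2 : IntervalIntegrable (fun t : ℝ => t ^ (p - 2)) volume 0 a :=
    intervalIntegral.intervalIntegrable_rpow' (by linarith)
  rw [← h1, intervalIntegral.integral_of_le ha, integral_Ioc_eq_integral_Ioo,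
    ofReal_integral_eq_lintegral_ofReal]
  · rw [intervalIntegrable_iff_integrableOn_Ioo_of_le ha] at h2; exact h2
  · filter_upwards [ae_restrict_mem measurableSet_Ioo] with t ht
    exact Real.rpow_nonneg ht.1.le _

lemma MM_lp {φ : ℝ → ℝ} (hφ : Measurable φ) (h0 : ∀ x, 0 ≤ φ x) {B : ℝ} (hB : ∀ x, φ x ≤ B)
    {p : ℝ} (hp : 1 < p) :
    ∫⁻ x, MM (fun y => ENNReal.ofReal (φ y)) x ^ p ≤
      ENNReal.ofReal (p * 20 * (4 ^ (p - 1) / (p - 1))) * Np p φ := by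
  set F : ℝ → ENNReal := fun y => ENNReal.ofReal (φ y) with hF
  have hFm : Measurable F := hφ.ennreal_ofReal
  have hfin : ∀ x, MM F x ≠ ⊤ := by
    intro x
    have := MM_le_add (F := F) (G := fun _ => 0) measurable_const (c := B) (fun x => by
      simp only [hF, zero_add]; exact ENNReal.ofReal_le_ofReal (hB x)) x
    rw [MM_zero, zero_add] at this
    exact ne_top_of_le_ne_top ENNReal.ofReal_ne_top this
  have hp0 : 0 < p := by linarith
  have e1 : ∀ x, MM F x ^ p = ENNReal.ofReal ((MM F x).toReal ^ p) := by
    intro x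
    rw [← ENNReal.ofReal_rpow_of_nonneg ENNReal.toReal_nonneg hp0.le, ENNReal.ofReal_toReal (hfin x)]
  simp_rw [e1]
  rw [lintegral_rpow_eq_lintegral_meas_lt_mul volume
    (Filter.Eventually.of_forall fun x => ENNReal.toReal_nonneg)
    (MM_meas hFm).ennreal_toReal.aemeasurable hp0]
  have h1 : ∀ t ∈ Set.Ioi (0:ℝ), volume {a | t < (MM F a).toReal} * ENNReal.ofReal (t ^ (p - 1)) ≤
      ENNReal.ofReal 20 * ∫⁻ x, F x * ((Set.Iio (4 * φ x)).indicator
        (fun t => ENNReal.ofReal (t ^ (p - 2))) t) := by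
    intro t ht
    have ht : 0 < t := ht
    set G : ℝ → ENNReal := {x | t / 4 < φ x}.indicator F with hG
    have hms : MeasurableSet {x | t / 4 < φ x} := measurableSet_lt measurable_const hφ
    have hGm : Measurable G := hFm.indicator hms
    have hFG : ∀ x, F x ≤ G x + ENNReal.ofReal (t / 4) := by
      intro x
      by_cases hx : t / 4 < φ x
      · rw [hG, Set.indicator_of_mem (by exact hx)]; exact le_self_add
      · exact le_add_left (ENNReal.ofReal_le_ofReal (not_lt.1 hx))
    have hsub : {a | t < (MM F a).toReal} ⊆ {x | ENNReal.ofReal (t / 2) < MM G x} := by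
      intro x hx
      have h2 := MM_le_add hGm hFG x
      have h3 : ENNReal.ofReal t < MM F x := by
        rw [← ENNReal.ofReal_toReal (hfin x)]
        exact (ENNReal.ofReal_lt_ofReal_iff (ht.trans hx)).2 hx
      have h4 : ENNReal.ofReal t = ENNReal.ofReal (t / 2) + ENNReal.ofReal (2 * (t / 4)) := by
        rw [← ENNReal.ofReal_add (by positivity) (by positivity)]; congr 1; ring
      have h5 := h3.trans_le h2
      rw [h4] at h5
      exact lt_of_add_lt_add_right h5
    have h6 := (measure_mono hsub).trans (MM_weak (F := G) (l := t / 2) (by positivity))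
    calc _ ≤ (ENNReal.ofReal (10 / (t / 2)) * ∫⁻ x, G x) * ENNReal.ofReal (t ^ (p - 1)) := by gcongr
      _ = ENNReal.ofReal 20 * (ENNReal.ofReal (t ^ (p - 2)) * ∫⁻ x, G x) := by
          rw [mul_right_comm, ← ENNReal.ofReal_mul (by positivity), ← mul_assoc,
            ← ENNReal.ofReal_mul (by positivity)]
          congr 2
          rw [rpow_split1 ht]; field_simp; norm_num
      _ = _ := by
          rw [← lintegral_const_mul' _ _ ENNReal.ofReal_ne_top]
          congr 2; ext x
          by_cases hx : t / 4 < φ x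
          · rw [hG, Set.indicator_of_mem (by exact hx), Set.indicator_of_mem, mul_comm]
            simp only [Set.mem_Iio]; linarith
          · rw [hG, Set.indicator_of_notMem (by exact hx), Set.indicator_of_notMem]
            · simp
            · simp only [Set.mem_Iio]; intro h; apply hx; linarith
  have hjm : Measurable (fun z : ℝ × ℝ => F z.2 * ((Set.Iio (4 * φ z.2)).indicator
        (fun t => ENNReal.ofReal (t ^ (p - 2))) z.1)) := by
    refine (hFm.comp measurable_snd).mul ?_
    have : (fun z : ℝ × ℝ => ((Set.Iio (4 * φ z.2)).indicator
        (fun t => ENNReal.ofReal (t ^ (p - 2))) z.1)) =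
        {z : ℝ × ℝ | z.1 < 4 * φ z.2}.indicator (fun z => ENNReal.ofReal (z.1 ^ (p - 2))) := rfl
    rw [this]
    refine Measurable.indicator (by fun_prop) ?_
    exact measurableSet_lt measurable_fst ((hφ.comp measurable_snd).const_mul 4)
  calc _ ≤ ENNReal.ofReal p * ∫⁻ t in Set.Ioi (0:ℝ), ENNReal.ofReal 20 * ∫⁻ x, F x *
        ((Set.Iio (4 * φ x)).indicator (fun t => ENNReal.ofReal (t ^ (p - 2))) t) := by
        gcongr ENNReal.ofReal p * ?_
        exact setLIntegral_mono' measurableSet_Ioi h1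
    _ = ENNReal.ofReal p * (ENNReal.ofReal 20 * ∫⁻ x, ∫⁻ t in Set.Ioi (0:ℝ), F x *
        ((Set.Iio (4 * φ x)).indicator (fun t => ENNReal.ofReal (t ^ (p - 2))) t)) := by
        rw [lintegral_const_mul' _ _ ENNReal.ofReal_ne_top,
          lintegral_lintegral_swap hjm.aemeasurable]
    _ = ENNReal.ofReal p * (ENNReal.ofReal 20 * ∫⁻ x, ENNReal.ofReal (4 ^ (p - 1) / (p - 1)) *
        ENNReal.ofReal (φ x ^ p)) := by
        congr 3; ext x
        rw [lintegral_const_mul' _ _ ENNReal.ofReal_ne_top, lintegral_indicator measurableSet_Iio,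
          Measure.restrict_restrict measurableSet_Iio, Set.inter_comm, Set.Ioi_inter_Iio,
          lint_rpow_Ioo hp (by have := h0 x; positivity)]
        have hp1 : 0 < p - 1 := by linarith
        rw [← ENNReal.ofReal_mul (h0 x), ← ENNReal.ofReal_mul (by positivity)]
        congr 1
        rw [Real.mul_rpow (by norm_num) (h0 x)]
        have : φ x ^ p = φ x * φ x ^ (p - 1) := by
          rw [← Real.rpow_one_add' (h0 x) (by linarith)]; congr 1; ring
        rw [this]; ring
    _ = _ := by
        have hp1 : 0 < p - 1 := by linarith
        rw [lintegral_const_mul' _ _ ENNReal.ofReal_ne_top, Np_nonneg_eq h0 hp0.le, ← mul_assoc,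
          ← mul_assoc, ← ENNReal.ofReal_mul hp0.le, ← ENNReal.ofReal_mul (by positivity)]

lemma hk_dyadic {t : ℝ} (ht : 0 < t) : ∃ k : ℤ, ∀ z : ℝ, ∃ n : ℕ, |z| ≤ (2:ℝ) ^ (k + n) ∧
    hk t z ≤ 16 * (2⁻¹ ^ n * ((2:ℝ) ^ (k + n))⁻¹) := by
  obtain ⟨m, hm1, hm2⟩ := exists_mem_Ioc_zpow (Real.sqrt_pos.2 ht) (one_lt_two (α := ℝ))
  refine ⟨m + 1, fun z => ?_⟩
  set k := m + 1 with hk'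
  have hkp : (0:ℝ) < 2 ^ k := by positivity
  have h2k : (2:ℝ) ^ k = 2 * 2 ^ m := by rw [hk', zpow_add_one₀ (by norm_num)]; ring
  have hpre : (√(4 * π * t))⁻¹ ≤ ((2:ℝ) ^ k)⁻¹ := by
    apply inv_anti₀ hkp
    have : √(4 * π * t) = √(4 * π) * √t := by rw [Real.sqrt_mul (by positivity)]
    rw [this]
    have h2 : 2 ≤ √(4 * π) := by
      apply Real.le_sqrt_of_sq_le; nlinarith [pi_gt_three]
    have h3 : 0 < √t := Real.sqrt_pos.2 ht
    nlinarith
  have hk0 : hk t z ≤ ((2:ℝ) ^ k)⁻¹ := (hk_le ht z).trans hpre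
  have hex : ∃ n : ℕ, |z| ≤ (2:ℝ) ^ (k + n) := by
    obtain ⟨n, hn⟩ := pow_unbounded_of_one_lt (|z| / 2 ^ k) (one_lt_two (α := ℝ))
    refine ⟨n, ?_⟩
    rw [zpow_add₀ (by norm_num), zpow_natCast]
    rw [div_lt_iff₀ hkp] at hn
    linarith
  classical
  refine ⟨Nat.find hex, Nat.find_spec hex, ?_⟩
  rcases Nat.eq_zero_or_pos (Nat.find hex) with h | h
  · rw [h]
    have : 0 < ((2:ℝ) ^ k)⁻¹ := by positivity
    simp
    linarith
  · have hmin := Nat.find_min hex (m := Nat.find hex - 1) (by omega)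
    set n := Nat.find hex
    obtain ⟨l, hl⟩ : ∃ l, n = l + 1 := ⟨n - 1, by omega⟩
    rw [hl] at hmin ⊢
    simp only [Nat.add_sub_cancel] at hmin
    have hz : (2:ℝ) ^ k * 2 ^ l < |z| := by
      rw [zpow_add₀ (by norm_num), zpow_natCast] at hmin
      exact not_le.1 hmin
    have hsq : t * 4 ^ l ≤ z ^ 2 := by
      have h5 : √t * 2 ^ l ≤ |z| := by
        refine le_trans ?_ hz.le
        gcongr
      have h6 : (√t * 2 ^ l) ^ 2 ≤ |z| ^ 2 := by gcongr
      rw [sq_abs, mul_pow, Real.sq_sqrt ht.le, ← pow_mul, mul_comm l, pow_mul] at h6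
      norm_num at h6
      exact h6
    have hexp : exp (-(z ^ 2) / (4 * t)) ≤ 4 * (4 ^ l)⁻¹ := by
      have h7 : -(z ^ 2) / (4 * t) ≤ -(4 ^ l / 4) := by
        rw [div_le_iff₀ (by positivity)]; linarith
      refine (exp_le_exp.2 h7).trans ?_
      rw [exp_neg]
      have h8 : (4:ℝ) ^ l / 4 ≤ exp (4 ^ l / 4) := by
        have := Real.add_one_le_exp ((4:ℝ) ^ l / 4); linarith
      calc _ ≤ ((4:ℝ) ^ l / 4)⁻¹ := by gcongr
        _ = _ := by rw [inv_div]; ring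
    calc hk t z ≤ ((2:ℝ) ^ k)⁻¹ * (4 * (4 ^ l)⁻¹) := by
          unfold hk; gcongr
      _ = _ := by
          rw [zpow_add₀ (by norm_num) k, zpow_natCast, show (4:ℝ) = 2 * 2 by norm_num, mul_pow, inv_pow]
          field_simp
          ring

lemma P0_le_MM {φ : ℝ → ℝ} (hφ : Nice φ) (h0 : ∀ x, 0 ≤ φ x) {t : ℝ} (ht : 0 < t) (x : ℝ) :
    ENNReal.ofReal (P 0 φ t x) ≤ 32 * MM (fun y => ENNReal.ofReal (φ y)) x := by
  rw [P0_ofReal hφ.int h0 ht]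
  obtain ⟨k, hkd⟩ := hk_dyadic ht
  set F : ℝ → ENNReal := fun y => ENNReal.ofReal (φ y) with hF
  have hFm : Measurable F := hφ.meas.ennreal_ofReal
  calc ∫⁻ y, ENNReal.ofReal (hk t (x - y)) * F y
      ≤ ∫⁻ y, ∑' n : ℕ, 16 * (2⁻¹ ^ n * (ENNReal.ofReal (((2:ℝ) ^ (k + n))⁻¹) *
        (Metric.closedBall x ((2:ℝ) ^ (k + n))).indicator F y)) := by
        refine lintegral_mono fun y => ?_
        obtain ⟨n, hn1, hn2⟩ := hkd (x - y)
        refine le_trans ?_ (ENNReal.le_tsum n)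
        rw [Set.indicator_of_mem (by rw [Metric.mem_closedBall, dist_comm, Real.dist_eq]; exact hn1)]
        rw [← mul_assoc, ← mul_assoc]
        gcongr
        refine (ENNReal.ofReal_le_ofReal hn2).trans (le_of_eq ?_)
        rw [ENNReal.ofReal_mul (by norm_num), ENNReal.ofReal_mul (by positivity),
          ENNReal.ofReal_pow (by positivity), ENNReal.ofReal_inv_of_pos (by norm_num)]
        simp [mul_assoc]
    _ = ∑' n : ℕ, 16 * (2⁻¹ ^ n * (ENNReal.ofReal (((2:ℝ) ^ (k + n))⁻¹) *
        ∫⁻ y in Metric.closedBall x ((2:ℝ) ^ (k + n)), F y)) := by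
        have hi : ∀ n : ℕ, Measurable ((Metric.closedBall x ((2:ℝ) ^ (k + n))).indicator F) :=
          fun n => hFm.indicator measurableSet_closedBall
        rw [lintegral_tsum]
        · congr 1; ext n
          rw [lintegral_const_mul _ (by have := hi n; fun_prop),
            lintegral_const_mul _ (by have := hi n; fun_prop), lintegral_const_mul _ (hi n),
            lintegral_indicator measurableSet_closedBall]
        · intro n
          have := hi n
          fun_prop
    _ ≤ ∑' n : ℕ, 16 * (2⁻¹ ^ n * MM F x) := by
        refine ENNReal.tsum_le_tsum fun n => ?_
        gcongr
        exact le_iSup (fun k : ℤ => ENNReal.ofReal (((2:ℝ) ^ k)⁻¹) *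
          ∫⁻ y in Metric.closedBall x ((2:ℝ) ^ k), F y) (k + n)
    _ = _ := by
        rw [ENNReal.tsum_mul_left, ENNReal.tsum_mul_right, ENNReal.tsum_geometric_two, ← mul_assoc]
        congr 1; norm_num

end KPV

namespace KPV

/-- vertical square function -/
def Sq (j : ℕ) (φ : ℝ → ℝ) (x : ℝ) : ENNReal :=
  ∫⁻ t in Set.Ioi (0:ℝ), ENNReal.ofReal (t ^ (j - 1) * P j φ t x ^ 2)

/-- Carleson type square function -/
def Cq (g h : ℝ → ℝ) (x : ℝ) : ENNReal :=
  ∫⁻ t in Set.Ioi (0:ℝ), ENNReal.ofReal (P 1 g t x ^ 2 * P 0 h (1 / 10 * t) x ^ 2)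

lemma P_meas_sc {h : ℝ → ℝ} (hh : Measurable h) (n : ℕ) (c : ℝ) :
    Measurable (fun q : ℝ × ℝ => P n h (c * q.1) q.2) :=
  (P_meas hh n).comp (by fun_prop : Measurable (fun q : ℝ × ℝ => (c * q.1, q.2)))

lemma Sq_ig_meas {φ : ℝ → ℝ} (hφ : Measurable φ) (j : ℕ) :
    Measurable (fun q : ℝ × ℝ => ENNReal.ofReal (q.1 ^ (j - 1) * P j φ q.1 q.2 ^ 2)) := by
  have := P_meas hφ j
  fun_prop

lemma Cq_ig_meas {g h : ℝ → ℝ} (hg : Measurable g) (hh : Measurable h) :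
    Measurable (fun q : ℝ × ℝ => ENNReal.ofReal (P 1 g q.1 q.2 ^ 2 * P 0 h (1 / 10 * q.1) q.2 ^ 2)) := by
  have := P_meas hg 1
  have := P_meas_sc hh 0 (1 / 10)
  fun_prop

lemma Sq_meas {φ : ℝ → ℝ} (hφ : Measurable φ) (j : ℕ) : Measurable (Sq j φ) :=
  Measurable.lintegral_prod_left' (μ := volume.restrict (Set.Ioi (0:ℝ))) (Sq_ig_meas hφ j)

lemma Cq_meas {g h : ℝ → ℝ} (hg : Measurable g) (hh : Measurable h) : Measurable (Cq g h) :=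
  Measurable.lintegral_prod_left' (μ := volume.restrict (Set.Ioi (0:ℝ))) (Cq_ig_meas hg hh)

lemma sl1 {A : ℝ × ℝ → ENNReal} (hA : Measurable A) (x : ℝ) : Measurable (fun t : ℝ => A (t, x)) :=
  hA.comp (by fun_prop)

lemma sl2 {A : ℝ × ℝ → ENNReal} (hA : Measurable A) (t : ℝ) : Measurable (fun x : ℝ => A (t, x)) :=
  hA.comp (by fun_prop)

lemma swap_mul {A : ℝ × ℝ → ENNReal} (hA : Measurable A) {W : ℝ → ENNReal} (hW : Measurable W) :
    ∫⁻ x, (∫⁻ t in Set.Ioi (0:ℝ), A (t, x)) * W x =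
      ∫⁻ t in Set.Ioi (0:ℝ), ∫⁻ x, A (t, x) * W x := by
  have : ∀ x, (∫⁻ t in Set.Ioi (0:ℝ), A (t, x)) * W x = ∫⁻ t in Set.Ioi (0:ℝ), A (t, x) * W x := by
    intro x
    rw [lintegral_mul_const _ (by fun_prop)]
  simp_rw [this]
  rw [lintegral_lintegral_swap]
  refine Measurable.aemeasurable ?_
  exact (hA.comp measurable_swap).mul (hW.comp measurable_fst)

lemma young_max {a b : ENNReal} {θ : ℝ} (h0 : 0 ≤ θ) (h1 : θ ≤ 1) :
    a ^ (1 - θ) * b ^ θ ≤ a + b := by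
  calc a ^ (1 - θ) * b ^ θ ≤ (a + b) ^ (1 - θ) * (a + b) ^ θ := by
        gcongr
        · exact le_self_add
        · exact le_add_self
    _ = a + b := by
        rw [← ENNReal.rpow_add_of_nonneg _ _ (by linarith) h0]; simp

lemma kerA {φ : ℝ → ℝ} (hφ : Nice φ) (h0 : ∀ x, 0 ≤ φ x) (hz : ¬ φ =ᵐ[volume] 0) {p : ℝ}
    (hp1 : 1 < p) (hp2 : p ≤ 2) {t : ℝ} (ht : 0 < t) (y : ℝ) :
    ∫⁻ x, ENNReal.ofReal (hk (t / 5) (x - y)) * ENNReal.ofReal (P 0 φ (2 * t) x ^ (p - 2)) ≤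
      27 * ENNReal.ofReal (P 0 φ (9 / 10 * t) y ^ (p - 2)) := by
  have ha : 0 < P 0 φ (9 / 10 * t) y := P_pos hφ.int h0 hz (by positivity) y
  calc _ ≤ ∫⁻ x, ENNReal.ofReal (hk (9 / 10 * t) (x - y)) *
        ENNReal.ofReal (27 * P 0 φ (9 / 10 * t) y ^ (p - 2)) := by
        refine lintegral_mono fun x => ?_
        have hb : 0 < P 0 φ (2 * t) x := P_pos hφ.int h0 hz (by positivity) x
        beta_reduce
        rw [← ENNReal.ofReal_mul (hk_nonneg _ _), ← ENNReal.ofReal_mul (hk_nonneg _ _)]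
        apply ENNReal.ofReal_le_ofReal
        set A := 3 * exp (5 * (x - y) ^ 2 / (16 * t)) with hA
        have hA1 : 1 ≤ A := by
          have : 1 ≤ exp (5 * (x - y) ^ 2 / (16 * t)) := Real.one_le_exp (by positivity)
          linarith
        have hA2 : A ^ (2:ℝ) = 9 * exp (5 * (x - y) ^ 2 / (8 * t)) := by
          rw [Real.rpow_two, hA, mul_pow, ← exp_nat_mul]
          norm_num
          ring_nf
        have h1 : P 0 φ (9 / 10 * t) y ≤ A * P 0 φ (2 * t) x := harnackA hφ.int h0 ht x y
        have h2 : P 0 φ (2 * t) x ^ (p - 2) ≤ P 0 φ (9 / 10 * t) y ^ (p - 2) * A ^ (2:ℝ) := by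
          calc P 0 φ (2 * t) x ^ (p - 2) ≤ (P 0 φ (9 / 10 * t) y / A) ^ (p - 2) := by
                apply Real.rpow_le_rpow_of_nonpos (by positivity) _ (by linarith)
                rw [div_le_iff₀ (by positivity)]; linarith
            _ = P 0 φ (9 / 10 * t) y ^ (p - 2) * A ^ (2 - p) := by
                rw [Real.div_rpow ha.le (by positivity), div_eq_mul_inv,
                  ← Real.rpow_neg (by positivity)]; congr 2; ring
            _ ≤ _ := by
                gcongr
                linarith
        rw [hA2] at h2
        have h3 := hk_exp ht (x - y)
        have hap : 0 < P 0 φ (9 / 10 * t) y ^ (p - 2) := Real.rpow_pos_of_pos ha _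
        calc hk (t / 5) (x - y) * P 0 φ (2 * t) x ^ (p - 2) ≤ hk (t / 5) (x - y) *
              (P 0 φ (9 / 10 * t) y ^ (p - 2) * (9 * exp (5 * (x - y) ^ 2 / (8 * t)))) := by
              gcongr; exact hk_nonneg _ _
          _ = (9 * P 0 φ (9 / 10 * t) y ^ (p - 2)) *
              (hk (t / 5) (x - y) * exp (5 * (x - y) ^ 2 / (8 * t))) := by ring
          _ ≤ (9 * P 0 φ (9 / 10 * t) y ^ (p - 2)) * (3 * hk (9 / 10 * t) (x - y)) := by gcongr
          _ = _ := by ring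
    _ = _ := by
        rw [lintegral_mul_const' _ _ ENNReal.ofReal_ne_top, lint_hk_sub' (by positivity), one_mul,
          ENNReal.ofReal_mul (by norm_num)]
        congr 1; simp

/-- kernel comparison with a weight -/
lemma kerB {h : ℝ → ℝ} (hh : Integrable h) (h0 : ∀ x, 0 ≤ h x) {p : ℝ}
    (hp1 : 0 ≤ p) (hp2 : p ≤ 2) {t : ℝ} (ht : 0 < t) (x y : ℝ) :
    hk (t / 5) (x - y) * P 0 h (1 / 10 * t) x ^ p ≤
      27 * P 0 h (9 / 10 * t) y ^ p * hk (9 / 10 * t) (x - y) := by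
  set A := 3 * exp (5 * (x - y) ^ 2 / (16 * t)) with hA
  have hA1 : 1 ≤ A := by
    have : 1 ≤ exp (5 * (x - y) ^ 2 / (16 * t)) := Real.one_le_exp (by positivity)
    linarith
  have hA2 : A ^ (2:ℝ) = 9 * exp (5 * (x - y) ^ 2 / (8 * t)) := by
    rw [Real.rpow_two, hA, mul_pow, ← exp_nat_mul]
    norm_num
    ring_nf
  have hx := P_nonneg h0 (1 / 10 * t) x
  have hy := P_nonneg h0 (9 / 10 * t) y
  have hyp := Real.rpow_nonneg hy p
  have h2 : P 0 h (1 / 10 * t) x ^ p ≤ A ^ (2:ℝ) * P 0 h (9 / 10 * t) y ^ p := by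
    calc P 0 h (1 / 10 * t) x ^ p ≤ (A * P 0 h (9 / 10 * t) y) ^ p :=
          Real.rpow_le_rpow hx (harnackB hh h0 ht x y) hp1
      _ = A ^ p * P 0 h (9 / 10 * t) y ^ p := Real.mul_rpow (by positivity) hy
      _ ≤ _ := by
          gcongr
  rw [hA2] at h2
  have h3 := hk_exp ht (x - y)
  calc hk (t / 5) (x - y) * P 0 h (1 / 10 * t) x ^ p ≤ hk (t / 5) (x - y) *
        (9 * exp (5 * (x - y) ^ 2 / (8 * t)) * P 0 h (9 / 10 * t) y ^ p) := by
        gcongr; exact hk_nonneg _ _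
    _ = (9 * P 0 h (9 / 10 * t) y ^ p) *
        (hk (t / 5) (x - y) * exp (5 * (x - y) ^ 2 / (8 * t))) := by ring
    _ ≤ (9 * P 0 h (9 / 10 * t) y ^ p) * (3 * hk (9 / 10 * t) (x - y)) := by gcongr
    _ = _ := by ring

/-- constant for small exponents -/
lemma low_exp {S I : ℝ → ENNReal} {φ : ℝ → ℝ} (hφ : Nice φ) (h0 : ∀ x, 0 ≤ φ x) {p : ℝ}
    (hp1 : 1 < p) (hp2 : p ≤ 2) {C : ENNReal}
    (hS : ∀ x, S x ≤ (32 * MM (fun y => ENNReal.ofReal (φ y)) x) ^ (2 - p) * I x)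
    (hI : ∫⁻ x, I x ≤ C * Np p φ) :
    ∫⁻ x, S x ^ (p / 2) ≤
      (32 ^ p * ENNReal.ofReal (p * 20 * (4 ^ (p - 1) / (p - 1))) + C) * Np p φ := by
  obtain ⟨B, hB⟩ := hφ.bdd
  have hM := MM_lp hφ.meas h0 (fun x => (le_abs_self _).trans (hB x)) hp1
  set M := MM (fun y => ENNReal.ofReal (φ y)) with hMd
  have hMm : Measurable M := MM_meas hφ.meas.ennreal_ofReal
  calc ∫⁻ x, S x ^ (p / 2) ≤ ∫⁻ x, ((32 * M x) ^ p + I x) := by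
        refine lintegral_mono fun x => ?_
        calc S x ^ (p / 2) ≤ ((32 * M x) ^ (2 - p) * I x) ^ (p / 2) := by
              gcongr; exact hS x
          _ = ((32 * M x) ^ p) ^ (1 - p / 2) * I x ^ (p / 2) := by
              rw [ENNReal.mul_rpow_of_nonneg _ _ (by linarith), ← ENNReal.rpow_mul,
                ← ENNReal.rpow_mul]
              congr 2; ring
          _ ≤ _ := young_max (by linarith) (by linarith)
    _ = 32 ^ p * (∫⁻ x, M x ^ p) + ∫⁻ x, I x := by
        rw [lintegral_add_left (by fun_prop)]
        congr 1
        simp_rw [ENNReal.mul_rpow_of_nonneg _ _ (by linarith : 0 ≤ p)]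
        rw [lintegral_const_mul _ (by fun_prop)]
    _ ≤ 32 ^ p * (ENNReal.ofReal (p * 20 * (4 ^ (p - 1) / (p - 1))) * Np p φ) + C * Np p φ := by
        gcongr
    _ = _ := by ring

lemma Sq_low {p : ℝ} (hp1 : 1 < p) (hp2 : p ≤ 2) : ∃ C : ENNReal, C ≠ ⊤ ∧
    ∀ φ : ℝ → ℝ, Nice φ → (∀ x, 0 ≤ φ x) → ∀ j : ℕ, 1 ≤ j → j ≤ 2 →
    ∫⁻ x, Sq j φ x ^ (p / 2) ≤ C * Np p φ := by
  refine ⟨32 ^ p * ENNReal.ofReal (p * 20 * (4 ^ (p - 1) / (p - 1))) +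
    ENNReal.ofReal 50 * 27 * ENNReal.ofReal (p * (p - 1))⁻¹, ?_, fun φ hφ h0 j hj1 hj2 => ?_⟩
  · refine ENNReal.add_ne_top.2 ⟨?_, ?_⟩
    · exact ENNReal.mul_ne_top (ENNReal.rpow_ne_top_of_nonneg (by linarith) (by simp))
        ENNReal.ofReal_ne_top
    · exact ENNReal.mul_ne_top (ENNReal.mul_ne_top ENNReal.ofReal_ne_top (by simp))
        ENNReal.ofReal_ne_top
  by_cases hz : φ =ᵐ[volume] 0
  · have : 0 < p / 2 := by linarith
    simp [Sq, P_ae_zero hz, this]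
  have hpos : ∀ t > 0, ∀ x, 0 < P 0 φ t x := fun t ht x => P_pos hφ.int h0 hz ht x
  have hm2 : Measurable (fun q : ℝ × ℝ => ENNReal.ofReal (P 0 φ (2 * q.1) q.2 ^ (p - 2))) :=
    ((P_meas_sc hφ.meas 0 2).pow_const _).ennreal_ofReal
  refine low_exp (I := fun x => ∫⁻ t in Set.Ioi (0:ℝ),
    ENNReal.ofReal (t ^ (j - 1) * P j φ t x ^ 2) * ENNReal.ofReal (P 0 φ (2 * t) x ^ (p - 2)))
    hφ h0 hp1 hp2 (fun x => ?_) ?_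
  · have hms : Measurable (fun t : ℝ => ENNReal.ofReal (t ^ (j - 1) * P j φ t x ^ 2) *
        ENNReal.ofReal (P 0 φ (2 * t) x ^ (p - 2))) :=
      (sl1 (Sq_ig_meas hφ.meas j) x).mul (sl1 hm2 x)
    rw [← lintegral_const_mul _ hms]
    refine setLIntegral_mono' measurableSet_Ioi fun t ht => ?_
    have ht : 0 < t := ht
    have hu := hpos (2 * t) (by positivity) x
    have h1 : ENNReal.ofReal (P 0 φ (2 * t) x) ^ (2 - p) ≤
        (32 * MM (fun y => ENNReal.ofReal (φ y)) x) ^ (2 - p) :=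
      ENNReal.rpow_le_rpow (P0_le_MM hφ h0 (by positivity) x) (by linarith)
    have h2 : ENNReal.ofReal (P 0 φ (2 * t) x) ^ (2 - p) *
        ENNReal.ofReal (P 0 φ (2 * t) x ^ (p - 2)) = 1 := by
      rw [ENNReal.ofReal_rpow_of_pos hu, ← ENNReal.ofReal_mul (by positivity), ← Real.rpow_add hu]
      simp
    calc _ = ENNReal.ofReal (t ^ (j - 1) * P j φ t x ^ 2) *
          (ENNReal.ofReal (P 0 φ (2 * t) x) ^ (2 - p) *
          ENNReal.ofReal (P 0 φ (2 * t) x ^ (p - 2))) := by rw [h2, mul_one]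
      _ ≤ ENNReal.ofReal (t ^ (j - 1) * P j φ t x ^ 2) *
          ((32 * MM (fun y => ENNReal.ofReal (φ y)) x) ^ (2 - p) *
          ENNReal.ofReal (P 0 φ (2 * t) x ^ (p - 2))) := by gcongr
      _ = _ := by ring
  · have hsw : ∫⁻ x, ∫⁻ t in Set.Ioi (0:ℝ),
        ENNReal.ofReal (t ^ (j - 1) * P j φ t x ^ 2) * ENNReal.ofReal (P 0 φ (2 * t) x ^ (p - 2))
        = ∫⁻ t in Set.Ioi (0:ℝ), ∫⁻ x,
        ENNReal.ofReal (t ^ (j - 1) * P j φ t x ^ 2) * ENNReal.ofReal (P 0 φ (2 * t) x ^ (p - 2)) := by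
      apply lintegral_lintegral_swap
      exact (((Sq_ig_meas hφ.meas j).mul hm2).comp measurable_swap).aemeasurable
    rw [hsw]
    refine (avg_int hφ.int hj1 hj2 (V := fun t x => ENNReal.ofReal (P 0 φ (2 * t) x ^ (p - 2)))
      (V' := fun t x => ENNReal.ofReal (P 0 φ t x ^ (p - 2)))
      (fun t ht => sl2 hm2 t) (C := 27) (by simp)
      (fun t ht y => kerA hφ h0 hz hp1 hp2 ht y)).trans ?_
    rw [mul_assoc (ENNReal.ofReal 50 * 27)]
    gcongr
    refine le_trans (le_of_eq ?_) (bell1 hφ h0 hp1)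
    refine setLIntegral_congr_fun measurableSet_Ioi fun t ht => lintegral_congr fun x => ?_
    rw [← ENNReal.ofReal_mul (by positivity), mul_comm]

lemma Cq_low {p : ℝ} (hp1 : 1 < p) (hp2 : p ≤ 2) : ∃ C : ENNReal, C ≠ ⊤ ∧
    ∀ g h : ℝ → ℝ, Nice g → (∀ x, |g x| ≤ 1) → Nice h → (∀ x, 0 ≤ h x) →
    ∫⁻ x, Cq g h x ^ (p / 2) ≤ C * Np p h := by
  refine ⟨32 ^ p * ENNReal.ofReal (p * 20 * (4 ^ (p - 1) / (p - 1))) +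
    ENNReal.ofReal 50 * 27 * ENNReal.ofReal (4 * p / (p - 1) + 1), ?_, fun g h hg hg1 hh h0 => ?_⟩
  · refine ENNReal.add_ne_top.2 ⟨?_, ?_⟩
    · exact ENNReal.mul_ne_top (ENNReal.rpow_ne_top_of_nonneg (by linarith) (by simp))
        ENNReal.ofReal_ne_top
    · exact ENNReal.mul_ne_top (ENNReal.mul_ne_top ENNReal.ofReal_ne_top (by simp))
        ENNReal.ofReal_ne_top
  have hm2 : Measurable (fun q : ℝ × ℝ => ENNReal.ofReal (P 0 h (1 / 10 * q.1) q.2 ^ p)) :=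
    ((P_meas_sc hh.meas 0 (1 / 10)).pow_const _).ennreal_ofReal
  have hp0 : 0 ≤ p := by linarith
  refine low_exp (I := fun x => ∫⁻ t in Set.Ioi (0:ℝ),
    ENNReal.ofReal (t ^ (1 - 1) * P 1 g t x ^ 2) * ENNReal.ofReal (P 0 h (1 / 10 * t) x ^ p))
    hh h0 hp1 hp2 (fun x => ?_) ?_
  · have hms : Measurable (fun t : ℝ => ENNReal.ofReal (t ^ (1 - 1) * P 1 g t x ^ 2) *
        ENNReal.ofReal (P 0 h (1 / 10 * t) x ^ p)) :=
      (sl1 (Sq_ig_meas hg.meas 1) x).mul (sl1 hm2 x)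
    rw [← lintegral_const_mul _ hms]
    refine setLIntegral_mono' measurableSet_Ioi fun t ht => ?_
    have ht : 0 < t := ht
    have hu := P_nonneg h0 (1 / 10 * t) x
    have h1 : ENNReal.ofReal (P 0 h (1 / 10 * t) x) ^ (2 - p) ≤
        (32 * MM (fun y => ENNReal.ofReal (h y)) x) ^ (2 - p) :=
      ENNReal.rpow_le_rpow (P0_le_MM hh h0 (by positivity) x) (by linarith)
    have h2 : ENNReal.ofReal (P 0 h (1 / 10 * t) x ^ 2) =
        ENNReal.ofReal (P 0 h (1 / 10 * t) x) ^ (2 - p) *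
        ENNReal.ofReal (P 0 h (1 / 10 * t) x ^ p) := by
      rw [← ENNReal.ofReal_rpow_of_nonneg hu hp0, ← ENNReal.rpow_add_of_nonneg _ _ (by linarith) hp0,
        ENNReal.ofReal_pow hu]
      simp
    calc _ = ENNReal.ofReal (t ^ (1 - 1) * P 1 g t x ^ 2) *
          (ENNReal.ofReal (P 0 h (1 / 10 * t) x) ^ (2 - p) *
          ENNReal.ofReal (P 0 h (1 / 10 * t) x ^ p)) := by
          rw [← h2, ← ENNReal.ofReal_mul (by positivity)]; simp
      _ ≤ ENNReal.ofReal (t ^ (1 - 1) * P 1 g t x ^ 2) *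
          ((32 * MM (fun y => ENNReal.ofReal (h y)) x) ^ (2 - p) *
          ENNReal.ofReal (P 0 h (1 / 10 * t) x ^ p)) := by gcongr
      _ = _ := by ring
  · have hsw : ∫⁻ x, ∫⁻ t in Set.Ioi (0:ℝ),
        ENNReal.ofReal (t ^ (1 - 1) * P 1 g t x ^ 2) * ENNReal.ofReal (P 0 h (1 / 10 * t) x ^ p)
        = ∫⁻ t in Set.Ioi (0:ℝ), ∫⁻ x,
        ENNReal.ofReal (t ^ (1 - 1) * P 1 g t x ^ 2) * ENNReal.ofReal (P 0 h (1 / 10 * t) x ^ p) := by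
      apply lintegral_lintegral_swap
      exact (((Sq_ig_meas hg.meas 1).mul hm2).comp measurable_swap).aemeasurable
    rw [hsw]
    refine (avg_int hg.int le_rfl one_le_two
      (V := fun t x => ENNReal.ofReal (P 0 h (1 / 10 * t) x ^ p))
      (V' := fun t x => ENNReal.ofReal (P 0 h t x ^ p))
      (fun t ht => sl2 hm2 t) (C := 27) (by simp)
      (fun t ht y => ?_)).trans ?_
    · calc _ ≤ ∫⁻ x, ENNReal.ofReal (27 * P 0 h (9 / 10 * t) y ^ p) *
            ENNReal.ofReal (hk (9 / 10 * t) (x - y)) := by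
            refine lintegral_mono fun x => ?_
            beta_reduce
            have := Real.rpow_nonneg (P_nonneg h0 (9 / 10 * t) y) p
            rw [← ENNReal.ofReal_mul (hk_nonneg _ _), ← ENNReal.ofReal_mul (by positivity)]
            exact ENNReal.ofReal_le_ofReal (kerB hh.int h0 hp0 hp2 ht x y)
        _ = _ := by
            rw [lintegral_const_mul' _ _ ENNReal.ofReal_ne_top, lint_hk_sub' (by positivity), mul_one,
              ENNReal.ofReal_mul (by norm_num)]
            congr 1; simp
    rw [mul_assoc (ENNReal.ofReal 50 * 27)]
    gcongr
    refine le_trans (le_of_eq ?_) (bell2 hh h0 hg.int hg1 hp1)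
    refine setLIntegral_congr_fun measurableSet_Ioi fun t ht => lintegral_congr fun x => ?_
    rw [← ENNReal.ofReal_mul (by positivity), mul_comm]

end KPV

namespace KPV

lemma dual_delta {C1 r : ℝ} (hC : 0 < C1) (hr : 1 < r) : ∃ δ : ℝ, 0 < δ ∧ C1 * δ ^ r ≤ δ / 2 := by
  refine ⟨(2 * C1) ^ (-(1 / (r - 1))), by positivity, ?_⟩
  set δ := (2 * C1) ^ (-(1 / (r - 1))) with hδ
  have h0 : 0 < δ := by positivity
  have h1 : δ ^ (r - 1) = (2 * C1)⁻¹ := by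
    rw [hδ, ← Real.rpow_mul (by positivity), ← Real.rpow_neg_one]
    congr 1
    have : r - 1 ≠ 0 := by linarith
    field_simp
  have h2 : δ ^ r = δ ^ (r - 1) * δ := by
    conv_lhs => rw [show r = (r - 1) + 1 by ring, Real.rpow_add h0, Real.rpow_one]
  rw [h2, h1]
  apply le_of_eq
  field_simp

lemma dual {p r : ℝ} (hp : 2 < p) (hr : r = p / (p - 2)) {C1 : ℝ} (hC : 0 < C1) :
    ∃ C : ENNReal, C ≠ ⊤ ∧ ∀ (F : ℝ → ENNReal) (B : ENNReal), Measurable F → B ≠ ⊤ →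
    (∀ ψ : ℝ → ℝ, Nice ψ → (∀ x, 0 ≤ ψ x) →
      ∫⁻ x, F x * ENNReal.ofReal (ψ x) ≤ ENNReal.ofReal C1 * (B + Np r ψ)) →
    ∫⁻ x, F x ^ (p / 2) ≤ C * B := by
  have hr1 : 1 < r := by rw [hr, one_lt_div (by linarith)]; linarith
  obtain ⟨δ, hδ, hδp⟩ := dual_delta hC hr1
  refine ⟨ENNReal.ofReal (2 * C1 / δ), ENNReal.ofReal_ne_top, fun F B hF hB H => ?_⟩
  set G : ℕ → ℝ → ENNReal := fun N => (Set.Icc (-(N:ℝ)) N).indicator (fun x => min (F x) N) with hG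
  have hGm : ∀ N, Measurable (G N) := fun N =>
    (hF.min measurable_const).indicator measurableSet_Icc
  have hGF : ∀ N x, G N x ≤ F x := fun N x => by
    simp only [hG]
    by_cases hx : x ∈ Set.Icc (-(N:ℝ)) N
    · rw [Set.indicator_of_mem hx]; exact min_le_left _ _
    · rw [Set.indicator_of_notMem hx]; exact zero_le
  have hGN : ∀ N x, G N x ≤ (Set.Icc (-(N:ℝ)) N).indicator (fun _ => (N:ENNReal)) x := fun N x => by
    simp only [hG]
    by_cases hx : x ∈ Set.Icc (-(N:ℝ)) N
    · rw [Set.indicator_of_mem hx, Set.indicator_of_mem hx]; exact min_le_right _ _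
    · rw [Set.indicator_of_notMem hx]; exact zero_le
  have hGN' : ∀ N x, G N x ≤ N := fun N x => (hGN N x).trans (Set.indicator_le_self' (by simp) x)
  have hGt : ∀ N x, G N x ≠ ⊤ := fun N x => ne_top_of_le_ne_top (by simp) (hGN' N x)
  have hq : 0 < p / 2 - 1 := by linarith
  -- finiteness of all powers
  have hfin : ∀ (N : ℕ) (e : ℝ), 0 < e → ∫⁻ x, G N x ^ e ≠ ⊤ := fun N e he => by
    have h1 : ∫⁻ x, G N x ^ e ≤ ∫⁻ x, (Set.Icc (-(N:ℝ)) N).indicator (fun _ => (N:ENNReal) ^ e) x := by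
      refine lintegral_mono fun x => ?_
      refine (ENNReal.rpow_le_rpow (hGN N x) he.le).trans (le_of_eq ?_)
      by_cases hx : x ∈ Set.Icc (-(N:ℝ)) N
      · rw [Set.indicator_of_mem hx, Set.indicator_of_mem hx]
      · rw [Set.indicator_of_notMem hx, Set.indicator_of_notMem hx, ENNReal.zero_rpow_of_pos he]
    refine ne_top_of_le_ne_top ?_ h1
    rw [lintegral_indicator_const measurableSet_Icc]
    exact ENNReal.mul_ne_top (ENNReal.rpow_ne_top_of_nonneg he.le (by simp)) (by simp)
  have key : ∀ N, ∫⁻ x, G N x ^ (p / 2) ≤ ENNReal.ofReal (2 * C1 / δ) * B := by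
    intro N
    set ψ : ℝ → ℝ := fun x => δ * (G N x ^ (p / 2 - 1)).toReal with hψ
    have hψ0 : ∀ x, 0 ≤ ψ x := fun x => by positivity
    have hψe : ∀ x, ENNReal.ofReal (ψ x) = ENNReal.ofReal δ * G N x ^ (p / 2 - 1) := fun x => by
      rw [hψ]; beta_reduce
      rw [ENNReal.ofReal_mul hδ.le, ENNReal.ofReal_toReal]
      exact ENNReal.rpow_ne_top_of_nonneg hq.le (hGt N x)
    have hψn : Nice ψ := by
      refine ⟨(((hGm N).pow_const _).ennreal_toReal).const_mul _, ?_, δ * ((N:ENNReal) ^ (p / 2 - 1)).toReal, fun x => ?_⟩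
      · exact (integrable_toReal_of_lintegral_ne_top ((hGm N).pow_const _).aemeasurable
          (hfin N _ hq)).const_mul _
      · rw [abs_of_nonneg (hψ0 x)]
        rw [hψ]; beta_reduce
        gcongr
        · exact ENNReal.rpow_ne_top_of_nonneg hq.le (by simp)
        · exact hGN' N x
    have h1 := H ψ hψn hψ0
    have h2 : Np r ψ = ENNReal.ofReal (δ ^ r) * ∫⁻ x, G N x ^ (p / 2) := by
      unfold Np
      rw [← lintegral_const_mul _ ((hGm N).pow_const _)]
      refine lintegral_congr fun x => ?_
      rw [abs_of_nonneg (hψ0 x), hψe, ENNReal.mul_rpow_of_nonneg _ _ (by linarith),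
        ← ENNReal.rpow_mul, ENNReal.ofReal_rpow_of_pos hδ]
      congr 2
      have : p - 2 ≠ 0 := by linarith
      rw [hr]; field_simp
    have h3 : ENNReal.ofReal δ * ∫⁻ x, G N x ^ (p / 2) ≤ ∫⁻ x, F x * ENNReal.ofReal (ψ x) := by
      rw [← lintegral_const_mul _ ((hGm N).pow_const _)]
      refine lintegral_mono fun x => ?_
      beta_reduce
      rw [hψe]
      calc ENNReal.ofReal δ * G N x ^ (p / 2) = G N x * (ENNReal.ofReal δ * G N x ^ (p / 2 - 1)) := by
            have : G N x ^ (p / 2) = G N x ^ (p / 2 - 1) * G N x := by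
              conv_lhs => rw [show p / 2 = (p / 2 - 1) + 1 by ring,
                ENNReal.rpow_add_of_nonneg _ _ hq.le zero_le_one, ENNReal.rpow_one]
            rw [this]; ring
        _ ≤ _ := by gcongr; exact hGF N x
    have h4 := h3.trans h1
    rw [h2] at h4
    have hX := hfin N (p / 2) (by linarith)
    set X := ∫⁻ x, G N x ^ (p / 2) with hXd
    rw [← ENNReal.ofReal_toReal hX, ← ENNReal.ofReal_toReal hB] at h4 ⊢
    have hX0 : 0 ≤ X.toReal := ENNReal.toReal_nonneg
    have hB0 : 0 ≤ B.toReal := ENNReal.toReal_nonneg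
    rw [← ENNReal.ofReal_mul hδ.le, ← ENNReal.ofReal_mul (by positivity),
      ← ENNReal.ofReal_add hB0 (by positivity), ← ENNReal.ofReal_mul hC.le,
      ENNReal.ofReal_le_ofReal_iff (by positivity)] at h4
    rw [← ENNReal.ofReal_mul (by positivity)]
    apply ENNReal.ofReal_le_ofReal
    rw [div_mul_eq_mul_div, le_div_iff₀ hδ]
    nlinarith [mul_le_mul_of_nonneg_right hδp hX0]
  have hlim : ∀ x, Filter.Tendsto (fun N => G N x ^ (p / 2)) Filter.atTop (nhds (F x ^ (p / 2))) := by
    intro x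
    refine (ENNReal.continuous_rpow_const.tendsto (F x)).comp ?_
    have h1 : Filter.Tendsto (fun N : ℕ => min (F x) (N:ENNReal)) Filter.atTop (nhds (F x)) := by
      have := (tendsto_const_nhds (x := F x)).min ENNReal.tendsto_nat_nhds_top
      simpa using this
    refine h1.congr' ?_
    filter_upwards [Filter.eventually_ge_atTop ⌈|x|⌉₊] with N hN
    have hN' : |x| ≤ N := Nat.ceil_le.1 hN
    simp only [hG]
    rw [Set.indicator_of_mem]
    exact abs_le.1 hN'
  calc ∫⁻ x, F x ^ (p / 2) = ∫⁻ x, Filter.liminf (fun N => G N x ^ (p / 2)) Filter.atTop := by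
        refine lintegral_congr fun x => (hlim x).liminf_eq.symm
    _ ≤ Filter.liminf (fun N => ∫⁻ x, G N x ^ (p / 2)) Filter.atTop :=
        lintegral_liminf_le fun N => (hGm N).pow_const _
    _ ≤ ENNReal.ofReal (2 * C1 / δ) * B := by
        refine Filter.liminf_le_of_le (by isBoundedDefault) fun b hb => ?_
        obtain ⟨N, hN⟩ := hb.exists
        exact hN.trans (key N)

lemma kerC {ψ : ℝ → ℝ} (hψ : Nice ψ) (h0 : ∀ x, 0 ≤ ψ x) {t : ℝ} (ht : 0 < t) (y : ℝ) :
    ∫⁻ x, ENNReal.ofReal (hk (9 / 10 * t) (x - y)) * ENNReal.ofReal (ψ x) =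
      ENNReal.ofReal (P 0 ψ (9 / 10 * t) y) := by
  rw [P0_ofReal hψ.int h0 (by positivity)]
  refine lintegral_congr fun x => ?_
  rw [← hk_neg, neg_sub]

lemma Sq_high {p : ℝ} (hp : 2 < p) : ∃ C : ENNReal, C ≠ ⊤ ∧
    ∀ φ : ℝ → ℝ, Nice φ → (∀ x, 0 ≤ φ x) → ∀ j : ℕ, 1 ≤ j → j ≤ 2 →
    ∫⁻ x, Sq j φ x ^ (p / 2) ≤ C * Np p φ := by
  have hp2 : 0 < p - 2 := by linarith
  have hr1 : 1 < p / (p - 2) := by rw [one_lt_div (by linarith)]; linarith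
  set C0 := 1 + 5 * (2 * (p / (p - 1) + (p / (p - 2)) / ((p / (p - 2)) - 1))) with hC0
  have hC0p : 0 < C0 := by
    have : 0 < p / (p - 1) := div_pos (by linarith) (by linarith)
    have : 0 < (p / (p - 2)) / ((p / (p - 2)) - 1) := div_pos (by linarith) (by linarith)
    positivity
  obtain ⟨C, hC, H⟩ := dual hp rfl (C1 := 50 * 3 * C0) (by positivity)
  refine ⟨C, hC, fun φ hφ h0 j hj1 hj2 => ?_⟩
  refine H _ _ (Sq_meas hφ.meas j) (Np_fin hφ (by linarith)) fun ψ hψ hψ0 => ?_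
  have hm := hψ.meas.ennreal_ofReal
  unfold Sq
  rw [swap_mul (Sq_ig_meas hφ.meas j) hm]
  refine (avg_int hφ.int hj1 hj2 (V := fun t x => ENNReal.ofReal (ψ x))
    (V' := fun t x => ENNReal.ofReal (P 0 ψ t x)) (fun t ht => hm) (C := 3) (by simp)
    (fun t ht y => ?_)).trans ?_
  · rw [← kerC hψ hψ0 ht, ← lintegral_const_mul' _ _ (by simp)]
    refine lintegral_mono fun x => ?_
    rw [← mul_assoc]
    gcongr
    refine (ENNReal.ofReal_le_ofReal (hk_exp' ht (x - y))).trans (le_of_eq ?_)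
    rw [ENNReal.ofReal_mul (by norm_num)]; simp
  · obtain ⟨C', rfl, hb⟩ := bell3 hφ h0 hψ hψ0 hp rfl
    rw [ENNReal.ofReal_mul (by norm_num), ENNReal.ofReal_mul (by norm_num),
      mul_assoc (ENNReal.ofReal 50 * ENNReal.ofReal 3)]
    rw [show ENNReal.ofReal 3 = 3 by simp]
    gcongr
    refine le_trans (le_of_eq ?_) hb
    refine setLIntegral_congr_fun measurableSet_Ioi fun t ht => lintegral_congr fun x => ?_
    rw [← ENNReal.ofReal_mul (by positivity)]

lemma young2 {a b p r : ℝ} (hp : 2 < p) (hr : r = p / (p - 2)) (ha : 0 ≤ a) (hb : 0 ≤ b) :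
    a ^ 2 * b ≤ a ^ p + b ^ r := by
  have hp2 : 0 < p - 2 := by linarith
  have hr1 : 1 < r := by rw [hr, one_lt_div (by linarith)]; linarith
  have hc : (p / 2).HolderConjugate r := by
    rw [Real.holderConjugate_iff]
    refine ⟨by linarith, ?_⟩
    rw [hr]; field_simp; ring
  have := Real.young_inequality_of_nonneg (sq_nonneg a) hb hc
  have e : (a ^ 2) ^ (p / 2) = a ^ p := by
    rw [← Real.rpow_natCast, ← Real.rpow_mul ha]; congr 1; push_cast; ring
  rw [e] at this
  have h1 : a ^ p / (p / 2) ≤ a ^ p := div_le_self (by positivity) (by linarith)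
  have h2 : b ^ r / r ≤ b ^ r := div_le_self (by positivity) (by linarith)
  linarith

lemma Cq_high {p : ℝ} (hp : 2 < p) : ∃ C : ENNReal, C ≠ ⊤ ∧
    ∀ g h : ℝ → ℝ, Nice g → (∀ x, |g x| ≤ 1) → Nice h → (∀ x, 0 ≤ h x) →
    ∫⁻ x, Cq g h x ^ (p / 2) ≤ C * Np p h := by
  have hp2 : 0 < p - 2 := by linarith
  have hr1 : 1 < p / (p - 2) := by rw [one_lt_div (by linarith)]; linarith
  set r := p / (p - 2) with hr
  set C0 := (4 * p / (p - 1) + 1) + (4 * r / (r - 1) + 1) with hC0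
  have hq1 : 0 < 4 * p / (p - 1) := div_pos (by linarith) (by linarith)
  have hq2 : 0 < 4 * r / (r - 1) := div_pos (by linarith) (by linarith)
  have hC0p : 0 < C0 := by positivity
  obtain ⟨C, hC, H⟩ := dual hp rfl (C1 := 50 * 27 * C0) (by positivity)
  refine ⟨C, hC, fun g h hg hg1 hh h0 => ?_⟩
  refine H _ _ (Cq_meas hg.meas hh.meas) (Np_fin hh (by linarith)) fun ψ hψ hψ0 => ?_
  have hm := hψ.meas.ennreal_ofReal
  unfold Cq
  rw [swap_mul (Cq_ig_meas hg.meas hh.meas) hm]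
  have hm2 : Measurable (fun q : ℝ × ℝ => ENNReal.ofReal (P 0 h (1 / 10 * q.1) q.2 ^ 2)) :=
    ((P_meas_sc hh.meas 0 (1 / 10)).pow_const _).ennreal_ofReal
  have e1 : ∫⁻ t in Set.Ioi (0:ℝ), ∫⁻ x, ENNReal.ofReal (P 1 g t x ^ 2 * P 0 h (1 / 10 * t) x ^ 2) *
      ENNReal.ofReal (ψ x) = ∫⁻ t in Set.Ioi (0:ℝ), ∫⁻ x, ENNReal.ofReal (t ^ (1 - 1) * P 1 g t x ^ 2) *
      (ENNReal.ofReal (P 0 h (1 / 10 * t) x ^ 2) * ENNReal.ofReal (ψ x)) := by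
    refine lintegral_congr fun t => lintegral_congr fun x => ?_
    rw [ENNReal.ofReal_mul (by positivity), mul_assoc]; simp
  dsimp only
  rw [e1]
  refine (avg_int hg.int le_rfl one_le_two
    (V := fun t x => ENNReal.ofReal (P 0 h (1 / 10 * t) x ^ 2) * ENNReal.ofReal (ψ x))
    (V' := fun t x => ENNReal.ofReal (P 0 h t x ^ 2) * ENNReal.ofReal (P 0 ψ t x))
    (fun t ht => (sl2 hm2 t).mul hm) (C := 27) (by simp) (fun t ht y => ?_)).trans ?_
  · rw [← kerC hψ hψ0 ht, ← lintegral_const_mul' _ _ (by simp), ← lintegral_const_mul' _ _ (by simp)]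
    refine lintegral_mono fun x => ?_
    have hB := kerB hh.int h0 (p := 2) (by norm_num) le_rfl ht x y
    simp only [Real.rpow_two] at hB
    beta_reduce
    rw [← ENNReal.ofReal_mul (by positivity), ← ENNReal.ofReal_mul (hk_nonneg _ _),
      ← ENNReal.ofReal_mul (hk_nonneg _ _), ← ENNReal.ofReal_mul (by positivity),
      show (27:ENNReal) = ENNReal.ofReal 27 by simp, ← ENNReal.ofReal_mul (by norm_num)]
    apply ENNReal.ofReal_le_ofReal
    nlinarith [mul_le_mul_of_nonneg_right hB (hψ0 x)]
  · rw [ENNReal.ofReal_mul (by norm_num), ENNReal.ofReal_mul (by norm_num),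
      mul_assoc (ENNReal.ofReal 50 * ENNReal.ofReal 27)]
    rw [show ENNReal.ofReal 27 = 27 by simp]
    gcongr
    have b1 := bell2 hh h0 hg.int hg1 (by linarith : 1 < p)
    have b2 := bell2 hψ hψ0 hg.int hg1 hr1
    have mg := P_meas hg.meas 1
    have mh := P_meas hh.meas 0
    have mψ := P_meas hψ.meas 0
    have M1 : Measurable (fun q : ℝ × ℝ => ENNReal.ofReal (P 0 h q.1 q.2 ^ p * P 1 g q.1 q.2 ^ 2)) := by
      fun_prop
    calc _ ≤ ∫⁻ t in Set.Ioi (0:ℝ), ∫⁻ x, (ENNReal.ofReal (P 0 h t x ^ p * P 1 g t x ^ 2) +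
          ENNReal.ofReal (P 0 ψ t x ^ r * P 1 g t x ^ 2)) := by
          refine lintegral_mono fun t => lintegral_mono fun x => ?_
          have n1 := P_nonneg h0 t x
          have n2 := P_nonneg hψ0 t x
          beta_reduce
          rw [← ENNReal.ofReal_mul (by positivity), ← ENNReal.ofReal_mul (by positivity),
            ← ENNReal.ofReal_add (by positivity) (by positivity)]
          apply ENNReal.ofReal_le_ofReal
          have := young2 hp hr n1 n2
          nlinarith [sq_nonneg (P 1 g t x)]
      _ = (∫⁻ t in Set.Ioi (0:ℝ), ∫⁻ x, ENNReal.ofReal (P 0 h t x ^ p * P 1 g t x ^ 2)) +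
          ∫⁻ t in Set.Ioi (0:ℝ), ∫⁻ x, ENNReal.ofReal (P 0 ψ t x ^ r * P 1 g t x ^ 2) := by
          rw [← lintegral_add_left (Measurable.lintegral_prod_right' M1)]
          refine lintegral_congr fun t => ?_
          rw [lintegral_add_left (sl2 M1 t)]
      _ ≤ ENNReal.ofReal (4 * p / (p - 1) + 1) * Np p h + ENNReal.ofReal (4 * r / (r - 1) + 1) * Np r ψ := by
          gcongr
      _ ≤ ENNReal.ofReal C0 * Np p h + ENNReal.ofReal C0 * Np r ψ := by
          gcongr <;> linarith
      _ = _ := by ring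

lemma Cq_all {p : ℝ} (hp : 1 < p) : ∃ C : ENNReal, C ≠ ⊤ ∧
    ∀ g h : ℝ → ℝ, Nice g → (∀ x, |g x| ≤ 1) → Nice h → (∀ x, 0 ≤ h x) →
    ∫⁻ x, Cq g h x ^ (p / 2) ≤ C * Np p h := by
  rcases le_or_gt p 2 with h | h
  · exact Cq_low hp h
  · exact Cq_high h

lemma Sq_pos_all {p : ℝ} (hp : 1 < p) : ∃ C : ENNReal, C ≠ ⊤ ∧
    ∀ φ : ℝ → ℝ, Nice φ → (∀ x, 0 ≤ φ x) → ∀ j : ℕ, 1 ≤ j → j ≤ 2 →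
    ∫⁻ x, Sq j φ x ^ (p / 2) ≤ C * Np p φ := by
  rcases le_or_gt p 2 with h | h
  · exact Sq_low hp h
  · exact Sq_high h

lemma Nice.pos {φ : ℝ → ℝ} (h : Nice φ) : Nice (fun x => max (φ x) 0) := by
  obtain ⟨B, hB⟩ := h.bdd
  refine ⟨h.meas.max measurable_const, h.int.pos_part, B, fun x => ?_⟩
  rw [abs_of_nonneg (le_max_right _ _)]
  exact max_le ((le_abs_self _).trans (hB x)) ((abs_nonneg _).trans (hB x))

lemma Nice.neg {φ : ℝ → ℝ} (h : Nice φ) : Nice (fun x => - φ x) := by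
  obtain ⟨B, hB⟩ := h.bdd
  exact ⟨h.meas.neg, h.int.neg, B, fun x => by simpa using hB x⟩

lemma Np_mono {f g : ℝ → ℝ} {p : ℝ} (hp : 0 ≤ p) (h : ∀ x, |f x| ≤ |g x|) : Np p f ≤ Np p g :=
  lintegral_mono fun x => ENNReal.rpow_le_rpow (ENNReal.ofReal_le_ofReal (h x)) hp

lemma Sq_all {p : ℝ} (hp : 1 < p) : ∃ C : ENNReal, C ≠ ⊤ ∧
    ∀ φ : ℝ → ℝ, Nice φ → ∀ j : ℕ, 1 ≤ j → j ≤ 2 →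
    ∫⁻ x, Sq j φ x ^ (p / 2) ≤ C * Np p φ := by
  obtain ⟨C, hC, H⟩ := Sq_pos_all hp
  refine ⟨4 ^ (p / 2) * (C + C), ENNReal.mul_ne_top
    (ENNReal.rpow_ne_top_of_nonneg (by linarith) (by simp)) (by simp [hC]), fun φ hφ j hj1 hj2 => ?_⟩
  set a : ℝ → ℝ := fun x => max (φ x) 0 with ha
  set b : ℝ → ℝ := fun x => max (- φ x) 0 with hb
  have na : Nice a := hφ.pos
  have nb : Nice b := hφ.neg.pos
  have e : φ = fun x => a x - b x := by
    ext x; simp only [ha, hb]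
    rcases le_total (φ x) 0 with h | h
    · rw [max_eq_right h, max_eq_left (by linarith)]; ring
    · rw [max_eq_left h, max_eq_right (by linarith)]; ring
  have hA := H a na (fun x => le_max_right _ _) j hj1 hj2
  have hB := H b nb (fun x => le_max_right _ _) j hj1 hj2
  have hA' : Np p a ≤ Np p φ := Np_mono (by linarith) fun x => by
    rw [abs_of_nonneg (le_max_right _ _)]; exact max_le (le_abs_self _) (abs_nonneg _)
  have hB' : Np p b ≤ Np p φ := Np_mono (by linarith) fun x => by
    rw [abs_of_nonneg (le_max_right _ _)]; exact max_le (neg_le_abs _) (abs_nonneg _)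
  have hS : ∀ x, Sq j φ x ≤ 2 * (Sq j a x + Sq j b x) := by
    intro x
    unfold Sq
    rw [← lintegral_add_left (sl1 (Sq_ig_meas na.meas j) x), ← lintegral_const_mul' _ _ (by simp)]
    refine setLIntegral_mono' measurableSet_Ioi fun t ht => ?_
    have ht : 0 < t := ht
    rw [e, P_sub na.int nb.int hj2 ht, ← ENNReal.ofReal_add (by positivity) (by positivity),
      show (2:ENNReal) = ENNReal.ofReal 2 by simp, ← ENNReal.ofReal_mul (by norm_num)]
    apply ENNReal.ofReal_le_ofReal
    have : 0 < t ^ (j - 1) := by positivity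
    nlinarith [mul_nonneg this.le (sq_nonneg (P j a t x + P j b t x))]
  have hmA := Sq_meas na.meas j
  calc ∫⁻ x, Sq j φ x ^ (p / 2) ≤ ∫⁻ x, 4 ^ (p / 2) * (Sq j a x ^ (p / 2) + Sq j b x ^ (p / 2)) := by
        refine lintegral_mono fun x => ?_
        calc Sq j φ x ^ (p / 2) ≤ (4 * max (Sq j a x) (Sq j b x)) ^ (p / 2) := by
              gcongr
              refine (hS x).trans ?_
              calc 2 * (Sq j a x + Sq j b x) ≤ 2 * (max (Sq j a x) (Sq j b x) + max (Sq j a x) (Sq j b x)) := by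
                    gcongr
                    · exact le_max_left _ _
                    · exact le_max_right _ _
                _ = _ := by ring
          _ = 4 ^ (p / 2) * (max (Sq j a x) (Sq j b x)) ^ (p / 2) := by
              rw [ENNReal.mul_rpow_of_nonneg _ _ (by linarith)]
          _ ≤ _ := by
              gcongr
              rcases le_total (Sq j a x) (Sq j b x) with h | h
              · rw [max_eq_right h]; exact le_add_self
              · rw [max_eq_left h]; exact le_self_add
    _ = 4 ^ (p / 2) * ((∫⁻ x, Sq j a x ^ (p / 2)) + ∫⁻ x, Sq j b x ^ (p / 2)) := by
        rw [lintegral_const_mul' _ _ (ENNReal.rpow_ne_top_of_nonneg (by linarith) (by simp)),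
          lintegral_add_left (hmA.pow_const _)]
    _ ≤ 4 ^ (p / 2) * (C * Np p φ + C * Np p φ) := by
        gcongr
        · exact hA.trans (by gcongr)
        · exact hB.trans (by gcongr)
    _ = _ := by ring

end KPV

namespace KPV

/-- quantitative continuity of the heat semigroup at time zero -/
structure Sm (f : ℝ → ℝ) : Prop where
  nice : Nice f
  sup : ∃ M, 0 ≤ M ∧ ∀ t > 0, ∀ x, |f x - P 0 f t x| ≤ M * √t
  l1 : ∃ M, 0 ≤ M ∧ ∀ t > 0, ∫⁻ x, ENNReal.ofReal |f x - P 0 f t x| ≤ ENNReal.ofReal (M * √t)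

lemma hk_abs_mul {t : ℝ} (ht : 0 < t) (z : ℝ) : hk t z * |z| ≤ 4 * √t * hk (2 * t) z := by
  have h := K_bound ht (n := 1) (by omega) z
  have hs : √t * √t = t := Real.mul_self_sqrt ht.le
  have hsp : 0 < √t := Real.sqrt_pos.2 ht
  have e : |K 1 t z| = |z| / (2 * t) * hk t z := by
    simp only [K, abs_mul, abs_neg, abs_div, abs_of_nonneg (hk_nonneg t z), abs_two, abs_of_pos ht]
  rw [e, pow_one] at h
  have h2 : 2 * t * (|z| / (2 * t) * hk t z) ≤ 2 * t * (2 * (√t)⁻¹ * hk (2 * t) z) := by gcongr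
  have e1 : 2 * t * (|z| / (2 * t) * hk t z) = hk t z * |z| := by field_simp
  have e2 : 2 * t * (2 * (√t)⁻¹ * hk (2 * t) z) = 4 * √t * hk (2 * t) z := by
    have : t * (√t)⁻¹ = √t := by field_simp; nlinarith
    linear_combination 4 * hk (2 * t) z * this
  linarith

lemma diff_le {f : ℝ → ℝ} (hf : Nice f) {t : ℝ} (ht : 0 < t) (x : ℝ) :
    ENNReal.ofReal |f x - P 0 f t x| ≤
      ∫⁻ y, ENNReal.ofReal (hk t (x - y)) * ENNReal.ofReal |f x - f y| := by
  have e : f x - P 0 f t x = ∫ y, hk t (x - y) * (f x - f y) := by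
    have h1 : ∫ y, hk t (x - y) * (f x - f y) = (∫ y, hk t (x - y) * f x) - ∫ y, hk t (x - y) * f y := by
      rw [← integral_sub (g := fun y => hk t (x - y) * f y) ((hk_sub_int ht x).mul_const _) (P_ig hf.int (n := 0) (by omega) ht x)]
      congr 1; ext y; ring
    rw [h1, integral_mul_const, hk_sub_integral ht, one_mul]; rfl
  rw [e, ← Real.enorm_eq_ofReal_abs]
  refine (enorm_integral_le_lintegral_enorm _).trans (lintegral_mono fun y => ?_)
  beta_reduce
  rw [Real.enorm_eq_ofReal_abs, abs_mul, ENNReal.ofReal_mul (abs_nonneg _), abs_of_nonneg (hk_nonneg _ _)]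

lemma shift_l1 {f f' : ℝ → ℝ} (hd : ∀ x, HasDerivAt f (f' x) x) (hc : Continuous f') (z : ℝ) :
    ∫⁻ x, ENNReal.ofReal |f x - f (x - z)| ≤ ENNReal.ofReal |z| * ∫⁻ x, ENNReal.ofReal |f' x| := by
  have h1 : ∀ x, ENNReal.ofReal |f x - f (x - z)| ≤
      ∫⁻ θ in Set.Ioc (0:ℝ) 1, ENNReal.ofReal |z| * ENNReal.ofReal |f' (x - z + θ * z)| := by
    intro x
    have e : ∫ θ in (0:ℝ)..1, z * f' (x - z + θ * z) = f x - f (x - z) := by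
      have := intervalIntegral.integral_eq_sub_of_hasDerivAt (a := 0) (b := 1)
        (f := fun θ => f (x - z + θ * z)) (f' := fun θ => z * f' (x - z + θ * z)) (fun θ _ => ?_)
        ((by fun_prop : Continuous _).intervalIntegrable _ _)
      · rw [this]; simp
      · have h2 : HasDerivAt (fun θ : ℝ => x - z + θ * z) z θ := by
          simpa using ((hasDerivAt_id θ).mul_const z).const_add (x - z)
        exact ((hd (x - z + θ * z)).comp θ h2).congr_deriv (by ring)
    rw [← e, intervalIntegral.integral_of_le zero_le_one, ← Real.enorm_eq_ofReal_abs]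
    refine (enorm_integral_le_lintegral_enorm _).trans (lintegral_mono fun y => ?_)
    beta_reduce
    rw [Real.enorm_eq_ofReal_abs, abs_mul, ENNReal.ofReal_mul (abs_nonneg _)]
  calc _ ≤ ∫⁻ x, ∫⁻ θ in Set.Ioc (0:ℝ) 1, ENNReal.ofReal |z| * ENNReal.ofReal |f' (x - z + θ * z)| :=
        lintegral_mono h1
    _ = ∫⁻ θ in Set.Ioc (0:ℝ) 1, ∫⁻ x, ENNReal.ofReal |z| * ENNReal.ofReal |f' (x - z + θ * z)| := by
        rw [lintegral_lintegral_swap]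
        have : Continuous (fun q : ℝ × ℝ => |f' (q.1 - z + q.2 * z)|) := by fun_prop
        exact (this.measurable.ennreal_ofReal.const_mul _).aemeasurable
    _ = ∫⁻ θ in Set.Ioc (0:ℝ) 1, ENNReal.ofReal |z| * ∫⁻ x, ENNReal.ofReal |f' x| := by
        refine lintegral_congr fun θ => ?_
        rw [lintegral_const_mul' _ _ ENNReal.ofReal_ne_top]
        congr 1
        rw [← lintegral_add_right_eq_self (fun x => ENNReal.ofReal |f' x|) (-z + θ * z)]
        congr 1; ext x; ring_nf
    _ = _ := by simp

lemma Sm_of_deriv {f f' : ℝ → ℝ} (hf : Nice f) (hd : ∀ x, HasDerivAt f (f' x) x) (hc : Continuous f')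
    (hf' : Nice f') : Sm f := by
  have hfc : Continuous f := continuous_iff_continuousAt.2 fun x => (hd x).continuousAt
  obtain ⟨M, hM⟩ := hf'.bdd
  have hM0 : 0 ≤ M := (abs_nonneg _).trans (hM 0)
  refine ⟨hf, ⟨4 * M, by positivity, fun t ht x => ?_⟩, ⟨4 * (∫ x, |f' x|), by positivity, fun t ht => ?_⟩⟩
  · rw [← ENNReal.ofReal_le_ofReal_iff (by positivity)]
    refine (diff_le hf ht x).trans ?_
    calc _ ≤ ∫⁻ y, ENNReal.ofReal (4 * M * √t) * ENNReal.ofReal (hk (2 * t) (x - y)) := by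
          refine lintegral_mono fun y => ?_
          beta_reduce
          rw [← ENNReal.ofReal_mul (hk_nonneg _ _), ← ENNReal.ofReal_mul (by positivity)]
          apply ENNReal.ofReal_le_ofReal
          have h1 : |f x - f y| ≤ M * |x - y| := by
            have := Convex.norm_image_sub_le_of_norm_hasDerivWithin_le (f := f) (f' := f') (C := M)
              (s := Set.univ) (x := y) (y := x) (fun z _ => (hd z).hasDerivWithinAt)
              (fun z _ => hM z) convex_univ trivial trivial
            simpa using this
          have h2 := hk_abs_mul ht (x - y)
          calc hk t (x - y) * |f x - f y| ≤ hk t (x - y) * (M * |x - y|) := by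
                gcongr; exact hk_nonneg _ _
            _ = M * (hk t (x - y) * |x - y|) := by ring
            _ ≤ M * (4 * √t * hk (2 * t) (x - y)) := by gcongr
            _ = _ := by ring
      _ = _ := by
          rw [lintegral_const_mul' _ _ ENNReal.ofReal_ne_top, lint_hk_sub (by positivity), mul_one]
  · have hI : ∫⁻ x, ENNReal.ofReal |f' x| = ENNReal.ofReal (∫ x, |f' x|) :=
      (ofReal_integral_eq_lintegral_ofReal hf'.int.abs
        (Filter.Eventually.of_forall fun x => abs_nonneg _)).symm
    have mk : Measurable (fun z => ENNReal.ofReal (hk t z)) := by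
      have := (K_meas1 0 t 0).comp measurable_neg
      refine Measurable.ennreal_ofReal ?_
      have e : hk t = (fun y => K 0 t (0 - y)) ∘ Neg.neg := by ext z; simp [K]
      rw [e]; exact this
    have mf : Measurable (fun q : ℝ × ℝ => ENNReal.ofReal |f q.1 - f (q.1 - q.2)|) := by
      have : Continuous (fun q : ℝ × ℝ => |f q.1 - f (q.1 - q.2)|) := by fun_prop
      exact this.measurable.ennreal_ofReal
    calc _ ≤ ∫⁻ x, ∫⁻ y, ENNReal.ofReal (hk t (x - y)) * ENNReal.ofReal |f x - f y| :=
          lintegral_mono fun x => diff_le hf ht x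
      _ = ∫⁻ x, ∫⁻ z, ENNReal.ofReal (hk t z) * ENNReal.ofReal |f x - f (x - z)| := by
          refine lintegral_congr fun x => ?_
          rw [← lintegral_sub_left_eq_self (fun z => ENNReal.ofReal (hk t z) * ENNReal.ofReal |f x - f (x - z)|) x]
          simp
      _ = ∫⁻ z, ∫⁻ x, ENNReal.ofReal (hk t z) * ENNReal.ofReal |f x - f (x - z)| := by
          rw [lintegral_lintegral_swap]
          exact ((mk.comp measurable_snd).mul mf).aemeasurable
      _ ≤ ∫⁻ z, ENNReal.ofReal (4 * (∫ x, |f' x|) * √t) * ENNReal.ofReal (hk (2 * t) z) := by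
          refine lintegral_mono fun z => ?_
          beta_reduce
          rw [lintegral_const_mul' _ _ ENNReal.ofReal_ne_top]
          calc _ ≤ ENNReal.ofReal (hk t z) * (ENNReal.ofReal |z| * ENNReal.ofReal (∫ x, |f' x|)) := by
                gcongr; rw [← hI]; exact shift_l1 hd hc z
            _ ≤ _ := by
                have hI0 : 0 ≤ ∫ x, |f' x| := by positivity
                rw [← ENNReal.ofReal_mul (abs_nonneg _), ← ENNReal.ofReal_mul (hk_nonneg _ _),
                  ← ENNReal.ofReal_mul (by positivity)]
                apply ENNReal.ofReal_le_ofReal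
                nlinarith [mul_le_mul_of_nonneg_right (hk_abs_mul ht z) hI0]
      _ = _ := by
          rw [lintegral_const_mul' _ _ ENNReal.ofReal_ne_top, lint_hk (by positivity), mul_one]

lemma schwartz_nice (f : SchwartzMap ℝ ℝ) : Nice f := by
  refine ⟨f.continuous.measurable, f.integrable, ?_⟩
  obtain ⟨C, hC⟩ := f.decay 0 0
  exact ⟨C, fun x => by simpa using hC.2 x⟩

lemma schwartz_Sm (f : SchwartzMap ℝ ℝ) : Sm f := by
  have h := schwartz_nice (SchwartzMap.derivCLM ℝ ℝ f)
  refine Sm_of_deriv (schwartz_nice f) (f' := SchwartzMap.derivCLM ℝ ℝ f) (fun x => ?_)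
    (SchwartzMap.continuous _) h
  rw [SchwartzMap.derivCLM_apply]
  exact f.differentiableAt.hasDerivAt

end KPV

namespace KPV

/-- trilinear product of heat extensions -/
def Tr (f g h : ℝ → ℝ) (t : ℝ) (i j k : ℕ) (r x : ℝ) : ℝ := P i f r x * P j g r x * P k h (t - r) x

lemma Tr_meas {f g h : ℝ → ℝ} (hf : Measurable f) (hg : Measurable g) (hh : Measurable h) (t : ℝ)
    (i j k : ℕ) : Measurable (fun q : ℝ × ℝ => Tr f g h t i j k q.1 q.2) := by
  have h1 := P_meas hf i
  have h2 := P_meas hg j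
  have h3 : Measurable (fun q : ℝ × ℝ => P k h (t - q.1) q.2) :=
    (P_meas hh k).comp (by fun_prop : Measurable (fun q : ℝ × ℝ => (t - q.1, q.2)))
  unfold Tr
  fun_prop

lemma Tr_int {f g h : ℝ → ℝ} (hf : Nice f) (hg : Nice g) (hh : Nice h) {t r : ℝ} (hr : 0 < r)
    (hrt : r < t) {i j k : ℕ} (hi : i ≤ 2) (hj : j ≤ 2) (hk : k ≤ 2) :
    Integrable (Tr f g h t i j k r) := by
  obtain ⟨Bf, hBf⟩ := (P_nice hf hi hr).bdd
  obtain ⟨Bg, hBg⟩ := (P_nice hg hj hr).bdd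
  have ht : 0 < t - r := by linarith
  refine (Pn_int hh.int hk ht).bdd_mul (c := Bf * Bg)
    ((P_cont hf.int hi hr).mul (P_cont hg.int hj hr)).aestronglyMeasurable ?_
  refine Filter.Eventually.of_forall fun x => ?_
  rw [norm_mul]
  have := hBf x
  exact mul_le_mul (hBf x) (hBg x) (abs_nonneg _) ((abs_nonneg _).trans this)

lemma Tr_l1 {f g h : ℝ → ℝ} (hf : Nice f) (hg : Nice g) (hh : Nice h) {t ρ : ℝ} (hρ : 0 < ρ)
    {i j k : ℕ} (hi : i ≤ 2) (hj : j ≤ 2) (hk : k ≤ 2) :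
    ∃ M, ∀ r ∈ Set.Ioc ρ (t / 2), ∫ x, |Tr f g h t i j k r x| ≤ M := by
  obtain ⟨Bf, hBf⟩ := hf.bdd
  obtain ⟨Bg, hBg⟩ := hg.bdd
  have hBf0 : 0 ≤ Bf := (abs_nonneg _).trans (hBf 0)
  have hBg0 : 0 ≤ Bg := (abs_nonneg _).trans (hBg 0)
  refine ⟨(2 * (√ρ)⁻¹ ^ i * Bf) * (2 * (√ρ)⁻¹ ^ j * Bg) * (2 * (√ρ)⁻¹ ^ k * ∫ x, |h x|), fun r hr => ?_⟩
  have hr0 : 0 < r := hρ.trans hr.1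
  have hrt : r < t := by linarith [hr.2]
  have htr : 0 < t - r := by linarith
  have hsq : 0 < √ρ := Real.sqrt_pos.2 hρ
  calc ∫ x, |Tr f g h t i j k r x| ≤ ∫ x, (2 * (√ρ)⁻¹ ^ i * Bf) * (2 * (√ρ)⁻¹ ^ j * Bg) * |P k h (t - r) x| := by
        refine integral_mono (Tr_int hf hg hh hr0 hrt hi hj hk).abs
          ((Pn_int hh.int hk htr).abs.const_mul _) fun x => ?_
        unfold Tr
        beta_reduce
        rw [abs_mul, abs_mul]
        gcongr
        · refine (Pn_abs_le hf.int hBf hi hr0 x).trans ?_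
          gcongr; exact hr.1.le
        · refine (Pn_abs_le hg.int hBg hj hr0 x).trans ?_
          gcongr; exact hr.1.le
    _ ≤ _ := by
        rw [integral_const_mul]
        gcongr
        refine (Pn_L1 hh.int hk htr).trans ?_
        have : 0 ≤ ∫ x, |h x| := by positivity
        gcongr
        linarith [hr.1, hr.2]

lemma Tr_prod {f g h : ℝ → ℝ} (hf : Nice f) (hg : Nice g) (hh : Nice h) {t ρ : ℝ} (hρ : 0 < ρ)
    {i j k : ℕ} (hi : i ≤ 2) (hj : j ≤ 2) (hk : k ≤ 2) :
    Integrable (fun q : ℝ × ℝ => Tr f g h t i j k q.1 q.2)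
      ((volume.restrict (Set.Ioc ρ (t / 2))).prod volume) := by
  have hm := Tr_meas hf.meas hg.meas hh.meas t i j k
  rw [integrable_prod_iff hm.aestronglyMeasurable]
  obtain ⟨M, hM⟩ := Tr_l1 hf hg hh (t := t) hρ hi hj hk
  constructor
  · refine (ae_restrict_iff' measurableSet_Ioc).2 (Filter.Eventually.of_forall fun r hr => ?_)
    exact Tr_int hf hg hh (hρ.trans hr.1) (by linarith [hr.1, hr.2]) hi hj hk
  · refine Measure.integrableOn_of_bounded (M := M) (by simp) ?_ ?_
    · exact (hm.norm.stronglyMeasurable.integral_prod_right (ν := volume)).aestronglyMeasurable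
    · refine (ae_restrict_iff' measurableSet_Ioc).2 (Filter.Eventually.of_forall fun r hr => ?_)
      rw [Real.norm_of_nonneg (integral_nonneg fun _ => norm_nonneg _)]
      exact hM r hr

lemma Tr_space {f g h : ℝ → ℝ} (hf : Nice f) (hg : Nice g) (hh : Nice h) {t r : ℝ} (hr : 0 < r)
    (hrt : r < t) :
    ∫ x, (Tr f g h t 2 0 0 r x + Tr f g h t 0 2 0 r x - Tr f g h t 0 0 2 r x) =
      ∫ x, (-2) * Tr f g h t 1 1 0 r x := by
  have ht : 0 < t - r := by linarith
  have I : ∀ {i j k : ℕ}, i ≤ 2 → j ≤ 2 → k ≤ 2 → Integrable (Tr f g h t i j k r) :=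
    fun hi hj hk => Tr_int hf hg hh hr hrt hi hj hk
  have i1 := I (i := 2) (j := 0) (k := 0) (by omega) (by omega) (by omega)
  have i2 := I (i := 0) (j := 2) (k := 0) (by omega) (by omega) (by omega)
  have i3 := I (i := 0) (j := 0) (k := 2) (by omega) (by omega) (by omega)
  have i4 := I (i := 1) (j := 1) (k := 0) (by omega) (by omega) (by omega)
  have hI : Integrable (fun x => Tr f g h t 2 0 0 r x + Tr f g h t 0 2 0 r x - Tr f g h t 0 0 2 r x) :=
    (i1.add i2).sub i3
  have j1 := I (i := 1) (j := 0) (k := 0) (by omega) (by omega) (by omega)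
  have j2 := I (i := 0) (j := 1) (k := 0) (by omega) (by omega) (by omega)
  have j3 := I (i := 0) (j := 0) (k := 1) (by omega) (by omega) (by omega)
  rw [← sub_eq_zero, ← integral_sub hI (i4.const_mul (-2))]
  refine integral_eq_zero_of_hasDerivAt_of_integrable
    (f := fun x => Tr f g h t 1 0 0 r x + Tr f g h t 0 1 0 r x - Tr f g h t 0 0 1 r x)
    (fun x => ?_) (hI.sub (i4.const_mul (-2))) ((j1.add j2).sub j3)
  have f0 := P_dx hf.int (n := 0) (by omega) hr x
  have f1 := P_dx hf.int (n := 1) (by omega) hr x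
  have g0 := P_dx hg.int (n := 0) (by omega) hr x
  have g1 := P_dx hg.int (n := 1) (by omega) hr x
  have h0 := P_dx hh.int (n := 0) (by omega) ht x
  have h1 := P_dx hh.int (n := 1) (by omega) ht x
  refine ((((f1.mul g0).mul h0).add ((f0.mul g1).mul h0)).sub ((f0.mul g0).mul h1)).congr_deriv ?_
  simp only [Tr, Pi.mul_apply]
  ring

lemma Tr_time {f g h : ℝ → ℝ} (hf : Nice f) (hg : Nice g) (hh : Nice h) {t ρ : ℝ} (hρ : 0 < ρ)
    (hρt : ρ ≤ t / 2) :
    ENNReal.ofReal |(∫ x, Tr f g h t 0 0 0 (t / 2) x) - ∫ x, Tr f g h t 0 0 0 ρ x| ≤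
      2 * ∫⁻ r in Set.Ioc 0 (t / 2), ∫⁻ x, ENNReal.ofReal |Tr f g h t 1 1 0 r x| := by
  have i1 := Tr_prod hf hg hh (t := t) hρ (i := 2) (j := 0) (k := 0) (by omega) (by omega) (by omega)
  have i2 := Tr_prod hf hg hh (t := t) hρ (i := 0) (j := 2) (k := 0) (by omega) (by omega) (by omega)
  have i3 := Tr_prod hf hg hh (t := t) hρ (i := 0) (j := 0) (k := 2) (by omega) (by omega) (by omega)
  have hI : Integrable (fun q : ℝ × ℝ => Tr f g h t 2 0 0 q.1 q.2 + Tr f g h t 0 2 0 q.1 q.2 -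
      Tr f g h t 0 0 2 q.1 q.2) ((volume.restrict (Set.Ioc ρ (t / 2))).prod volume) :=
    (i1.add i2).sub i3
  have ftc : ∀ x, Tr f g h t 0 0 0 (t / 2) x - Tr f g h t 0 0 0 ρ x =
      ∫ r in Set.Ioc ρ (t / 2), (Tr f g h t 2 0 0 r x + Tr f g h t 0 2 0 r x - Tr f g h t 0 0 2 r x) := by
    intro x
    rw [← intervalIntegral.integral_of_le hρt]
    have hpos : ∀ r ∈ Set.uIcc ρ (t / 2), 0 < r ∧ 0 < t - r := by
      intro r hr
      rw [Set.uIcc_of_le hρt] at hr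
      exact ⟨by linarith [hr.1], by linarith [hr.1, hr.2]⟩
    have hc : ∀ {w : ℝ → ℝ} (_ : Nice w) {n : ℕ}, n ≤ 2 → ContinuousOn (fun r => P n w r x) (Set.Ioi 0) := by
      intro w hw n hn
      exact (P_contOn hw.int hn).comp (f := fun r : ℝ => (r, x)) (by fun_prop) (fun r hr => ⟨hr, trivial⟩)
    have hTc : ∀ {i j k : ℕ}, i ≤ 2 → j ≤ 2 → k ≤ 2 →
        ContinuousOn (fun r => Tr f g h t i j k r x) (Set.uIcc ρ (t / 2)) := by
      intro i j k hi hj hk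
      have c1 := (hc hf hi).mono (fun r hr => (hpos r hr).1)
      have c2 := (hc hg hj).mono (fun r hr => (hpos r hr).1)
      have c3 : ContinuousOn (fun r => P k h (t - r) x) (Set.uIcc ρ (t / 2)) :=
        (hc hh hk).comp (f := fun r : ℝ => t - r) (by fun_prop) (fun r hr => (hpos r hr).2)
      exact (c1.mul c2).mul c3
    refine (intervalIntegral.integral_eq_sub_of_hasDerivAt
      (f := fun r => Tr f g h t 0 0 0 r x) (fun r hr => ?_) ?_).symm
    · have h1 := P_dt hf.int (hpos r hr).1 x
      have h2 := P_dt hg.int (hpos r hr).1 x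
      have h3 : HasDerivAt (fun r => P 0 h (t - r) x) (- P 2 h (t - r) x) r := by
        have := (P_dt hh.int (hpos r hr).2 x).comp r ((hasDerivAt_id r).const_sub t)
        exact this.congr_deriv (by simp)
      refine ((h1.mul h2).mul h3).congr_deriv ?_
      simp only [Tr, Pi.mul_apply]
      ring
    · exact (((hTc (by omega) (by omega) (by omega)).add (hTc (by omega) (by omega) (by omega))).sub
        (hTc (by omega) (by omega) (by omega))).intervalIntegrable
  have e : (∫ x, Tr f g h t 0 0 0 (t / 2) x) - ∫ x, Tr f g h t 0 0 0 ρ x =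
      ∫ r in Set.Ioc ρ (t / 2), ∫ x, (-2) * Tr f g h t 1 1 0 r x := by
    rw [← integral_sub (Tr_int hf hg hh (by linarith) (by linarith) (by omega) (by omega) (by omega))
      (Tr_int hf hg hh hρ (by linarith) (by omega) (by omega) (by omega))]
    simp_rw [ftc]
    rw [← integral_integral_swap (f := fun r x => Tr f g h t 2 0 0 r x + Tr f g h t 0 2 0 r x -
      Tr f g h t 0 0 2 r x) hI]
    refine setIntegral_congr_fun measurableSet_Ioc fun r hr => ?_
    exact Tr_space hf hg hh (hρ.trans hr.1) (by linarith [hr.1, hr.2])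
  rw [e, ← Real.enorm_eq_ofReal_abs]
  refine (enorm_integral_le_lintegral_enorm _).trans ?_
  rw [← lintegral_const_mul' _ _ (by simp)]
  refine (lintegral_mono_set (Set.Ioc_subset_Ioc_left hρ.le)).trans (lintegral_mono fun r => ?_)
  beta_reduce
  refine (enorm_integral_le_lintegral_enorm _).trans ?_
  rw [← lintegral_const_mul' _ _ (by simp)]
  refine lintegral_mono fun x => ?_
  beta_reduce
  rw [Real.enorm_eq_ofReal_abs, abs_mul, ENNReal.ofReal_mul (abs_nonneg _)]
  simp

lemma Nice.l1nonneg (f : ℝ → ℝ) : 0 ≤ ∫ x, |f x| := integral_nonneg fun _ => abs_nonneg _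

lemma P0_L1 {h : ℝ → ℝ} (hh : Integrable h) {t : ℝ} (ht : 0 < t) : ∫ x, |P 0 h t x| ≤ ∫ x, |h x| := by
  rw [← P0_integral hh.abs ht]
  refine integral_mono (P0_int hh ht).abs (P0_int hh.abs ht) fun x => ?_
  unfold P
  rw [← norm_eq_abs]
  refine norm_integral_le_of_norm_le (P_ig hh.abs (n := 0) (by omega) ht x) ?_
  exact Filter.Eventually.of_forall fun y => by
    rw [norm_mul, norm_eq_abs, norm_eq_abs, K, abs_of_nonneg (hk_nonneg _ _)]

lemma half {f g h : ℝ → ℝ} (hf : Sm f) (hg : Sm g) (hh : Sm h) {t : ℝ} (ht : 0 < t) :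
    ENNReal.ofReal |(∫ x, f x * g x * P 0 h t x) - ∫ x, P 0 f (t / 2) x * P 0 g (t / 2) x * P 0 h (t / 2) x| ≤
      2 * ∫⁻ r in Set.Ioc 0 (t / 2), ∫⁻ x, ENNReal.ofReal |P 1 f r x * P 1 g r x * P 0 h (t - r) x| := by
  have hW : ∫ x, P 0 f (t / 2) x * P 0 g (t / 2) x * P 0 h (t / 2) x = ∫ x, Tr f g h t 0 0 0 (t / 2) x := by
    unfold Tr; rw [sub_half]
  rw [hW]
  set R := 2 * ∫⁻ r in Set.Ioc 0 (t / 2), ∫⁻ x, ENNReal.ofReal |P 1 f r x * P 1 g r x * P 0 h (t - r) x|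
    with hR
  by_cases hRt : R = ⊤
  · rw [hRt]; exact le_top
  obtain ⟨Bf, hBf⟩ := hf.nice.bdd
  obtain ⟨Bg, hBg⟩ := hg.nice.bdd
  obtain ⟨Bh, hBh⟩ := hh.nice.bdd
  obtain ⟨Mf, hMf0, hMf⟩ := hf.sup
  obtain ⟨Mg, hMg0, hMg⟩ := hg.sup
  obtain ⟨Mh, hMh0, hMh⟩ := hh.sup
  have hBf0 : 0 ≤ Bf := (abs_nonneg _).trans (hBf 0)
  have hBg0 : 0 ≤ Bg := (abs_nonneg _).trans (hBg 0)
  have hBh0 : 0 ≤ Bh := (abs_nonneg _).trans (hBh 0)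
  set X := ∫ x, f x * g x * P 0 h t x with hX
  set Y := ∫ x, Tr f g h t 0 0 0 (t / 2) x with hY
  set N := Mf * Bg * (∫ x, |h x|) + (∫ x, |f x|) * Mg * Bh + (∫ x, |f x|) * Bg * Mh with hN
  have hN0 : 0 ≤ N := by
    have := Nice.l1nonneg f
    have := Nice.l1nonneg h
    positivity
  have hTr000 : ∀ ρ, 0 < ρ → ρ ≤ t / 2 → |X - ∫ x, Tr f g h t 0 0 0 ρ x| ≤ N * √ρ := by
    intro ρ hρ hρt
    have htρ : 0 < t - ρ := by linarith
    have ih := P0_int hh.nice.int htρ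
    have i0 : Integrable (fun x => f x * g x * P 0 h t x) := by
      refine (hf.nice.int.bdd_mul (c := Bg * Bh)
        (hg.nice.meas.mul (P_cont hh.nice.int (n := 0) (by omega) ht).measurable).aestronglyMeasurable ?_).congr
        (Filter.Eventually.of_forall fun x => ?_)
      · refine Filter.Eventually.of_forall fun x => ?_
        rw [Pi.mul_apply, norm_mul]
        exact mul_le_mul (hBg x) (P0_abs_le hBh ht x) (abs_nonneg _) hBg0
      · simp only [Pi.mul_apply]; ring
    rw [hX, ← integral_sub i0 (Tr_int hf.nice hg.nice hh.nice hρ (by linarith) (by omega) (by omega) (by omega))]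
    have hHt : ∀ x, |P 0 h (t - ρ) x - P 0 h t x| ≤ Mh * √ρ := by
      intro x
      have e1 : P 0 h t x = P 0 (P 0 h ρ) (t - ρ) x := by
        rw [P_semi hh.nice.int htρ hρ]; congr 1; ring
      rw [e1, ← P_sub hh.nice.int (P0_int hh.nice.int hρ) (by omega) htρ]
      exact P0_abs_le (fun y => hMh ρ hρ y) htρ x
    rw [← norm_eq_abs]
    calc _ ≤ ∫ x, (Mf * √ρ * Bg * |P 0 h (t - ρ) x| + |f x| * (Mg * √ρ) * Bh + |f x| * Bg * (Mh * √ρ)) := by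
          refine norm_integral_le_of_norm_le (((ih.abs.const_mul _).add
            ((hf.nice.int.abs.mul_const _).mul_const _)).add
            ((hf.nice.int.abs.mul_const _).mul_const _)) (Filter.Eventually.of_forall fun x => ?_)
          unfold Tr
          rw [norm_eq_abs]
          have e : f x * g x * P 0 h t x - P 0 f ρ x * P 0 g ρ x * P 0 h (t - ρ) x =
            (f x - P 0 f ρ x) * P 0 g ρ x * P 0 h (t - ρ) x + f x * (g x - P 0 g ρ x) * P 0 h (t - ρ) x
              + f x * g x * (P 0 h t x - P 0 h (t - ρ) x) := by ring
          rw [e]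
          refine (abs_add_three _ _ _).trans ?_
          simp only [abs_mul]
          have a1 := hMf ρ hρ x
          have a2 := hMg ρ hρ x
          have a3 := hHt x
          rw [abs_sub_comm] at a3
          have b1 := P0_abs_le hBg hρ x
          have b2 := P0_abs_le hBh htρ x
          have b3 := hBg x
          gcongr
      _ = Mf * √ρ * Bg * (∫ x, |P 0 h (t - ρ) x|) + (∫ x, |f x|) * (Mg * √ρ) * Bh +
          (∫ x, |f x|) * Bg * (Mh * √ρ) := by
          have k1 : Integrable (fun x => Mf * √ρ * Bg * |P 0 h (t - ρ) x|) := ih.abs.const_mul _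
          have k2 : Integrable (fun x => |f x| * (Mg * √ρ) * Bh) :=
            (hf.nice.int.abs.mul_const _).mul_const _
          have k3 : Integrable (fun x => |f x| * Bg * (Mh * √ρ)) :=
            (hf.nice.int.abs.mul_const _).mul_const _
          have k12 : Integrable (fun x => Mf * √ρ * Bg * |P 0 h (t - ρ) x| + |f x| * (Mg * √ρ) * Bh) :=
            k1.add k2
          rw [integral_add k12 k3, integral_add k1 k2]
          simp only [integral_mul_const, integral_const_mul]
      _ ≤ Mf * √ρ * Bg * (∫ x, |h x|) + (∫ x, |f x|) * (Mg * √ρ) * Bh +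
          (∫ x, |f x|) * Bg * (Mh * √ρ) := by
          have hl := P0_L1 hh.nice.int htρ
          have hl2 : 0 ≤ Mf * √ρ * Bg := by positivity
          linarith [mul_le_mul_of_nonneg_left hl hl2]
      _ = _ := by rw [hN]; ring
  have key : ∀ ρ, 0 < ρ → ρ ≤ t / 2 → |X - Y| ≤ R.toReal + N * √ρ := by
    intro ρ hρ hρt
    have h1 := hTr000 ρ hρ hρt
    have h2 := Tr_time hf.nice hg.nice hh.nice hρ hρt
    have h3 : |Y - ∫ x, Tr f g h t 0 0 0 ρ x| ≤ R.toReal :=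
      (ENNReal.ofReal_le_iff_le_toReal hRt).1 h2
    calc |X - Y| = |(X - ∫ x, Tr f g h t 0 0 0 ρ x) - (Y - ∫ x, Tr f g h t 0 0 0 ρ x)| := by congr 1; ring
      _ ≤ _ := (abs_sub _ _).trans (by linarith)
  rw [ENNReal.ofReal_le_iff_le_toReal hRt]
  have hlim : Filter.Tendsto (fun ρ => R.toReal + N * √ρ) (nhdsWithin 0 (Set.Ioi 0)) (nhds (R.toReal)) := by
    have : Filter.Tendsto (fun ρ => R.toReal + N * √ρ) (nhds 0) (nhds (R.toReal + N * √0)) := by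
      apply Continuous.tendsto; fun_prop
    simp only [Real.sqrt_zero, mul_zero, add_zero] at this
    exact this.mono_left nhdsWithin_le_nhds
  refine ge_of_tendsto hlim ?_
  filter_upwards [Ioc_mem_nhdsGT (by linarith : (0:ℝ) < t / 2)] with ρ hρ
  exact key ρ hρ.1 hρ.2

/-- the basic identity, as an inequality -/
lemma D_le {f g h : ℝ → ℝ} (hf : Sm f) (hg : Sm g) (hh : Sm h) {t : ℝ} (ht : 0 < t) :
    ENNReal.ofReal |(∫ x, f x * h x * P 0 g t x) - ∫ x, f x * g x * P 0 h t x| ≤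
      2 * (∫⁻ r in Set.Ioc 0 (t / 2), ∫⁻ x, ENNReal.ofReal |P 1 f r x * P 1 h r x * P 0 g (t - r) x|) +
      2 * ∫⁻ r in Set.Ioc 0 (t / 2), ∫⁻ x, ENNReal.ofReal |P 1 f r x * P 1 g r x * P 0 h (t - r) x| := by
  refine le_trans ?_ (add_le_add (half hf hh hg ht) (half hf hg hh ht))
  rw [← ENNReal.ofReal_add (abs_nonneg _) (abs_nonneg _)]
  apply ENNReal.ofReal_le_ofReal
  have e : ∫ x, P 0 f (t / 2) x * P 0 h (t / 2) x * P 0 g (t / 2) x =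
      ∫ x, P 0 f (t / 2) x * P 0 g (t / 2) x * P 0 h (t / 2) x := by
    congr 1; ext x; ring
  rw [e]
  refine le_trans (le_of_eq ?_) (abs_sub _ _)
  congr 1; ring

end KPV

namespace KPV

lemma fub {w E : ℝ → ENNReal} (hw : Measurable w) (hE : Measurable E) {a : ℝ} :
    ∫⁻ t in Set.Ioi (0:ℝ), w t * ∫⁻ σ in Set.Ioc a t, E σ ≤
      ∫⁻ σ in Set.Ioi a, E σ * ∫⁻ t in Set.Ici σ, w t := by
  have hS : MeasurableSet {q : ℝ × ℝ | a < q.2 ∧ q.2 ≤ q.1} :=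
    (measurableSet_lt measurable_const measurable_snd).inter
      (measurableSet_le measurable_snd measurable_fst)
  set G : ℝ × ℝ → ENNReal := {q : ℝ × ℝ | a < q.2 ∧ q.2 ≤ q.1}.indicator (fun q => w q.1 * E q.2) with hG
  have hGm : Measurable G := ((hw.comp measurable_fst).mul (hE.comp measurable_snd)).indicator hS
  calc _ ≤ ∫⁻ t, ∫⁻ σ, G (t, σ) := by
        refine (setLIntegral_le_lintegral _ _).trans (lintegral_mono fun t => ?_)
        beta_reduce
        rw [← lintegral_const_mul _ hE, ← lintegral_indicator measurableSet_Ioc]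
        refine lintegral_mono fun σ => ?_
        by_cases h : σ ∈ Set.Ioc a t
        · rw [Set.indicator_of_mem h, hG, Set.indicator_of_mem (show (t, σ) ∈ {q : ℝ × ℝ | a < q.2 ∧ q.2 ≤ q.1} from h)]
        · rw [Set.indicator_of_notMem h]; exact zero_le
    _ = ∫⁻ σ, ∫⁻ t, G (t, σ) := by
        rw [lintegral_lintegral_swap]; exact hGm.aemeasurable
    _ ≤ _ := by
        rw [← lintegral_indicator measurableSet_Ioi]
        refine lintegral_mono fun σ => ?_
        by_cases h : σ ∈ Set.Ioi a
        · rw [Set.indicator_of_mem h, ← lintegral_const_mul _ hw, ← lintegral_indicator measurableSet_Ici]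
          refine lintegral_mono fun t => ?_
          by_cases h2 : t ∈ Set.Ici σ
          · rw [Set.indicator_of_mem h2, hG]
            refine (Set.indicator_le_self' (fun _ _ => zero_le) _).trans (le_of_eq (mul_comm _ _))
          · rw [hG, Set.indicator_of_notMem]
            · exact zero_le
            · intro h3; exact h2 h3.2
        · rw [Set.indicator_of_notMem h]
          refine le_of_eq ?_
          rw [lintegral_eq_zero_iff (by fun_prop)]
          refine Filter.Eventually.of_forall fun t => ?_
          rw [hG]
          exact Set.indicator_of_notMem (fun h3 => h h3.1) _

lemma fub2 {w : ℝ → ENNReal} {E : ℝ → ℝ → ENNReal} (hw : Measurable w)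
    (hE : Measurable (fun q : ℝ × ℝ => E q.1 q.2)) :
    ∫⁻ t in Set.Ioi (0:ℝ), w t * ∫⁻ r in Set.Ioc (0:ℝ) (t / 2), ∫⁻ σ in Set.Ioc (1 / 10 * r) t, E r σ ≤
      ∫⁻ r in Set.Ioi (0:ℝ), ∫⁻ σ in Set.Ioi (1 / 10 * r), E r σ * ∫⁻ t in Set.Ici σ, w t := by
  have hS : MeasurableSet {q : (ℝ × ℝ) × ℝ | 1 / 10 * q.1.2 < q.2 ∧ q.2 ≤ q.1.1} := by
    have a1 : MeasurableSet {q : (ℝ × ℝ) × ℝ | 1 / 10 * q.1.2 < q.2} :=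
      measurableSet_lt (by fun_prop) (by fun_prop)
    have a2 : MeasurableSet {q : (ℝ × ℝ) × ℝ | q.2 ≤ q.1.1} :=
      measurableSet_le (by fun_prop) (by fun_prop)
    exact a1.inter a2
  have hm : Measurable (fun q : ℝ × ℝ => ∫⁻ σ in Set.Ioc (1 / 10 * q.2) q.1, E q.2 σ) := by
    have h1 : Measurable ({q : (ℝ × ℝ) × ℝ | 1 / 10 * q.1.2 < q.2 ∧ q.2 ≤ q.1.1}.indicator
        (fun q => E q.1.2 q.2)) :=
      (hE.comp (by fun_prop : Measurable (fun q : (ℝ × ℝ) × ℝ => (q.1.2, q.2)))).indicator hS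
    have h2 := Measurable.lintegral_prod_right' (ν := volume) h1
    have e : (fun q : ℝ × ℝ => ∫⁻ σ in Set.Ioc (1 / 10 * q.2) q.1, E q.2 σ) = fun q =>
        ∫⁻ σ, ({q : (ℝ × ℝ) × ℝ | 1 / 10 * q.1.2 < q.2 ∧ q.2 ≤ q.1.1}.indicator
        (fun q => E q.1.2 q.2)) (q, σ) := by
      ext q
      rw [← lintegral_indicator measurableSet_Ioc]
      rfl
    rw [e]
    exact h2
  calc _ ≤ ∫⁻ t in Set.Ioi (0:ℝ), ∫⁻ r in Set.Ioi (0:ℝ), w t * ∫⁻ σ in Set.Ioc (1 / 10 * r) t, E r σ := by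
        refine lintegral_mono fun t => ?_
        beta_reduce
        have h3 : Measurable (fun r : ℝ => ∫⁻ σ in Set.Ioc (1 / 10 * r) t, E r σ) := sl2 hm t
        rw [lintegral_const_mul _ h3]
        gcongr
        exact Set.Ioc_subset_Ioi_self
    _ = ∫⁻ r in Set.Ioi (0:ℝ), ∫⁻ t in Set.Ioi (0:ℝ), w t * ∫⁻ σ in Set.Ioc (1 / 10 * r) t, E r σ := by
        rw [lintegral_lintegral_swap]
        exact ((hw.comp measurable_fst).mul hm).aemeasurable
    _ ≤ _ := by
        refine setLIntegral_mono' measurableSet_Ioi fun r hr => ?_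
        exact fub hw (sl2 hE r)

lemma tail_w {s : ℝ} (hs : 0 < s) {σ : ℝ} (hσ : 0 < σ) :
    ∫⁻ t in Set.Ici σ, ENNReal.ofReal (t ^ (-1 - s / 2)) = ENNReal.ofReal (2 / s) * ENNReal.ofReal (σ ^ (-(s / 2))) := by
  rw [setLIntegral_congr Ioi_ae_eq_Ici.symm, ← ofReal_integral_eq_lintegral_ofReal
    (integrableOn_Ioi_rpow_of_lt (by linarith) hσ)
    ((ae_restrict_iff' measurableSet_Ioi).2 (Filter.Eventually.of_forall fun t ht =>
      Real.rpow_nonneg (hσ.le.trans (le_of_lt ht)) _)), integral_Ioi_rpow_of_lt (by linarith) hσ,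
    ← ENNReal.ofReal_mul (by positivity)]
  congr 1
  rw [show -1 - s / 2 + 1 = -(s / 2) by ring]
  field_simp

lemma dil {κ : Measure ℝ} [SFinite κ] {w U : ℝ → ENNReal} {d : ℝ → ℝ} (hw : Measurable w)
    (hU : Measurable U) (hd : Measurable d) (hd0 : ∀ᵐ ν ∂κ, 0 < d ν) :
    ∫⁻ r in Set.Ioi (0:ℝ), (∫⁻ ν, w ν * U (d ν * r) ∂κ) ^ (2:ℝ) ≤
      (∫⁻ ν, w ν * ENNReal.ofReal (d ν ^ (-(1 / 2) : ℝ)) ∂κ) ^ (2:ℝ) * ∫⁻ r in Set.Ioi (0:ℝ), U r ^ (2:ℝ) := by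
  set W := ∫⁻ ν, w ν * ENNReal.ofReal (d ν ^ (-(1 / 2) : ℝ)) ∂κ with hW
  have hdm : ∀ e : ℝ, Measurable (fun ν => ENNReal.ofReal (d ν ^ e)) := fun e =>
    (hd.pow_const e).ennreal_ofReal
  have hone : ∀ {y e e' : ℝ}, 0 < y → ENNReal.ofReal (y ^ e) * ENNReal.ofReal (y ^ e') = ENNReal.ofReal (y ^ (e + e')) := by
    intro y e e' hy
    rw [← ENNReal.ofReal_mul (by positivity), Real.rpow_add hy]
  have hUm : Measurable (fun q : ℝ × ℝ => U (d q.2 * q.1)) :=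
    hU.comp (by fun_prop : Measurable (fun q : ℝ × ℝ => d q.2 * q.1))
  calc _ ≤ ∫⁻ r in Set.Ioi (0:ℝ), W * ∫⁻ ν, w ν * ENNReal.ofReal (d ν ^ ((1 / 2) : ℝ)) * U (d ν * r) ^ (2:ℝ) ∂κ := by
        refine lintegral_mono fun r => ?_
        have h1 : ∫⁻ ν, w ν * U (d ν * r) ∂κ = ∫⁻ ν, (w ν * ENNReal.ofReal (d ν ^ (-(1 / 2) : ℝ))) *
            (ENNReal.ofReal (d ν ^ ((1 / 2) : ℝ)) * U (d ν * r)) ∂κ := by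
          refine lintegral_congr_ae ?_
          filter_upwards [hd0] with ν hν
          have := hone (e := -(1 / 2)) (e' := 1 / 2) hν
          rw [show (-(1 / 2) + 1 / 2 : ℝ) = 0 by ring, Real.rpow_zero, ENNReal.ofReal_one] at this
          calc _ = w ν * (ENNReal.ofReal (d ν ^ (-(1 / 2) : ℝ)) * ENNReal.ofReal (d ν ^ ((1 / 2) : ℝ))) * U (d ν * r) := by
                rw [this, mul_one]
            _ = _ := by ring
        beta_reduce
        rw [h1]
        refine (jensen (hw.mul (hdm _)) ((hdm _).mul (hU.comp (hd.mul_const r))) one_le_two).trans (le_of_eq ?_)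
        rw [show (2 - 1 : ℝ) = 1 by ring, ENNReal.rpow_one]
        congr 1
        refine lintegral_congr_ae ?_
        filter_upwards [hd0] with ν hν
        simp only [Pi.mul_apply, Function.comp_apply]
        rw [ENNReal.mul_rpow_of_nonneg _ _ zero_le_two, ENNReal.ofReal_rpow_of_pos (by positivity),
          ← Real.rpow_mul hν.le]
        have := hone (e := -(1 / 2)) (e' := 1 / 2 * 2) hν
        rw [show (-(1 / 2) + 1 / 2 * 2 : ℝ) = 1 / 2 by ring] at this
        rw [← this]; ring
    _ = W * ∫⁻ ν, (∫⁻ r in Set.Ioi (0:ℝ), w ν * ENNReal.ofReal (d ν ^ ((1 / 2) : ℝ)) * U (d ν * r) ^ (2:ℝ)) ∂κ := by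
        have hM : Measurable (fun q : ℝ × ℝ => w q.2 * ENNReal.ofReal (d q.2 ^ ((1 / 2) : ℝ)) * U (d q.2 * q.1) ^ (2:ℝ)) :=
          ((hw.comp measurable_snd).mul ((hdm _).comp measurable_snd)).mul (hUm.pow_const _)
        rw [lintegral_const_mul _ (Measurable.lintegral_prod_right' hM),
          lintegral_lintegral_swap hM.aemeasurable]
    _ = W * ∫⁻ ν, w ν * ENNReal.ofReal (d ν ^ (-(1 / 2) : ℝ)) * (∫⁻ r in Set.Ioi (0:ℝ), U r ^ (2:ℝ)) ∂κ := by
        congr 1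
        refine lintegral_congr_ae ?_
        filter_upwards [hd0] with ν hν
        have hm : Measurable (fun r => U (d ν * r) ^ (2:ℝ)) := (hU.comp (measurable_const_mul (d ν))).pow_const _
        rw [lintegral_const_mul _ hm,
          lint_scale (fun r => U r ^ (2:ℝ)) hν, ← mul_assoc, mul_assoc (w ν), ← Real.rpow_neg_one, hone hν]
        congr 4; norm_num
    _ = _ := by
        have hm : Measurable (fun ν => w ν * ENNReal.ofReal (d ν ^ (-(1 / 2) : ℝ))) := hw.mul (hdm _)
        rw [lintegral_mul_const _ hm, ← hW, ← mul_assoc, ENNReal.rpow_two, sq]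

lemma cs {A Y : ℝ → ENNReal} (hA : Measurable A) (hY : Measurable Y) :
    ∫⁻ r in Set.Ioi (0:ℝ), A r * Y r ≤
      (∫⁻ r in Set.Ioi (0:ℝ), A r ^ (2:ℝ)) ^ (1 / 2 : ℝ) * (∫⁻ r in Set.Ioi (0:ℝ), Y r ^ (2:ℝ)) ^ (1 / 2 : ℝ) :=
  ENNReal.lintegral_mul_le_Lp_mul_Lq _ (by rw [Real.holderConjugate_iff]; norm_num) hA.aemeasurable
    hY.aemeasurable

lemma w1_fin {s : ℝ} (hs : 0 < s) (hs1 : s < 1) :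
    ∫⁻ ν in Set.Ioi (0:ℝ), ENNReal.ofReal (ν ^ (s / 2 - 1)) * ENNReal.ofReal ((1 + ν) ^ (-(1 / 2) : ℝ)) ≠ ⊤ := by
  have h1 : IntegrableOn (fun ν : ℝ => ν ^ (s / 2 - 1)) (Set.Ioc 0 1) := by
    rw [← intervalIntegrable_iff_integrableOn_Ioc_of_le zero_le_one]
    exact intervalIntegral.intervalIntegrable_rpow' (by linarith)
  have h2 : IntegrableOn (fun ν : ℝ => ν ^ (s / 2 - 3 / 2)) (Set.Ioi 1) :=
    integrableOn_Ioi_rpow_of_lt (by linarith) one_pos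
  rw [← Set.Ioc_union_Ioi_eq_Ioi zero_le_one, lintegral_union measurableSet_Ioi
    (Set.Ioc_disjoint_Ioi le_rfl)]
  refine ENNReal.add_ne_top.2 ⟨?_, ?_⟩
  · refine ne_top_of_le_ne_top h1.lintegral_lt_top.ne (setLIntegral_mono' measurableSet_Ioc fun ν hν => ?_)
    rw [← ENNReal.ofReal_mul (Real.rpow_nonneg hν.1.le _)]
    apply ENNReal.ofReal_le_ofReal
    have : (1 + ν) ^ (-(1 / 2) : ℝ) ≤ 1 := Real.rpow_le_one_of_one_le_of_nonpos (by linarith [hν.1]) (by norm_num)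
    exact mul_le_of_le_one_right (Real.rpow_nonneg hν.1.le _) this
  · refine ne_top_of_le_ne_top h2.lintegral_lt_top.ne (setLIntegral_mono' measurableSet_Ioi fun ν hν => ?_)
    have hν : (1:ℝ) < ν := hν
    have hν0 : 0 < ν := by linarith
    rw [← ENNReal.ofReal_mul (by positivity)]
    apply ENNReal.ofReal_le_ofReal
    have : (1 + ν) ^ (-(1 / 2) : ℝ) ≤ ν ^ (-(1 / 2) : ℝ) :=
      Real.rpow_le_rpow_of_nonpos hν0 (by linarith) (by norm_num)
    calc _ ≤ ν ^ (s / 2 - 1) * ν ^ (-(1 / 2) : ℝ) := by gcongr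
      _ = _ := by rw [← Real.rpow_add hν0]; congr 1; ring

lemma w2_fin {s : ℝ} (hs : 0 < s) :
    ∫⁻ μ in Set.Ioi (1 / 10 : ℝ), ENNReal.ofReal (μ ^ (-(1 / 2) - s / 2)) * ENNReal.ofReal (μ ^ (-(1 / 2) : ℝ)) ≠ ⊤ := by
  have h2 : IntegrableOn (fun ν : ℝ => ν ^ (-1 - s / 2)) (Set.Ioi (1 / 10)) :=
    integrableOn_Ioi_rpow_of_lt (by linarith) (by norm_num)
  refine ne_top_of_le_ne_top h2.lintegral_lt_top.ne (setLIntegral_mono' measurableSet_Ioi fun ν hν => ?_)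
  have hν : (1 / 10:ℝ) < ν := hν
  have hν0 : 0 < ν := by linarith
  rw [← ENNReal.ofReal_mul (by positivity)]
  apply ENNReal.ofReal_le_ofReal
  rw [← Real.rpow_add hν0]
  apply le_of_eq; congr 1; ring

lemma scale_Ioi {F : ℝ → ENNReal} {r a : ℝ} (hr : 0 < r) (ha : 0 ≤ a) :
    ∫⁻ σ in Set.Ioi (a * r), F σ = ENNReal.ofReal r * ∫⁻ μ in Set.Ioi a, F (μ * r) := by
  have e1 : ∫⁻ σ in Set.Ioi (a * r), F σ = ∫⁻ σ in Set.Ioi (0:ℝ), (Set.Ioi (a * r)).indicator F σ := by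
    rw [setLIntegral_indicator measurableSet_Ioi, Set.inter_eq_self_of_subset_left]
    exact Set.Ioi_subset_Ioi (by positivity)
  have e2 : ∫⁻ μ in Set.Ioi a, F (μ * r) = ∫⁻ μ in Set.Ioi (0:ℝ), (Set.Ioi (a * r)).indicator F (r * μ) := by
    have : ∀ μ, (Set.Ioi (a * r)).indicator F (r * μ) = (Set.Ioi a).indicator (fun μ => F (μ * r)) μ := by
      intro μ
      by_cases h : μ ∈ Set.Ioi a
      · rw [Set.indicator_of_mem h, Set.indicator_of_mem, mul_comm]
        have : a < μ := h
        simp only [Set.mem_Ioi]; nlinarith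
      · rw [Set.indicator_of_notMem h, Set.indicator_of_notMem]
        have : μ ≤ a := not_lt.1 h
        simp only [Set.mem_Ioi, not_lt]; nlinarith
    simp_rw [this]
    rw [setLIntegral_indicator measurableSet_Ioi, Set.inter_eq_self_of_subset_left]
    exact Set.Ioi_subset_Ioi ha
  rw [e1, e2, lint_scale _ hr, ← mul_assoc, ← ENNReal.ofReal_mul hr.le, mul_inv_cancel₀ hr.ne']
  simp

end KPV

namespace KPV

def W1 (s : ℝ) : ENNReal :=
  ∫⁻ ν in Set.Ioi (0:ℝ), ENNReal.ofReal (ν ^ (s / 2 - 1)) * ENNReal.ofReal ((1 + ν) ^ (-(1 / 2) : ℝ))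

def W2 (s : ℝ) : ENNReal :=
  ∫⁻ μ in Set.Ioi (1 / 10 : ℝ), ENNReal.ofReal (μ ^ (-(1 / 2) - s / 2)) * ENNReal.ofReal (μ ^ (-(1 / 2) : ℝ))

/-- subordination hypothesis -/
def Sub (s c : ℝ) (f φ : ℝ → ℝ) : Prop := ∀ t > 0, ∀ x, ENNReal.ofReal |P 1 f t x| ≤
  ENNReal.ofReal c * ∫⁻ τ in Set.Ioi (0:ℝ), ENNReal.ofReal (τ ^ (s / 2 - 1)) * ENNReal.ofReal |P 1 φ (t + τ) x|

lemma aP_meas {h : ℝ → ℝ} (hh : Measurable h) (n : ℕ) :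
    Measurable (fun q : ℝ × ℝ => ENNReal.ofReal |P n h q.1 q.2|) := by
  have := P_meas hh n
  fun_prop

lemma sqrt_pull {a b c : ENNReal} (h : a ≤ b ^ (2:ℝ) * c) : a ^ (1 / 2 : ℝ) ≤ b * c ^ (1 / 2 : ℝ) := by
  calc a ^ (1 / 2 : ℝ) ≤ (b ^ (2:ℝ) * c) ^ (1 / 2 : ℝ) := by gcongr
    _ = _ := by
      rw [ENNReal.mul_rpow_of_nonneg _ _ (by norm_num), ← ENNReal.rpow_mul]; norm_num

lemma A_sq {s c : ℝ} {f φ : ℝ → ℝ} (hφ : Nice φ) (H : Sub s c f φ) (x : ℝ) :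
    (∫⁻ r in Set.Ioi (0:ℝ), (ENNReal.ofReal (r ^ (-(s / 2))) * ENNReal.ofReal |P 1 f r x|) ^ (2:ℝ)) ^ (1 / 2 : ℝ)
      ≤ ENNReal.ofReal c * W1 s * Sq 1 φ x ^ (1 / 2 : ℝ) := by
  have hU : Measurable (fun r => ENNReal.ofReal |P 1 φ r x|) := sl1 (aP_meas hφ.meas 1) x
  have hw : Measurable (fun ν : ℝ => ENNReal.ofReal (ν ^ (s / 2 - 1))) := by fun_prop
  have h1 : ∀ r > 0, ENNReal.ofReal (r ^ (-(s / 2))) * ENNReal.ofReal |P 1 f r x| ≤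
      ENNReal.ofReal c * ∫⁻ ν in Set.Ioi (0:ℝ), ENNReal.ofReal (ν ^ (s / 2 - 1)) * ENNReal.ofReal |P 1 φ ((1 + ν) * r) x| := by
    intro r hr
    have e := scale_Ioi (F := fun τ => ENNReal.ofReal (τ ^ (s / 2 - 1)) * ENNReal.ofReal |P 1 φ (r + τ) x|) hr le_rfl
    rw [zero_mul] at e
    have h2 := H r hr x
    rw [e] at h2
    have e2 : ∫⁻ μ in Set.Ioi (0:ℝ), ENNReal.ofReal ((μ * r) ^ (s / 2 - 1)) * ENNReal.ofReal |P 1 φ (r + μ * r) x| =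
        ENNReal.ofReal (r ^ (s / 2 - 1)) * ∫⁻ ν in Set.Ioi (0:ℝ), ENNReal.ofReal (ν ^ (s / 2 - 1)) * ENNReal.ofReal |P 1 φ ((1 + ν) * r) x| := by
      have hm : Measurable (fun ν : ℝ => ENNReal.ofReal (ν ^ (s / 2 - 1)) * ENNReal.ofReal |P 1 φ ((1 + ν) * r) x|) :=
        hw.mul (hU.comp (by fun_prop : Measurable (fun ν : ℝ => (1 + ν) * r)))
      rw [← lintegral_const_mul _ hm]
      refine setLIntegral_congr_fun measurableSet_Ioi fun μ hμ => ?_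
      have hμ : 0 < μ := hμ
      beta_reduce
      rw [Real.mul_rpow hμ.le hr.le, ENNReal.ofReal_mul (by positivity), show r + μ * r = (1 + μ) * r by ring]
      ring
    rw [e2] at h2
    refine (mul_le_mul' le_rfl h2).trans (le_of_eq ?_)
    calc _ = ENNReal.ofReal c * (ENNReal.ofReal (r ^ (-(s / 2))) * (ENNReal.ofReal r * ENNReal.ofReal (r ^ (s / 2 - 1)))) * ∫⁻ ν in Set.Ioi (0:ℝ), ENNReal.ofReal (ν ^ (s / 2 - 1)) * ENNReal.ofReal |P 1 φ ((1 + ν) * r) x| := by ring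
      _ = _ := by
        have : ENNReal.ofReal (r ^ (-(s / 2))) * (ENNReal.ofReal r * ENNReal.ofReal (r ^ (s / 2 - 1))) = 1 := by
          rw [← ENNReal.ofReal_mul (by positivity), ← ENNReal.ofReal_mul (by positivity)]
          nth_rewrite 2 [← Real.rpow_one r]
          rw [← Real.rpow_add hr, ← Real.rpow_add hr]
          ring_nf
          simp
        rw [this, mul_one]
  have h2 : ∫⁻ r in Set.Ioi (0:ℝ), (ENNReal.ofReal (r ^ (-(s / 2))) * ENNReal.ofReal |P 1 f r x|) ^ (2:ℝ) ≤
      (ENNReal.ofReal c * W1 s) ^ (2:ℝ) * Sq 1 φ x := by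
    have hd := dil (κ := volume.restrict (Set.Ioi (0:ℝ))) hw hU (d := fun ν => 1 + ν) (by fun_prop)
      ((ae_restrict_iff' measurableSet_Ioi).2 (Filter.Eventually.of_forall fun ν hν => by
        have : (0:ℝ) < ν := hν
        positivity))
    calc _ ≤ ∫⁻ r in Set.Ioi (0:ℝ), ENNReal.ofReal c ^ (2:ℝ) * (∫⁻ ν in Set.Ioi (0:ℝ), ENNReal.ofReal (ν ^ (s / 2 - 1)) * ENNReal.ofReal |P 1 φ ((1 + ν) * r) x|) ^ (2:ℝ) := by
          refine setLIntegral_mono' measurableSet_Ioi fun r hr => ?_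
          rw [← ENNReal.mul_rpow_of_nonneg _ _ zero_le_two]
          exact ENNReal.rpow_le_rpow (h1 r hr) zero_le_two
      _ = ENNReal.ofReal c ^ (2:ℝ) * ∫⁻ r in Set.Ioi (0:ℝ), (∫⁻ ν in Set.Ioi (0:ℝ), ENNReal.ofReal (ν ^ (s / 2 - 1)) * ENNReal.ofReal |P 1 φ ((1 + ν) * r) x|) ^ (2:ℝ) := by
          rw [lintegral_const_mul' _ _ (ENNReal.rpow_ne_top_of_nonneg zero_le_two ENNReal.ofReal_ne_top)]
      _ ≤ ENNReal.ofReal c ^ (2:ℝ) * (W1 s ^ (2:ℝ) * ∫⁻ r in Set.Ioi (0:ℝ), ENNReal.ofReal |P 1 φ r x| ^ (2:ℝ)) := by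
          gcongr
          exact hd
      _ = _ := by
          rw [ENNReal.mul_rpow_of_nonneg _ _ zero_le_two, ← mul_assoc]
          congr 1
          unfold Sq
          congr 1; ext r
          rw [ENNReal.ofReal_rpow_of_nonneg (abs_nonneg _) zero_le_two]
          congr 1
          simp
  exact sqrt_pull h2

lemma Y_sq {s : ℝ} {h : ℝ → ℝ} (hh : Nice h) (x : ℝ) :
    (∫⁻ r in Set.Ioi (0:ℝ), (∫⁻ μ in Set.Ioi (1 / 10 : ℝ), ENNReal.ofReal (μ ^ (-(1 / 2) - s / 2)) *
      (ENNReal.ofReal ((μ * r) ^ (1 / 2 : ℝ)) * ENNReal.ofReal |P 2 h (μ * r) x|)) ^ (2:ℝ)) ^ (1 / 2 : ℝ)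
      ≤ W2 s * Sq 2 h x ^ (1 / 2 : ℝ) := by
  have hU0 : Measurable (fun r => ENNReal.ofReal |P 2 h r x|) := sl1 (aP_meas hh.meas 2) x
  have hU : Measurable (fun r : ℝ => ENNReal.ofReal (r ^ (1 / 2 : ℝ)) * ENNReal.ofReal |P 2 h r x|) :=
    (by fun_prop : Measurable (fun r : ℝ => ENNReal.ofReal (r ^ (1 / 2 : ℝ)))).mul hU0
  have hd := dil (κ := volume.restrict (Set.Ioi (1 / 10:ℝ))) (w := fun μ => ENNReal.ofReal (μ ^ (-(1 / 2) - s / 2))) (by fun_prop) hU (d := fun ν => ν) (by fun_prop)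
      ((ae_restrict_iff' measurableSet_Ioi).2 (Filter.Eventually.of_forall fun ν hν => by
        have : (1 / 10:ℝ) < ν := hν
        linarith))
  refine sqrt_pull (hd.trans (le_of_eq ?_))
  congr 1
  unfold Sq
  refine setLIntegral_congr_fun measurableSet_Ioi fun r hr => ?_
  have hr : 0 < r := hr
  rw [ENNReal.mul_rpow_of_nonneg _ _ zero_le_two, ENNReal.ofReal_rpow_of_nonneg (abs_nonneg _) zero_le_two,
    ENNReal.ofReal_rpow_of_nonneg (by positivity) zero_le_two, ← ENNReal.ofReal_mul (by positivity),
    ← Real.rpow_mul hr.le]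
  congr 1
  simp

lemma fin_cs {s c : ℝ} {f φ : ℝ → ℝ} (hf : Nice f) (hφ : Nice φ) (H : Sub s c f φ) {Z : ℝ → ℝ → ENNReal}
    (hZ : Measurable (fun q : ℝ × ℝ => Z q.1 q.2)) :
    ∫⁻ r in Set.Ioi (0:ℝ), ∫⁻ x, (ENNReal.ofReal (r ^ (-(s / 2))) * ENNReal.ofReal |P 1 f r x|) * Z r x ≤
      ENNReal.ofReal c * W1 s * ∫⁻ x, Sq 1 φ x ^ (1 / 2 : ℝ) * (∫⁻ r in Set.Ioi (0:ℝ), Z r x ^ (2:ℝ)) ^ (1 / 2 : ℝ) := by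
  have hA : Measurable (fun q : ℝ × ℝ => ENNReal.ofReal (q.1 ^ (-(s / 2))) * ENNReal.ofReal |P 1 f q.1 q.2|) :=
    (by fun_prop : Measurable (fun q : ℝ × ℝ => ENNReal.ofReal (q.1 ^ (-(s / 2))))).mul (aP_meas hf.meas 1)
  have hI : Measurable (fun x => ∫⁻ r in Set.Ioi (0:ℝ), Z r x ^ (2:ℝ)) :=
    Measurable.lintegral_prod_left' (f := fun q : ℝ × ℝ => Z q.1 q.2 ^ (2:ℝ)) (hZ.pow_const _)
  have hm : Measurable (fun x => Sq 1 φ x ^ (1 / 2 : ℝ) * (∫⁻ r in Set.Ioi (0:ℝ), Z r x ^ (2:ℝ)) ^ (1 / 2 : ℝ)) :=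
    ((Sq_meas hφ.meas 1).pow_const _).mul (hI.pow_const _)
  have hAZ : Measurable (fun q : ℝ × ℝ => ENNReal.ofReal (q.1 ^ (-(s / 2))) * ENNReal.ofReal |P 1 f q.1 q.2| * Z q.1 q.2) := hA.mul hZ
  rw [lintegral_lintegral_swap hAZ.aemeasurable, ← lintegral_const_mul _ hm]
  refine lintegral_mono fun x => ?_
  beta_reduce
  refine (cs (sl1 hA x) (sl1 hZ x)).trans ?_
  rw [← mul_assoc]
  gcongr
  exact A_sq hφ H x

end KPV

namespace KPV

lemma P0_late {h : ℝ → ℝ} (hh : Nice h) {a b t : ℝ} (ha : 0 < a) (hab : a ≤ b) (hbt : b ≤ t) (x : ℝ) :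
    ENNReal.ofReal |P 0 h b x| ≤ ENNReal.ofReal (P 0 (fun y => |h y|) a x) +
      ∫⁻ σ in Set.Ioc a t, ENNReal.ofReal |P 2 h σ x| := by
  have hc : ContinuousOn (fun σ => P 2 h σ x) (Set.uIcc a b) := by
    intro σ hσ
    rw [Set.uIcc_of_le hab] at hσ
    exact (ContinuousAt.comp (f := fun σ : ℝ => (σ, x)) (g := fun q : ℝ × ℝ => P 2 h q.1 q.2)
      (P_contAt hh.int le_rfl (ha.trans_le hσ.1) x) (by fun_prop)).continuousWithinAt
  have e : ∫ σ in a..b, P 2 h σ x = P 0 h b x - P 0 h a x := by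
    refine intervalIntegral.integral_eq_sub_of_hasDerivAt (f := fun σ => P 0 h σ x) (fun σ hσ => ?_) hc.intervalIntegrable
    rw [Set.uIcc_of_le hab] at hσ
    exact P_dt hh.int (ha.trans_le hσ.1) x
  have h1 : |P 0 h a x| ≤ P 0 (fun y => |h y|) a x := by
    unfold P
    rw [← norm_eq_abs]
    refine norm_integral_le_of_norm_le (P_ig hh.int.abs (by omega) ha x) (Filter.Eventually.of_forall fun y => ?_)
    rw [norm_mul, norm_eq_abs, norm_eq_abs, abs_of_nonneg (show 0 ≤ K 0 a (x - y) from hk_nonneg _ _)]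
  have e2 : P 0 h b x = P 0 h a x + ∫ σ in a..b, P 2 h σ x := by rw [e]; ring
  rw [e2]
  refine (ENNReal.ofReal_le_ofReal (abs_add_le _ _)).trans ?_
  rw [ENNReal.ofReal_add (abs_nonneg _) (abs_nonneg _)]
  gcongr
  rw [intervalIntegral.integral_of_le hab, ← Real.enorm_eq_ofReal_abs]
  refine (enorm_integral_le_lintegral_enorm _).trans ?_
  simp_rw [Real.enorm_eq_ofReal_abs]
  exact lintegral_mono_set (Set.Ioc_subset_Ioc_right hbt)

lemma aP_comp {α : Type*} [MeasurableSpace α] {h : ℝ → ℝ} (hh : Measurable h) (n : ℕ) (a b : α → ℝ)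
    (ha : Measurable a) (hb : Measurable b) : Measurable (fun z => ENNReal.ofReal |P n h (a z) (b z)|) :=
  (aP_meas hh n).comp (ha.prodMk hb)

/-- weighted version used for single-time terms -/
lemma one_time {s c : ℝ} (hs : 0 < s) {f φ : ℝ → ℝ} (hf : Nice f) (hφ : Nice φ) (H : Sub s c f φ) {Z : ℝ → ℝ → ENNReal}
    (hZ : Measurable (fun q : ℝ × ℝ => Z q.1 q.2)) :
    ∫⁻ t in Set.Ioi (0:ℝ), ENNReal.ofReal (t ^ (-1 - s / 2)) * ∫⁻ r in Set.Ioc 0 (t / 2),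
      ∫⁻ x, ENNReal.ofReal |P 1 f r x| * Z r x ≤
      ENNReal.ofReal (2 / s) * (ENNReal.ofReal c * W1 s) * ∫⁻ x, Sq 1 φ x ^ (1 / 2 : ℝ) * (∫⁻ r in Set.Ioi (0:ℝ), Z r x ^ (2:ℝ)) ^ (1 / 2 : ℝ) := by
  have hm : Measurable (fun q : ℝ × ℝ => ENNReal.ofReal |P 1 f q.1 q.2| * Z q.1 q.2) := (aP_meas hf.meas 1).mul hZ
  have hE : Measurable (fun r => ∫⁻ x, ENNReal.ofReal |P 1 f r x| * Z r x) :=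
    Measurable.lintegral_prod_right' hm
  have hw : Measurable (fun t : ℝ => ENNReal.ofReal (t ^ (-1 - s / 2))) := by fun_prop
  calc _ ≤ ∫⁻ t in Set.Ioi (0:ℝ), ENNReal.ofReal (t ^ (-1 - s / 2)) * ∫⁻ r in Set.Ioc 0 t,
          ∫⁻ x, ENNReal.ofReal |P 1 f r x| * Z r x := by
        refine setLIntegral_mono' measurableSet_Ioi fun t ht => ?_
        have ht : 0 < t := ht
        refine mul_le_mul' le_rfl (lintegral_mono_set (Set.Ioc_subset_Ioc_right (by linarith)))
    _ ≤ ∫⁻ r in Set.Ioi (0:ℝ), (∫⁻ x, ENNReal.ofReal |P 1 f r x| * Z r x) * ∫⁻ t in Set.Ici r, ENNReal.ofReal (t ^ (-1 - s / 2)) :=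
        fub hw hE
    _ = ∫⁻ r in Set.Ioi (0:ℝ), ENNReal.ofReal (2 / s) * ∫⁻ x, (ENNReal.ofReal (r ^ (-(s / 2))) * ENNReal.ofReal |P 1 f r x|) * Z r x := by
        refine setLIntegral_congr_fun measurableSet_Ioi fun r hr => ?_
        beta_reduce
        rw [tail_w hs hr]
        simp_rw [mul_assoc (ENNReal.ofReal (r ^ (-(s / 2))))]
        rw [lintegral_const_mul' _ _ ENNReal.ofReal_ne_top, mul_comm, mul_assoc]
    _ ≤ _ := by
        rw [lintegral_const_mul' _ _ ENNReal.ofReal_ne_top, mul_assoc]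
        exact mul_le_mul' le_rfl (fin_cs hf hφ H hZ)

lemma two_time {s c : ℝ} (hs : 0 < s) {f φ g h : ℝ → ℝ} (hf : Nice f) (hφ : Nice φ) (H : Sub s c f φ)
    (hg : Nice g) (hg1 : ∀ x, |g x| ≤ 1) (hh : Nice h) :
    ∫⁻ t in Set.Ioi (0:ℝ), ENNReal.ofReal (t ^ (-1 - s / 2)) * ∫⁻ r in Set.Ioc 0 (t / 2),
      ∫⁻ σ in Set.Ioc (1 / 10 * r) t,
      ∫⁻ x, ENNReal.ofReal |P 1 f r x| * ENNReal.ofReal |P 1 g r x| * ENNReal.ofReal |P 2 h σ x| ≤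
      2 * ENNReal.ofReal (2 / s) * (ENNReal.ofReal c * W1 s) * W2 s * ∫⁻ x, Sq 1 φ x ^ (1 / 2 : ℝ) * Sq 2 h x ^ (1 / 2 : ℝ) := by
  have hw : Measurable (fun t : ℝ => ENNReal.ofReal (t ^ (-1 - s / 2))) := by fun_prop
  have hE : Measurable (fun q : ℝ × ℝ => ∫⁻ x, ENNReal.ofReal |P 1 f q.1 x| * ENNReal.ofReal |P 1 g q.1 x| * ENNReal.ofReal |P 2 h q.2 x|) := by
    have hm : Measurable (fun z : (ℝ × ℝ) × ℝ => ENNReal.ofReal |P 1 f z.1.1 z.2| * ENNReal.ofReal |P 1 g z.1.1 z.2| * ENNReal.ofReal |P 2 h z.1.2 z.2|) :=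
      ((aP_comp hf.meas 1 (fun z : (ℝ × ℝ) × ℝ => z.1.1) (fun z => z.2) (by fun_prop) (by fun_prop)).mul
      (aP_comp hg.meas 1 (fun z : (ℝ × ℝ) × ℝ => z.1.1) (fun z => z.2) (by fun_prop) (by fun_prop))).mul
      (aP_comp hh.meas 2 (fun z : (ℝ × ℝ) × ℝ => z.1.2) (fun z => z.2) (by fun_prop) (by fun_prop))
    exact Measurable.lintegral_prod_right' hm
  set Yt : ℝ → ℝ → ENNReal := fun r x => ∫⁻ μ in Set.Ioi (1 / 10 : ℝ), ENNReal.ofReal (μ ^ (-(1 / 2) - s / 2)) *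
      (ENNReal.ofReal ((μ * r) ^ (1 / 2 : ℝ)) * ENNReal.ofReal |P 2 h (μ * r) x|) with hYt
  have hYm : Measurable (fun q : ℝ × ℝ => Yt q.1 q.2) := by
    have hm : Measurable (fun z : (ℝ × ℝ) × ℝ => ENNReal.ofReal (z.2 ^ (-(1 / 2) - s / 2)) *
      (ENNReal.ofReal ((z.2 * z.1.1) ^ (1 / 2 : ℝ)) * ENNReal.ofReal |P 2 h (z.2 * z.1.1) z.1.2|)) :=
      (by fun_prop : Measurable (fun z : (ℝ × ℝ) × ℝ => ENNReal.ofReal (z.2 ^ (-(1 / 2) - s / 2)))).mul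
      ((by fun_prop : Measurable (fun z : (ℝ × ℝ) × ℝ => ENNReal.ofReal ((z.2 * z.1.1) ^ (1 / 2 : ℝ)))).mul
      (aP_comp hh.meas 2 (fun z : (ℝ × ℝ) × ℝ => z.2 * z.1.1) (fun z => z.1.2) (by fun_prop) (by fun_prop)))
    exact Measurable.lintegral_prod_right' (ν := volume.restrict (Set.Ioi (1 / 10 : ℝ))) hm
  have key : ∀ r > 0, ∀ x, ENNReal.ofReal |P 1 g r x| * ∫⁻ σ in Set.Ioi (1 / 10 * r), ENNReal.ofReal (σ ^ (-(s / 2))) * ENNReal.ofReal |P 2 h σ x|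
      ≤ 2 * (ENNReal.ofReal (r ^ (-(s / 2))) * Yt r x) := by
    intro r hr x
    rw [scale_Ioi hr (by norm_num)]
    have e : ∫⁻ μ in Set.Ioi (1 / 10 : ℝ), ENNReal.ofReal ((μ * r) ^ (-(s / 2))) * ENNReal.ofReal |P 2 h (μ * r) x| =
        ENNReal.ofReal (r ^ (-(1 / 2) - s / 2)) * Yt r x := by
      rw [hYt]
      beta_reduce
      rw [← lintegral_const_mul' _ _ ENNReal.ofReal_ne_top]
      refine setLIntegral_congr_fun measurableSet_Ioi fun μ hμ => ?_
      have hμ : 0 < μ := lt_trans (by norm_num) (show 1 / 10 < μ from hμ)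
      beta_reduce
      rw [← mul_assoc, ← mul_assoc]
      congr 1
      rw [← ENNReal.ofReal_mul (by positivity), ← ENNReal.ofReal_mul (by positivity)]
      congr 1
      rw [mul_comm (r ^ _), ← Real.mul_rpow hμ.le hr.le, ← Real.rpow_add (by positivity)]
      congr 1; ring
    rw [e]
    have h2 : ENNReal.ofReal |P 1 g r x| ≤ ENNReal.ofReal (2 * r ^ (-(1 / 2) : ℝ)) := by
      apply ENNReal.ofReal_le_ofReal
      refine (Pn_abs_le hg.int hg1 (by omega) hr x).trans (le_of_eq ?_)
      rw [Real.sqrt_eq_rpow, ← Real.rpow_neg hr.le]; simp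
    refine (mul_le_mul' h2 le_rfl).trans (le_of_eq ?_)
    rw [ENNReal.ofReal_mul zero_le_two, ENNReal.ofReal_ofNat]
    have : ENNReal.ofReal (r ^ (-(1 / 2) : ℝ)) * (ENNReal.ofReal r * ENNReal.ofReal (r ^ (-(1 / 2) - s / 2))) = ENNReal.ofReal (r ^ (-(s / 2))) := by
      rw [← ENNReal.ofReal_mul (by positivity), ← ENNReal.ofReal_mul (by positivity)]
      nth_rewrite 2 [← Real.rpow_one r]
      rw [← Real.rpow_add hr, ← Real.rpow_add hr]
      congr 2; ring
    rw [← this]; ring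
  calc _ ≤ ∫⁻ r in Set.Ioi (0:ℝ), ∫⁻ σ in Set.Ioi (1 / 10 * r), (∫⁻ x, ENNReal.ofReal |P 1 f r x| * ENNReal.ofReal |P 1 g r x| * ENNReal.ofReal |P 2 h σ x|) * ∫⁻ t in Set.Ici σ, ENNReal.ofReal (t ^ (-1 - s / 2)) :=
        fub2 hw hE
    _ = ∫⁻ r in Set.Ioi (0:ℝ), ENNReal.ofReal (2 / s) * ∫⁻ x, ENNReal.ofReal |P 1 f r x| * (ENNReal.ofReal |P 1 g r x| * ∫⁻ σ in Set.Ioi (1 / 10 * r), ENNReal.ofReal (σ ^ (-(s / 2))) * ENNReal.ofReal |P 2 h σ x|) := by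
        refine setLIntegral_congr_fun measurableSet_Ioi fun r hr => ?_
        have hr : 0 < r := hr
        beta_reduce
        have e1 : ∀ x, ENNReal.ofReal |P 1 f r x| * (ENNReal.ofReal |P 1 g r x| * ∫⁻ σ in Set.Ioi (1 / 10 * r), ENNReal.ofReal (σ ^ (-(s / 2))) * ENNReal.ofReal |P 2 h σ x|) =
            ∫⁻ σ in Set.Ioi (1 / 10 * r), ENNReal.ofReal (σ ^ (-(s / 2))) * (ENNReal.ofReal |P 1 f r x| * ENNReal.ofReal |P 1 g r x| * ENNReal.ofReal |P 2 h σ x|) := by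
          intro x
          rw [← mul_assoc, ← lintegral_const_mul' _ _ (ENNReal.mul_ne_top ENNReal.ofReal_ne_top ENNReal.ofReal_ne_top)]
          congr 1; ext σ; ring
        simp_rw [e1]
        have hm : Measurable (fun q : ℝ × ℝ => ENNReal.ofReal (q.2 ^ (-(s / 2))) * (ENNReal.ofReal |P 1 f r q.1| * ENNReal.ofReal |P 1 g r q.1| * ENNReal.ofReal |P 2 h q.2 q.1|)) :=
          (by fun_prop : Measurable (fun q : ℝ × ℝ => ENNReal.ofReal (q.2 ^ (-(s / 2))))).mul
          (((aP_comp hf.meas 1 (fun _ : ℝ × ℝ => r) (fun z => z.1) (by fun_prop) (by fun_prop)).mul (aP_comp hg.meas 1 (fun _ : ℝ × ℝ => r) (fun z => z.1) (by fun_prop) (by fun_prop))).mul (aP_comp hh.meas 2 (fun z : ℝ × ℝ => z.2) (fun z => z.1) (by fun_prop) (by fun_prop)))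
        rw [lintegral_lintegral_swap hm.aemeasurable, ← lintegral_const_mul' _ _ ENNReal.ofReal_ne_top]
        refine setLIntegral_congr_fun measurableSet_Ioi fun σ hσ => ?_
        have hσ : 0 < σ := lt_trans (by positivity) (show 1 / 10 * r < σ from hσ)
        beta_reduce
        rw [tail_w hs hσ, lintegral_const_mul' _ _ ENNReal.ofReal_ne_top]
        ring
    _ ≤ ∫⁻ r in Set.Ioi (0:ℝ), ENNReal.ofReal (2 / s) * (2 * ∫⁻ x, (ENNReal.ofReal (r ^ (-(s / 2))) * ENNReal.ofReal |P 1 f r x|) * Yt r x) := by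
        refine setLIntegral_mono' measurableSet_Ioi fun r hr => ?_
        refine mul_le_mul' le_rfl ?_
        rw [← lintegral_const_mul' _ _ (by simp)]
        refine lintegral_mono fun x => ?_
        beta_reduce
        refine (mul_le_mul' le_rfl (key r hr x)).trans (le_of_eq ?_)
        ring
    _ ≤ ENNReal.ofReal (2 / s) * (2 * (ENNReal.ofReal c * W1 s * ∫⁻ x, Sq 1 φ x ^ (1 / 2 : ℝ) * (∫⁻ r in Set.Ioi (0:ℝ), Yt r x ^ (2:ℝ)) ^ (1 / 2 : ℝ))) := by
        rw [lintegral_const_mul' _ _ ENNReal.ofReal_ne_top, lintegral_const_mul' _ _ (by simp)]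
        exact mul_le_mul' le_rfl (mul_le_mul' le_rfl (fin_cs hf hφ H hYm))
    _ ≤ ENNReal.ofReal (2 / s) * (2 * (ENNReal.ofReal c * W1 s * (W2 s * ∫⁻ x, Sq 1 φ x ^ (1 / 2 : ℝ) * Sq 2 h x ^ (1 / 2 : ℝ)))) := by
        refine mul_le_mul' le_rfl (mul_le_mul' le_rfl (mul_le_mul' le_rfl ?_))
        have hm : Measurable (fun x => Sq 1 φ x ^ (1 / 2 : ℝ) * Sq 2 h x ^ (1 / 2 : ℝ)) :=
          ((Sq_meas hφ.meas 1).pow_const _).mul ((Sq_meas hh.meas 2).pow_const _)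
        rw [← lintegral_const_mul _ hm]
        refine lintegral_mono fun x => ?_
        beta_reduce
        refine (mul_le_mul' le_rfl (Y_sq hh x)).trans (le_of_eq ?_)
        ring
    _ = _ := by ring

end KPV

namespace KPV

lemma hol2 {p q : ℝ} (hpq : p.HolderConjugate q) {F G : ℝ → ENNReal} (hF : Measurable F) (hG : Measurable G) :
    ∫⁻ x, F x ^ (1 / 2 : ℝ) * G x ^ (1 / 2 : ℝ) ≤ (∫⁻ x, F x ^ (p / 2)) ^ (1 / p) * (∫⁻ x, G x ^ (q / 2)) ^ (1 / q) := by
  refine (ENNReal.lintegral_mul_le_Lp_mul_Lq _ hpq (hF.pow_const _).aemeasurable (hG.pow_const _).aemeasurable).trans (le_of_eq ?_)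
  simp_rw [← ENNReal.rpow_mul]
  congr 4 <;> (ext x; congr 1; ring)

lemma Sm_abs_nice {h : ℝ → ℝ} (hh : Nice h) : Nice (fun x => |h x|) := by
  obtain ⟨B, hB⟩ := hh.bdd
  exact ⟨measurable_norm.comp hh.meas, hh.int.abs, B, fun x => by simpa using hB x⟩

lemma D_split {s c : ℝ} (hs : 0 < s) {f g h φ : ℝ → ℝ} (hf : Sm f) (hg : Sm g) (hg1 : ∀ x, |g x| ≤ 1)
    (hh : Sm h) (hφ : Nice φ) (H : Sub s c f φ) :
    ∫⁻ t in Set.Ioi (0:ℝ), ENNReal.ofReal (t ^ (-1 - s / 2)) *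
      ENNReal.ofReal |(∫ x, f x * h x * P 0 g t x) - ∫ x, f x * g x * P 0 h t x| ≤
    2 * (ENNReal.ofReal (2 / s) * (ENNReal.ofReal c * W1 s) * ∫⁻ x, Sq 1 φ x ^ (1 / 2 : ℝ) * Sq 1 h x ^ (1 / 2 : ℝ)) +
    2 * (ENNReal.ofReal (2 / s) * (ENNReal.ofReal c * W1 s) * ∫⁻ x, Sq 1 φ x ^ (1 / 2 : ℝ) * Cq g (fun x => |h x|) x ^ (1 / 2 : ℝ)) +
    2 * (2 * ENNReal.ofReal (2 / s) * (ENNReal.ofReal c * W1 s) * W2 s * ∫⁻ x, Sq 1 φ x ^ (1 / 2 : ℝ) * Sq 2 h x ^ (1 / 2 : ℝ)) := by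
  have hmf := aP_meas hf.nice.meas 1
  have ha := Sm_abs_nice hh.nice
  have hw : Measurable (fun t : ℝ => ENNReal.ofReal (t ^ (-1 - s / 2))) := by fun_prop
  set Z1 : ℝ → ℝ → ENNReal := fun r x => ENNReal.ofReal |P 1 h r x| with hZ1
  set Z2 : ℝ → ℝ → ENNReal := fun r x => ENNReal.ofReal |P 1 g r x| * ENNReal.ofReal |P 0 (fun x => |h x|) (1 / 10 * r) x| with hZ2
  have m1 : Measurable (fun q : ℝ × ℝ => Z1 q.1 q.2) := aP_meas hh.nice.meas 1
  have m2 : Measurable (fun q : ℝ × ℝ => Z2 q.1 q.2) := (aP_meas hg.nice.meas 1).mul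
    (aP_comp ha.meas 0 (fun q : ℝ × ℝ => 1 / 10 * q.1) (fun q => q.2) (by fun_prop) (by fun_prop))
  have o1 := one_time hs hf.nice hφ H m1
  have o2 := one_time hs hf.nice hφ H m2
  have o3 := two_time hs hf.nice hφ H hg.nice hg1 hh.nice
  have e1 : ∀ x, ∫⁻ r in Set.Ioi (0:ℝ), Z1 r x ^ (2:ℝ) = Sq 1 h x := by
    intro x
    unfold Sq
    congr 1; ext r
    rw [hZ1, ENNReal.ofReal_rpow_of_nonneg (abs_nonneg _) zero_le_two]
    congr 1
    simp
  have e2 : ∀ x, ∫⁻ r in Set.Ioi (0:ℝ), Z2 r x ^ (2:ℝ) = Cq g (fun x => |h x|) x := by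
    intro x
    unfold Cq
    congr 1; ext r
    rw [hZ2]
    beta_reduce
    rw [← ENNReal.ofReal_mul (abs_nonneg _), ENNReal.ofReal_rpow_of_nonneg (by positivity) zero_le_two]
    congr 1
    rw [← abs_mul, Real.rpow_two, sq_abs, mul_pow]
  simp_rw [e1] at o1
  simp_rw [e2] at o2
  refine le_trans ?_ (add_le_add (add_le_add (mul_le_mul' le_rfl o1) (mul_le_mul' le_rfl o2)) (mul_le_mul' le_rfl o3))
  have hEZ : ∀ Z : ℝ → ℝ → ENNReal, Measurable (fun q : ℝ × ℝ => Z q.1 q.2) →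
      Measurable (fun r => ∫⁻ x, ENNReal.ofReal |P 1 f r x| * Z r x) := fun Z hZ =>
    Measurable.lintegral_prod_right' (f := fun q : ℝ × ℝ => ENNReal.ofReal |P 1 f q.1 q.2| * Z q.1 q.2) (hmf.mul hZ)
  have hIm : ∀ E : ℝ → ENNReal, Measurable E → Measurable (fun t : ℝ => ENNReal.ofReal (t ^ (-1 - s / 2)) * ∫⁻ r in Set.Ioc 0 (t / 2), E r) := by
    intro E hE
    refine hw.mul ?_
    have hS : MeasurableSet {q : ℝ × ℝ | 0 < q.2 ∧ q.2 ≤ q.1 / 2} := by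
      have a1 : MeasurableSet {q : ℝ × ℝ | 0 < q.2} := measurableSet_lt (by fun_prop) (by fun_prop)
      have a2 : MeasurableSet {q : ℝ × ℝ | q.2 ≤ q.1 / 2} := measurableSet_le (by fun_prop) (by fun_prop)
      exact a1.inter a2
    have h1 : Measurable ({q : ℝ × ℝ | 0 < q.2 ∧ q.2 ≤ q.1 / 2}.indicator (fun q => E q.2)) :=
      (hE.comp measurable_snd).indicator hS
    have h2 := Measurable.lintegral_prod_right' (ν := volume) h1
    have e : (fun t : ℝ => ∫⁻ r in Set.Ioc 0 (t / 2), E r) = fun t =>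
        ∫⁻ r, ({q : ℝ × ℝ | 0 < q.2 ∧ q.2 ≤ q.1 / 2}.indicator (fun q => E q.2)) (t, r) := by
      ext t
      rw [← lintegral_indicator measurableSet_Ioc]
      rfl
    rw [e]; exact h2
  have m12 : Measurable (fun a : ℝ => 2 * (ENNReal.ofReal (a ^ (-1 - s / 2)) * ∫⁻ r in Set.Ioc 0 (a / 2), ∫⁻ x, ENNReal.ofReal |P 1 f r x| * Z1 r x) +
      2 * (ENNReal.ofReal (a ^ (-1 - s / 2)) * ∫⁻ r in Set.Ioc 0 (a / 2), ∫⁻ x, ENNReal.ofReal |P 1 f r x| * Z2 r x)) :=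
    ((hIm _ (hEZ _ m1)).const_mul 2).add ((hIm _ (hEZ _ m2)).const_mul 2)
  rw [← lintegral_const_mul' _ _ (by simp), ← lintegral_const_mul' _ _ (by simp), ← lintegral_const_mul' _ _ (by simp),
    ← lintegral_add_left ((hIm _ (hEZ _ m1)).const_mul 2),
    ← lintegral_add_left m12]
  refine setLIntegral_mono' measurableSet_Ioi fun t ht => ?_
  have ht : 0 < t := ht
  refine (mul_le_mul' le_rfl (D_le hf hg hh ht)).trans ?_
  have b1 : ∫⁻ r in Set.Ioc 0 (t / 2), ∫⁻ x, ENNReal.ofReal |P 1 f r x * P 1 h r x * P 0 g (t - r) x| ≤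
      ∫⁻ r in Set.Ioc 0 (t / 2), ∫⁻ x, ENNReal.ofReal |P 1 f r x| * Z1 r x := by
    refine setLIntegral_mono' measurableSet_Ioc fun r hr => lintegral_mono fun x => ?_
    beta_reduce
    rw [hZ1, ← ENNReal.ofReal_mul (abs_nonneg _), abs_mul, abs_mul]
    apply ENNReal.ofReal_le_ofReal
    have := P0_abs_le hg1 (t := t - r) (by linarith [hr.1, hr.2]) x
    exact mul_le_of_le_one_right (by positivity) this
  have b2 : ∫⁻ r in Set.Ioc 0 (t / 2), ∫⁻ x, ENNReal.ofReal |P 1 f r x * P 1 g r x * P 0 h (t - r) x| ≤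
      (∫⁻ r in Set.Ioc 0 (t / 2), ∫⁻ x, ENNReal.ofReal |P 1 f r x| * Z2 r x) +
      ∫⁻ r in Set.Ioc 0 (t / 2), ∫⁻ σ in Set.Ioc (1 / 10 * r) t,
      ∫⁻ x, ENNReal.ofReal |P 1 f r x| * ENNReal.ofReal |P 1 g r x| * ENNReal.ofReal |P 2 h σ x| := by
    rw [← lintegral_add_left (hEZ _ m2)]
    refine setLIntegral_mono' measurableSet_Ioc fun r hr => ?_
    have hm : Measurable (fun q : ℝ × ℝ => ENNReal.ofReal |P 1 f r q.2| * ENNReal.ofReal |P 1 g r q.2| * ENNReal.ofReal |P 2 h q.1 q.2|) :=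
      ((aP_comp hf.nice.meas 1 (fun _ : ℝ × ℝ => r) (fun z => z.2) (by fun_prop) (by fun_prop)).mul
      (aP_comp hg.nice.meas 1 (fun _ : ℝ × ℝ => r) (fun z => z.2) (by fun_prop) (by fun_prop))).mul (aP_meas hh.nice.meas 2)
    have hm2 : Measurable (fun x => ENNReal.ofReal |P 1 f r x| * Z2 r x) := (sl2 hmf r).mul (sl2 m2 r)
    rw [lintegral_lintegral_swap hm.aemeasurable, ← lintegral_add_left hm2]
    refine lintegral_mono fun x => ?_
    beta_reduce
    rw [lintegral_const_mul' _ _ (ENNReal.mul_ne_top ENNReal.ofReal_ne_top ENNReal.ofReal_ne_top), hZ2]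
    beta_reduce
    rw [← mul_assoc, ← mul_add, abs_mul, abs_mul, ENNReal.ofReal_mul (by positivity), ENNReal.ofReal_mul (by positivity)]
    refine mul_le_mul' le_rfl ?_
    refine (P0_late hh.nice (a := 1 / 10 * r) (t := t) (by linarith [hr.1]) (by linarith [hr.1, hr.2]) (by linarith [hr.1]) x).trans ?_
    gcongr
    exact le_abs_self _
  refine (mul_le_mul' le_rfl (add_le_add (mul_le_mul' le_rfl b1) (mul_le_mul' le_rfl b2))).trans (le_of_eq ?_)
  ring

lemma tri {s p q : ℝ} (hs : 0 < s) (hs1 : s < 1) (hpq : p.HolderConjugate q) (c : ℝ) :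
    ∃ C : ENNReal, C ≠ ⊤ ∧ ∀ f g h φ : ℝ → ℝ, Sm f → Sm g → (∀ x, |g x| ≤ 1) → Sm h → Nice φ → Sub s c f φ →
    ∫⁻ t in Set.Ioi (0:ℝ), ENNReal.ofReal (t ^ (-1 - s / 2)) *
      ENNReal.ofReal |(∫ x, f x * h x * P 0 g t x) - ∫ x, f x * g x * P 0 h t x| ≤
      C * (Np p φ ^ (1 / p) * Np q h ^ (1 / q)) := by
  have hp := hpq.lt
  have hq := hpq.symm.lt
  have hp1 : 0 ≤ 1 / p := by positivity
  have hq1 : 0 ≤ 1 / q := by positivity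
  obtain ⟨C1, hC1, H1⟩ := Sq_all hp
  obtain ⟨C2, hC2, H2⟩ := Sq_all hq
  obtain ⟨C3, hC3, H3⟩ := Cq_all hq
  have hW1 : W1 s ≠ ⊤ := w1_fin hs hs1
  have hW2 : W2 s ≠ ⊤ := w2_fin hs
  have hk1 : C1 ^ (1 / p) ≠ ⊤ := ENNReal.rpow_ne_top_of_nonneg hp1 hC1
  have hk2 : C2 ^ (1 / q) ≠ ⊤ := ENNReal.rpow_ne_top_of_nonneg hq1 hC2
  have hk3 : C3 ^ (1 / q) ≠ ⊤ := ENNReal.rpow_ne_top_of_nonneg hq1 hC3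
  refine ⟨2 * (ENNReal.ofReal (2 / s) * (ENNReal.ofReal c * W1 s) * (C1 ^ (1 / p) * C2 ^ (1 / q))) +
    2 * (ENNReal.ofReal (2 / s) * (ENNReal.ofReal c * W1 s) * (C1 ^ (1 / p) * C3 ^ (1 / q))) +
    2 * (2 * ENNReal.ofReal (2 / s) * (ENNReal.ofReal c * W1 s) * W2 s * (C1 ^ (1 / p) * C2 ^ (1 / q))), ?_, ?_⟩
  · finiteness
  intro f g h φ hf hg hg1 hh hφ H
  refine (D_split hs hf hg hg1 hh hφ H).trans ?_
  have gen : ∀ G : ℝ → ENNReal, ∀ D : ENNReal, Measurable G → ∫⁻ x, G x ^ (q / 2) ≤ D * Np q h →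
      ∫⁻ x, Sq 1 φ x ^ (1 / 2 : ℝ) * G x ^ (1 / 2 : ℝ) ≤ C1 ^ (1 / p) * D ^ (1 / q) * (Np p φ ^ (1 / p) * Np q h ^ (1 / q)) := by
    intro G D hG hD
    refine (hol2 hpq (Sq_meas hφ.meas 1) hG).trans ?_
    refine (mul_le_mul' (ENNReal.rpow_le_rpow (H1 φ hφ 1 le_rfl one_le_two) hp1) (ENNReal.rpow_le_rpow hD hq1)).trans (le_of_eq ?_)
    rw [ENNReal.mul_rpow_of_nonneg _ _ hp1, ENNReal.mul_rpow_of_nonneg _ _ hq1]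
    ring
  have ha := Sm_abs_nice hh.nice
  have g1 := gen _ C2 (Sq_meas hh.nice.meas 1) (H2 h hh.nice 1 le_rfl one_le_two)
  have g2 := gen _ C2 (Sq_meas hh.nice.meas 2) (H2 h hh.nice 2 one_le_two le_rfl)
  have g3 := gen _ C3 (Cq_meas hg.nice.meas ha.meas) ((H3 g _ hg.nice hg1 ha (fun x => abs_nonneg _)).trans
    (mul_le_mul' le_rfl (Np_mono (by linarith) (fun x => by simp))))
  refine (add_le_add (add_le_add (mul_le_mul' le_rfl (mul_le_mul' le_rfl g1)) (mul_le_mul' le_rfl (mul_le_mul' le_rfl g3)))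
    (mul_le_mul' le_rfl (mul_le_mul' le_rfl g2))).trans (le_of_eq ?_)
  ring

end KPV

namespace KPV

/-- the character -/
def ee (y ξ : ℝ) : ℂ := Complex.exp (Complex.I * ((y * ξ : ℝ) : ℂ))

lemma ee_norm (y ξ : ℝ) : ‖ee y ξ‖ = 1 := by
  unfold ee; rw [mul_comm]; exact Complex.norm_exp_ofReal_mul_I _

lemma ee_cont : Continuous (fun z : ℝ × ℝ => ee z.1 z.2) := by
  unfold ee; fun_prop

lemma ee_add (x y ξ : ℝ) : ee (x + y) ξ = ee x ξ * ee y ξ := by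
  unfold ee; rw [← Complex.exp_add]; congr 1; push_cast; ring

/-- real function as a Fourier integral of an integrable density -/
structure Fr (v : ℝ → ℝ) (F : ℝ → ℂ) : Prop where
  int : Integrable F
  int1 : Integrable (fun ξ : ℝ => (ξ : ℂ) * F ξ)
  rep : ∀ y, (v y : ℂ) = ∫ ξ, F ξ * ee y ξ

lemma hk_fourier {t : ℝ} (ht : 0 < t) (x ξ : ℝ) :
    ∫ y, (hk t (x - y) : ℂ) * ee y ξ = ee x ξ * ((exp (-(t * ξ ^ 2)) : ℝ) : ℂ) := by
  have h1 : ∫ y, (hk t (x - y) : ℂ) * ee y ξ = ∫ z, (hk t z : ℂ) * ee (x - z) ξ := by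
    have := integral_sub_left_eq_self (fun z => (hk t z : ℂ) * ee (x - z) ξ) volume x
    rw [← this]; simp
  have h2 : ∀ z, (hk t z : ℂ) * ee (x - z) ξ = (ee x ξ * (((√(4 * π * t))⁻¹ : ℝ) : ℂ)) *
      (Complex.exp (Complex.I * (-ξ : ℂ) * z) * Complex.exp (-((1 / (4 * t) : ℝ) : ℂ) * z ^ 2)) := by
    intro z
    have e1 : ee (x - z) ξ = ee x ξ * Complex.exp (Complex.I * (-ξ : ℂ) * z) := by
      rw [sub_eq_add_neg, ee_add]; congr 1; unfold ee; congr 1; push_cast; ring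
    have e2 : (hk t z : ℂ) = (((√(4 * π * t))⁻¹ : ℝ) : ℂ) * Complex.exp (-((1 / (4 * t) : ℝ) : ℂ) * z ^ 2) := by
      unfold hk; push_cast; congr 2; field_simp
    rw [e1, e2]; ring
  rw [h1]; simp_rw [h2]
  rw [integral_const_mul, fourierIntegral_gaussian (by rw [Complex.ofReal_re]; positivity)]
  have e3 : ((π : ℂ) / ((1 / (4 * t) : ℝ) : ℂ)) ^ (1 / 2 : ℂ) = ((√(4 * π * t) : ℝ) : ℂ) := by
    rw [Real.sqrt_eq_rpow, Complex.ofReal_cpow (by positivity)]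
    congr 1
    · have := ht.ne'
      push_cast; field_simp
    · push_cast; rfl
  have e4 : Complex.exp (-(-ξ : ℂ) ^ 2 / (4 * ((1 / (4 * t) : ℝ) : ℂ))) = ((exp (-(t * ξ ^ 2)) : ℝ) : ℂ) := by
    have := ht.ne'
    push_cast; congr 1; field_simp
  rw [e3, e4]
  have hne : (√(4 * π * t)) ≠ 0 := by positivity
  have : (((√(4 * π * t))⁻¹ : ℝ) : ℂ) * ((√(4 * π * t) : ℝ) : ℂ) = 1 := by
    rw [← Complex.ofReal_mul, inv_mul_cancel₀ hne, Complex.ofReal_one]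
  linear_combination (ee x ξ * ((exp (-(t * ξ ^ 2)) : ℝ) : ℂ)) * this

lemma exp_le1 {t : ℝ} (ht : 0 ≤ t) (ξ : ℝ) : exp (-(t * ξ ^ 2)) ≤ 1 :=
  exp_le_one_iff.2 (by nlinarith [mul_nonneg ht (sq_nonneg ξ)])

lemma Fr_P0 {v : ℝ → ℝ} {F : ℝ → ℂ} (h : Fr v F) {t : ℝ} (ht : 0 < t) (x : ℝ) :
    (P 0 v t x : ℂ) = ∫ ξ, F ξ * ee x ξ * ((exp (-(t * ξ ^ 2)) : ℝ) : ℂ) := by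
  have h1 : (P 0 v t x : ℂ) = ∫ y, ∫ ξ, (hk t (x - y) : ℂ) * (F ξ * ee y ξ) := by
    unfold P
    rw [← integral_complex_ofReal]
    congr 1; ext y
    rw [integral_const_mul, Complex.ofReal_mul, h.rep]; rfl
  rw [h1, integral_integral_swap (f := fun y ξ => (hk t (x - y) : ℂ) * (F ξ * ee y ξ))]
  · congr 1; ext ξ
    have : ∀ y, (hk t (x - y) : ℂ) * (F ξ * ee y ξ) = F ξ * ((hk t (x - y) : ℂ) * ee y ξ) := fun y => by ring
    simp_rw [this]
    rw [integral_const_mul, hk_fourier ht]; ring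
  · have hb : Integrable (fun z : ℝ × ℝ => (hk t (x - z.1) : ℂ) * F z.2) (volume.prod volume) :=
      Integrable.mul_prod (f := fun y => (hk t (x - y) : ℂ)) (g := F) (hk_sub_int ht x).ofReal h.int
    refine (hb.mul_bdd (c := 1) (f := fun z : ℝ × ℝ => (hk t (x - z.1) : ℂ) * F z.2) (g := fun z : ℝ × ℝ => ee z.1 z.2) ee_cont.aestronglyMeasurable (Filter.Eventually.of_forall fun z => (ee_norm _ _).le)).congr
      (Filter.Eventually.of_forall fun z => ?_)
    simp only [Function.uncurry]; ring

lemma ee_dx (x ξ : ℝ) : HasDerivAt (fun x => ee x ξ) (Complex.I * ξ * ee x ξ) x := by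
  unfold ee
  have h1 : HasDerivAt (fun x : ℝ => Complex.I * ((x * ξ : ℝ) : ℂ)) (Complex.I * ξ) x := by
    have : HasDerivAt (fun x : ℝ => x * ξ) ξ x := by simpa using (hasDerivAt_id x).mul_const ξ
    exact this.ofReal_comp.const_mul _
  exact h1.cexp.congr_deriv (by ring)

lemma Fr_P1 {v : ℝ → ℝ} {F : ℝ → ℂ} (hv : Integrable v) (h : Fr v F) {t : ℝ} (ht : 0 < t) (x : ℝ) :
    (P 1 v t x : ℂ) = ∫ ξ, (Complex.I * ξ * F ξ) * ee x ξ * ((exp (-(t * ξ ^ 2)) : ℝ) : ℂ) := by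
  have d1 : HasDerivAt (fun x => (P 0 v t x : ℂ)) (P 1 v t x : ℂ) x :=
    (P_dx hv (n := 0) (by omega) ht x).ofReal_comp
  have ecx : ∀ x, Continuous (fun ξ : ℝ => ee x ξ) := fun x => by unfold ee; fun_prop
  have d2 := (hasDerivAt_integral_of_dominated_loc_of_deriv_le (μ := volume)
    (F := fun x (ξ : ℝ) => F ξ * ee x ξ * ((exp (-(t * ξ ^ 2)) : ℝ) : ℂ))
    (F' := fun x (ξ : ℝ) => (Complex.I * ξ * F ξ) * ee x ξ * ((exp (-(t * ξ ^ 2)) : ℝ) : ℂ)) (x₀ := x) (s := Set.univ)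
    (bound := fun ξ : ℝ => ‖(ξ : ℂ) * F ξ‖) Filter.univ_mem ?_ ?_ ?_ ?_ h.int1.norm ?_).2
  · have : (fun x => (P 0 v t x : ℂ)) = fun x => ∫ ξ, F ξ * ee x ξ * ((exp (-(t * ξ ^ 2)) : ℝ) : ℂ) :=
      funext fun x => Fr_P0 h ht x
    rw [this] at d1
    exact d1.unique d2
  · refine Filter.Eventually.of_forall fun x => ?_
    exact (h.int.1.mul (ecx x).aestronglyMeasurable).mul (by fun_prop)
  · have := (h.int.mul_bdd (c := 1) (g := fun ξ : ℝ => ee x ξ * ((exp (-(t * ξ ^ 2)) : ℝ) : ℂ)) ((ecx x).mul (by fun_prop)).aestronglyMeasurable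
      (Filter.Eventually.of_forall fun ξ => ?_))
    · exact this.congr (Filter.Eventually.of_forall fun ξ => by simp only []; ring)
    · rw [norm_mul, ee_norm, one_mul, Complex.norm_real, Real.norm_eq_abs, abs_of_pos (exp_pos _)]
      exact exp_le1 ht.le ξ
  · have : AEStronglyMeasurable (fun ξ : ℝ => Complex.I * ((ξ : ℂ) * F ξ)) := h.int1.1.const_mul _
    refine AEStronglyMeasurable.mul (AEStronglyMeasurable.mul ?_ (ecx x).aestronglyMeasurable) (by fun_prop)
    exact this.congr (Filter.Eventually.of_forall fun ξ => by simp only []; ring)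
  · refine Filter.Eventually.of_forall fun ξ y _ => ?_
    rw [norm_mul, norm_mul, ee_norm, mul_one, Complex.norm_real, Real.norm_eq_abs, abs_of_pos (exp_pos _), mul_assoc, norm_mul, Complex.norm_I, one_mul]
    exact mul_le_of_le_one_right (norm_nonneg _) (exp_le1 ht.le ξ)
  · refine Filter.Eventually.of_forall fun ξ y _ => ?_
    exact (((ee_dx y ξ).const_mul (F ξ)).mul_const _).congr_deriv (by ring)

end KPV

namespace KPV

lemma kk : (((2 * π) ^ (-(1 : ℝ) / 2) : ℝ) : ℂ) * (((2 * π) ^ (-(1 : ℝ) / 2) : ℝ) : ℂ) = (((2 * π)⁻¹ : ℝ) : ℂ) := by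
  rw [← Complex.ofReal_mul, ← Real.rpow_add (by positivity), ← Real.rpow_neg_one]
  norm_num

lemma schwartz_F (f : SchwartzMap ℝ ℝ) : ∃ F : ℝ → ℂ, Continuous F ∧ Fr f F ∧
    (∀ n : ℕ, Integrable (fun ξ : ℝ => |ξ| ^ n * ‖F ξ‖)) ∧
    ∀ s x, Lam1 s (fun y => ((f y : ℝ) : ℂ)) x = ∫ ξ, ((|ξ| ^ s : ℝ) : ℂ) * F ξ * ee x ξ := by
  set fC : SchwartzMap ℝ ℂ := f.postcompCLM Complex.ofRealCLM with hfC
  have hfCa : ∀ y, fC y = (f y : ℂ) := fun y => rfl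
  set G : SchwartzMap ℝ ℂ := FourierTransform.fourier fC with hG
  have hGa : ∀ w, G w = ∫ v : ℝ, Complex.exp (↑(-2 * π * v * w) * Complex.I) * (f v : ℂ) := by
    intro w
    rw [hG, SchwartzMap.fourier_coe, Real.fourier_real_eq_integral_exp_smul]; rfl
  have hpi : (2 * π) ≠ 0 := by positivity
  have hFT : ∀ ξ, (((2 * π) ^ (-(1 : ℝ) / 2) : ℝ) : ℂ) * FT1 (fun y => ((f y : ℝ) : ℂ)) ξ = (((2 * π)⁻¹ : ℝ) : ℂ) * G (ξ / (2 * π)) := by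
    intro ξ
    rw [hGa]; unfold FT1
    rw [← mul_assoc, kk]
    congr 2; ext v
    congr 2
    have : -2 * π * v * (ξ / (2 * π)) = -(v * ξ) := by field_simp
    rw [this]; push_cast; ring
  have hinv : ∀ y, (f y : ℂ) = ∫ w : ℝ, G w * ee y (2 * π * w) := by
    intro y
    have h1 : FourierTransformInv.fourierInv G = fC := FourierTransform.fourierInv_fourier_eq fC
    rw [← hfCa, ← h1, SchwartzMap.fourierInv_coe, Real.fourierInv_eq']
    congr 1; ext w
    rw [smul_eq_mul, mul_comm]; congr 1
    unfold ee; congr 1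
    simp only [RCLike.inner_apply, conj_trivial]
    push_cast; ring
  refine ⟨fun ξ => (((2 * π)⁻¹ : ℝ) : ℂ) * G (ξ / (2 * π)), ?_, ?_, ?_, ?_⟩
  · exact continuous_const.mul (G.continuous.comp (continuous_id.div_const _))
  · have hintg : ∀ H : ℝ → ℂ, Integrable H → Integrable (fun ξ : ℝ => H (ξ / (2 * π))) := fun H hH => hH.comp_div hpi
    refine ⟨(hintg G G.integrable).const_mul _, ?_, ?_⟩
    · have h1 : Integrable (fun w : ℝ => (w : ℂ) * G w) := by
        refine (G.integrable_pow_mul volume 1).mono (by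
          exact (Complex.continuous_ofReal.mul G.continuous).aestronglyMeasurable) (Filter.Eventually.of_forall fun w => ?_)
        simp
      refine (hintg _ h1).congr (Filter.Eventually.of_forall fun ξ => ?_)
      have hpc : (π : ℂ) ≠ 0 := Complex.ofReal_ne_zero.2 pi_ne_zero
      push_cast; field_simp
    · intro y
      rw [hinv y]
      have h2 := Measure.integral_comp_div (fun w : ℝ => G w * ee y (2 * π * w)) (2 * π)
      have h3 : ∀ ξ, (((2 * π)⁻¹ : ℝ) : ℂ) * G (ξ / (2 * π)) * ee y ξ = (((2 * π)⁻¹ : ℝ) : ℂ) * (G (ξ / (2 * π)) * ee y (2 * π * (ξ / (2 * π)))) := by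
        intro ξ
        rw [mul_div_cancel₀ _ hpi, mul_assoc]
      simp_rw [h3]
      rw [integral_const_mul, h2, abs_of_pos (by positivity), Complex.real_smul, ← mul_assoc, ← Complex.ofReal_mul, inv_mul_cancel₀ hpi, Complex.ofReal_one, one_mul]
  · intro n
    have h1 := (G.integrable_pow_mul volume n).comp_div hpi
    refine (h1.const_mul ((2 * π) ^ n * (2 * π)⁻¹)).congr (Filter.Eventually.of_forall fun ξ => ?_)
    have : ‖(((2 * π)⁻¹ : ℝ) : ℂ)‖ = (2 * π)⁻¹ := by
      rw [Complex.norm_real, Real.norm_eq_abs, abs_of_pos (by positivity)]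
    simp only [norm_mul, this, Real.norm_eq_abs, abs_div]
    rw [abs_of_pos (show 0 < 2 * π by positivity)]
    rw [div_pow]; field_simp
  · intro s x
    unfold Lam1
    rw [← integral_const_mul]
    congr 1; ext ξ
    beta_reduce; rw [← hFT]; unfold ee; ring

end KPV

namespace KPV

/-- the basic integrable weight -/
lemma w_int {s : ℝ} (hs : 0 < s) (hs1 : s < 1) :
    IntegrableOn (fun t : ℝ => t ^ (-1 - s / 2) * min (√t) 1) (Set.Ioi 0) := by
  rw [← Set.Ioc_union_Ioi_eq_Ioi zero_le_one]
  refine IntegrableOn.union ?_ ?_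
  · have h1 : IntegrableOn (fun t : ℝ => t ^ (-1 / 2 - s / 2)) (Set.Ioc 0 1) :=
      (intervalIntegrable_iff_integrableOn_Ioc_of_le zero_le_one).1 (intervalIntegral.intervalIntegrable_rpow' (by linarith))
    refine h1.congr_fun (fun t ht => ?_) measurableSet_Ioc
    have : min (√t) 1 = √t := min_eq_left (Real.sqrt_le_one.2 ht.2)
    simp only [this]
    rw [Real.sqrt_eq_rpow, ← Real.rpow_add ht.1]; congr 1; ring
  · have h1 : IntegrableOn (fun t : ℝ => t ^ (-1 - s / 2)) (Set.Ioi 1) :=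
      integrableOn_Ioi_rpow_of_lt (by linarith) zero_lt_one
    refine h1.congr_fun (fun t ht => ?_) measurableSet_Ioi
    have : min (√t) 1 = 1 := min_eq_right (Real.one_le_sqrt.2 (le_of_lt ht))
    simp only [this, mul_one]

lemma e_bound {t : ℝ} (ht : 0 ≤ t) (ξ : ℝ) : 1 - exp (-(t * ξ ^ 2)) ≤ min (√t) 1 * (1 + |ξ|) := by
  have h1 : 1 - exp (-(t * ξ ^ 2)) ≤ 1 := by have := exp_pos (-(t * ξ ^ 2)); linarith
  have h2 : 1 - exp (-(t * ξ ^ 2)) ≤ √t * |ξ| := by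
    have e : t * ξ ^ 2 = (√t * |ξ|) ^ 2 := by rw [mul_pow, Real.sq_sqrt ht, sq_abs]
    rcases le_total (√t * |ξ|) 1 with h | h
    · have := Real.add_one_le_exp (-(t * ξ ^ 2))
      have h0 : 0 ≤ √t * |ξ| := by positivity
      rw [e] at this ⊢
      nlinarith
    · linarith
  have h3 : 0 ≤ |ξ| := abs_nonneg ξ
  rcases min_cases (√t) 1 with ⟨h, _⟩ | ⟨h, _⟩ <;> rw [h]
  · nlinarith [Real.sqrt_nonneg t]
  · linarith

lemma J_int {s : ℝ} (hs : 0 < s) (hs1 : s < 1) (ξ : ℝ) :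
    IntegrableOn (fun t : ℝ => t ^ (-1 - s / 2) * (1 - exp (-(t * ξ ^ 2)))) (Set.Ioi 0) := by
  refine Integrable.mono' ((w_int hs hs1).mul_const (1 + |ξ|)) (by fun_prop) ?_
  filter_upwards [self_mem_ae_restrict measurableSet_Ioi] with t ht
  have ht' : 0 < t := ht
  have h0 : 0 ≤ 1 - exp (-(t * ξ ^ 2)) := by linarith [exp_le1 ht'.le ξ]
  rw [Real.norm_eq_abs, abs_of_nonneg (by positivity), mul_assoc]
  exact mul_le_mul_of_nonneg_left (e_bound ht'.le ξ) (by positivity)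

/-- normalising constant -/
def J (s : ℝ) : ℝ := ∫ t in Set.Ioi (0 : ℝ), t ^ (-1 - s / 2) * (1 - exp (-t))

lemma J_pos {s : ℝ} (hs : 0 < s) (hs1 : s < 1) : 0 < J s := by
  unfold J
  have hi := J_int hs hs1 1
  simp only [one_pow, mul_one] at hi
  rw [setIntegral_pos_iff_support_of_nonneg_ae ?_ hi]
  · have : Function.support (fun t : ℝ => t ^ (-1 - s / 2) * (1 - exp (-t))) ∩ Set.Ioi 0 = Set.Ioi 0 := by
      apply Set.inter_eq_right.2
      intro t ht
      have ht' : 0 < t := ht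
      have : exp (-t) < 1 := exp_lt_one_iff.2 (by linarith)
      have h1 : 0 < t ^ (-1 - s / 2) * (1 - exp (-t)) := mul_pos (by positivity) (by linarith)
      exact h1.ne'
    rw [this]; simp
  · filter_upwards [self_mem_ae_restrict measurableSet_Ioi] with t ht
    have ht' : 0 < t := ht
    have : exp (-t) < 1 := exp_lt_one_iff.2 (by linarith)
    exact mul_nonneg (by positivity) (by linarith)

lemma J_scale {s : ℝ} (hs : 0 < s) (ξ : ℝ) :
    ∫ t in Set.Ioi (0 : ℝ), t ^ (-1 - s / 2) * (1 - exp (-(t * ξ ^ 2))) = |ξ| ^ s * J s := by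
  by_cases hx : ξ = 0
  · subst hx; simp [Real.zero_rpow hs.ne']
  have hb : 0 < ξ ^ 2 := by positivity
  have h := integral_comp_mul_left_Ioi (fun u : ℝ => u ^ (-1 - s / 2) * (1 - exp (-u))) 0 hb
  rw [mul_zero, smul_eq_mul] at h
  have e : ∫ t in Set.Ioi (0 : ℝ), (ξ ^ 2 * t) ^ (-1 - s / 2) * (1 - exp (-(ξ ^ 2 * t))) =
      (ξ ^ 2) ^ (-1 - s / 2) * ∫ t in Set.Ioi (0 : ℝ), t ^ (-1 - s / 2) * (1 - exp (-(t * ξ ^ 2))) := by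
    rw [← integral_const_mul]
    refine setIntegral_congr_fun measurableSet_Ioi fun t ht => ?_
    have ht' : 0 < t := ht
    beta_reduce
    rw [Real.mul_rpow hb.le ht'.le, mul_comm t]; ring
  rw [e] at h
  have hp : (ξ ^ 2) ^ (-1 - s / 2) * ((ξ ^ 2) * |ξ| ^ s) = 1 := by
    have : |ξ| ^ s = (ξ ^ 2) ^ (s / 2) := by
      rw [← sq_abs, ← Real.rpow_natCast, ← Real.rpow_mul (abs_nonneg _)]; congr 1; push_cast; ring
    rw [this]
    nth_rw 2 [← Real.rpow_one (ξ ^ 2)]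
    rw [← Real.rpow_add hb, ← Real.rpow_add hb]
    norm_num
  have hJ : (ξ ^ 2)⁻¹ * (∫ t in Set.Ioi (0 : ℝ), t ^ (-1 - s / 2) * (1 - exp (-t))) = (ξ ^ 2)⁻¹ * J s := rfl
  rw [hJ] at h
  have h2 : (ξ ^ 2) * ((ξ ^ 2)⁻¹ * J s) = J s := by rw [← mul_assoc, mul_inv_cancel₀ hb.ne', one_mul]
  set X := ∫ t in Set.Ioi (0 : ℝ), t ^ (-1 - s / 2) * (1 - exp (-(t * ξ ^ 2)))
  rw [← h] at h2
  linear_combination (-X) * hp + |ξ| ^ s * h2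

/-- the fractional derivative via the heat semigroup -/
def phi (s : ℝ) (f : ℝ → ℝ) (x : ℝ) : ℝ :=
  (J s)⁻¹ * ∫ t in Set.Ioi (0 : ℝ), t ^ (-1 - s / 2) * (f x - P 0 f t x)

lemma phi_meas {s : ℝ} {f : ℝ → ℝ} (hf : Measurable f) : Measurable (phi s f) := by
  have h1 : Measurable (fun z : ℝ × ℝ => z.2 ^ (-1 - s / 2) * (f z.1 - P 0 f z.2 z.1)) := by
    have := (P_meas hf 0).comp measurable_swap
    exact (measurable_snd.pow_const _).mul ((hf.comp measurable_fst).sub this)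
  exact (h1.stronglyMeasurable.integral_prod_right' (ν := volume.restrict (Set.Ioi 0))).measurable.const_mul _

lemma phi_prod_int {s : ℝ} (hs : 0 < s) (hs1 : s < 1) {f : ℝ → ℝ} (hf : Sm f) :
    Integrable (fun z : ℝ × ℝ => z.2 ^ (-1 - s / 2) * (f z.1 - P 0 f z.2 z.1)) (volume.prod (volume.restrict (Set.Ioi 0))) := by
  have hm : Measurable (fun z : ℝ × ℝ => z.2 ^ (-1 - s / 2) * (f z.1 - P 0 f z.2 z.1)) := by
    have := (P_meas hf.nice.meas 0).comp measurable_swap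
    exact (measurable_snd.pow_const _).mul ((hf.nice.meas.comp measurable_fst).sub this)
  obtain ⟨M, hM, hl⟩ := hf.l1
  set A := max M (2 * ∫ x, |f x|)
  have hA : 0 ≤ A := hM.trans (le_max_left _ _)
  refine (integrable_prod_iff' hm.aestronglyMeasurable).2 ⟨?_, ?_⟩
  · filter_upwards [self_mem_ae_restrict measurableSet_Ioi] with t ht
    exact (hf.nice.int.sub (P0_int hf.nice.int ht)).const_mul _
  · refine Integrable.mono' ((w_int hs hs1).const_mul A) ?_ ?_
    · exact (hm.norm.stronglyMeasurable.integral_prod_left' (μ := volume)).aestronglyMeasurable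
    · filter_upwards [self_mem_ae_restrict measurableSet_Ioi] with t ht
      have ht' : 0 < t := ht
      have hi : Integrable (fun x => f x - P 0 f t x) := hf.nice.int.sub (P0_int hf.nice.int ht')
      have hb1 : ∫ x, |f x - P 0 f t x| ≤ M * √t := by
        rw [integral_eq_lintegral_of_nonneg_ae (Filter.Eventually.of_forall fun x => abs_nonneg _) hi.abs.1]
        exact ENNReal.toReal_le_of_le_ofReal (by positivity) (hl t ht')
      have hb2 : ∫ x, |f x - P 0 f t x| ≤ 2 * ∫ x, |f x| := by
        have h3 := P0_L1 hf.nice.int ht'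
        have h4 : ∫ x, |f x - P 0 f t x| ≤ ∫ x, (|f x| + |P 0 f t x|) :=
          integral_mono hi.abs (hf.nice.int.abs.add (P0_int hf.nice.int ht').abs) fun x => abs_sub _ _
        rw [integral_add hf.nice.int.abs (P0_int hf.nice.int ht').abs] at h4
        linarith
      have hb3 : ∫ x, |f x - P 0 f t x| ≤ A * min (√t) 1 := by
        rcases min_cases (√t) 1 with ⟨h, _⟩ | ⟨h, _⟩ <;> rw [h]
        · exact hb1.trans (mul_le_mul_of_nonneg_right (le_max_left _ _) (Real.sqrt_nonneg t))
        · rw [mul_one]; exact hb2.trans (le_max_right _ _)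
      have hp : 0 ≤ t ^ (-1 - s / 2) := by positivity
      have e : ∫ x, ‖t ^ (-1 - s / 2) * (f x - P 0 f t x)‖ = t ^ (-1 - s / 2) * ∫ x, |f x - P 0 f t x| := by
        rw [← integral_const_mul]; congr 1; ext x
        rw [Real.norm_eq_abs, abs_mul, abs_of_nonneg hp]
      rw [e, Real.norm_eq_abs, abs_of_nonneg (mul_nonneg hp (integral_nonneg fun x => abs_nonneg _))]
      calc _ ≤ t ^ (-1 - s / 2) * (A * min (√t) 1) := mul_le_mul_of_nonneg_left hb3 hp
        _ = _ := by ring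

lemma phi_sup_bound {f : ℝ → ℝ} (hf : Sm f) : ∃ A, 0 ≤ A ∧ ∀ t > 0, ∀ x, |f x - P 0 f t x| ≤ A * min (√t) 1 := by
  obtain ⟨M, hM, hl⟩ := hf.sup
  obtain ⟨B, hB⟩ := hf.nice.bdd
  refine ⟨max M (2 * B), hM.trans (le_max_left _ _), fun t ht x => ?_⟩
  rcases min_cases (√t) 1 with ⟨h, _⟩ | ⟨h, _⟩ <;> rw [h]
  · exact (hl t ht x).trans (mul_le_mul_of_nonneg_right (le_max_left _ _) (Real.sqrt_nonneg t))
  · rw [mul_one]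
    have h1 := P0_abs_le hB ht x
    have h2 := hB x
    have h3 := abs_sub (f x) (P 0 f t x)
    exact (by linarith : _ ≤ 2 * B).trans (le_max_right _ _)

lemma phi_nice {s : ℝ} (hs : 0 < s) (hs1 : s < 1) {f : ℝ → ℝ} (hf : Sm f) : Nice (phi s f) := by
  refine ⟨phi_meas hf.nice.meas, ?_, ?_⟩
  · exact (phi_prod_int hs hs1 hf).integral_prod_left.const_mul _
  · obtain ⟨A, hA, hb⟩ := phi_sup_bound hf
    refine ⟨|(J s)⁻¹| * ∫ t in Set.Ioi (0 : ℝ), A * (t ^ (-1 - s / 2) * min (√t) 1), fun x => ?_⟩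
    unfold phi
    rw [abs_mul]
    refine mul_le_mul_of_nonneg_left ?_ (abs_nonneg _)
    rw [← Real.norm_eq_abs]
    refine norm_integral_le_of_norm_le ((w_int hs hs1).const_mul A) ?_
    filter_upwards [self_mem_ae_restrict measurableSet_Ioi] with t ht
    have ht' : 0 < t := ht
    have hp : 0 ≤ t ^ (-1 - s / 2) := by positivity
    rw [Real.norm_eq_abs, abs_mul, abs_of_nonneg hp]
    calc _ ≤ t ^ (-1 - s / 2) * (A * min (√t) 1) := mul_le_mul_of_nonneg_left (hb t ht' x) hp
      _ = _ := by ring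

end KPV

namespace KPV

lemma rpow_le_lin {s : ℝ} (hs : 0 < s) (hs1 : s < 1) (ξ : ℝ) : |ξ| ^ s ≤ 1 + |ξ| := by
  rcases le_total |ξ| 1 with h | h
  · exact (Real.rpow_le_one (abs_nonneg _) h hs.le).trans (by linarith [abs_nonneg ξ])
  · calc |ξ| ^ s ≤ |ξ| ^ (1 : ℝ) := Real.rpow_le_rpow_of_exponent_le h hs1.le
      _ ≤ _ := by rw [Real.rpow_one]; linarith

lemma ee_meas (x : ℝ) : Continuous (fun ξ : ℝ => ee x ξ) := by unfold ee; fun_prop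

lemma phi_eq {s : ℝ} (hs : 0 < s) (hs1 : s < 1) {f : ℝ → ℝ} {F : ℝ → ℂ} (hc : Continuous F) (hF : Fr f F)
    (hi : ∀ n : ℕ, Integrable (fun ξ : ℝ => |ξ| ^ n * ‖F ξ‖)) (x : ℝ) :
    (phi s f x : ℂ) = ∫ ξ, ((|ξ| ^ s : ℝ) : ℂ) * F ξ * ee x ξ := by
  have h1 : ∀ t > 0, ((t ^ (-1 - s / 2) * (f x - P 0 f t x) : ℝ) : ℂ) =
      ∫ ξ, ((t ^ (-1 - s / 2) * (1 - exp (-(t * ξ ^ 2))) : ℝ) : ℂ) * (F ξ * ee x ξ) := by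
    intro t ht
    rw [Complex.ofReal_mul, Complex.ofReal_sub, Fr_P0 hF ht, hF.rep]
    have hi1 : Integrable (fun ξ => F ξ * ee x ξ) :=
      hF.int.mul_bdd (c := 1) (ee_meas x).aestronglyMeasurable (Filter.Eventually.of_forall fun z => (ee_norm _ _).le)
    have hi2 : Integrable (fun ξ => F ξ * ee x ξ * ((exp (-(t * ξ ^ 2)) : ℝ) : ℂ)) := by
      refine hi1.mul_bdd (c := 1) (by fun_prop) (Filter.Eventually.of_forall fun ξ => ?_)
      rw [Complex.norm_real, Real.norm_eq_abs, abs_of_pos (exp_pos _)]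
      exact exp_le1 ht.le ξ
    rw [← integral_sub hi1 hi2, ← integral_const_mul]
    congr 1; ext ξ; push_cast; ring
  unfold phi
  rw [Complex.ofReal_mul, ← integral_complex_ofReal, setIntegral_congr_fun measurableSet_Ioi (fun t ht => h1 t ht)]
  rw [integral_integral_swap (f := fun t ξ => ((t ^ (-1 - s / 2) * (1 - exp (-(t * ξ ^ 2))) : ℝ) : ℂ) * (F ξ * ee x ξ))]
  · have h2 : ∀ ξ, ∫ t in Set.Ioi (0 : ℝ), ((t ^ (-1 - s / 2) * (1 - exp (-(t * ξ ^ 2))) : ℝ) : ℂ) * (F ξ * ee x ξ) =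
        ((J s : ℝ) : ℂ) * (((|ξ| ^ s : ℝ) : ℂ) * F ξ * ee x ξ) := by
      intro ξ
      rw [integral_mul_const, integral_complex_ofReal, J_scale hs]
      push_cast; ring
    simp_rw [h2]
    rw [integral_const_mul, ← mul_assoc, ← Complex.ofReal_mul, inv_mul_cancel₀ (J_pos hs hs1).ne', Complex.ofReal_one, one_mul]
  · have hb : Integrable (fun z : ℝ × ℝ => (z.1 ^ (-1 - s / 2) * min (√z.1) 1) * ((1 + |z.2|) * ‖F z.2‖)) ((volume.restrict (Set.Ioi 0)).prod volume) := by
      refine Integrable.mul_prod (f := fun t : ℝ => t ^ (-1 - s / 2) * min (√t) 1) (g := fun ξ : ℝ => (1 + |ξ|) * ‖F ξ‖) (w_int hs hs1) ?_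
      refine ((hi 0).add (hi 1)).congr (Filter.Eventually.of_forall fun ξ => ?_)
      simp only [Pi.add_apply]; ring
    refine Integrable.mono' hb ?_ ?_
    · have m1 : Measurable (fun z : ℝ × ℝ => F z.2) := hc.measurable.comp measurable_snd
      have m2 : Measurable (fun z : ℝ × ℝ => ee x z.2) := (ee_meas x).measurable.comp measurable_snd
      have m3 : Measurable (fun z : ℝ × ℝ => ((z.1 ^ (-1 - s / 2) * (1 - exp (-(z.1 * z.2 ^ 2))) : ℝ) : ℂ)) := by fun_prop
      exact (m3.mul (m1.mul m2)).aestronglyMeasurable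
    · have : ∀ᵐ z : ℝ × ℝ ∂((volume.restrict (Set.Ioi 0)).prod volume), 0 < z.1 :=
        Measure.quasiMeasurePreserving_fst.ae (self_mem_ae_restrict measurableSet_Ioi)
      filter_upwards [this] with z hz
      have h0 : 0 ≤ 1 - exp (-(z.1 * z.2 ^ 2)) := by linarith [exp_le1 hz.le z.2]
      simp only [Function.uncurry]
      rw [norm_mul, norm_mul, ee_norm, mul_one, Complex.norm_real, Real.norm_eq_abs, abs_of_nonneg (by positivity)]
      calc _ ≤ z.1 ^ (-1 - s / 2) * (min (√z.1) 1 * (1 + |z.2|)) * ‖F z.2‖ := by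
            refine mul_le_mul_of_nonneg_right (mul_le_mul_of_nonneg_left (e_bound hz.le _) (by positivity)) (norm_nonneg _)
        _ = _ := by ring

lemma Lam_eq {s : ℝ} (hs : 0 < s) (hs1 : s < 1) (f : SchwartzMap ℝ ℝ) (x : ℝ) :
    Lam1 s (fun y => ((f y : ℝ) : ℂ)) x = (phi s f x : ℂ) := by
  obtain ⟨F, hc, hF, hi, hL⟩ := schwartz_F f
  rw [hL, phi_eq hs hs1 hc hF hi]

lemma phi_Fr {s : ℝ} (hs : 0 < s) (hs1 : s < 1) {f : ℝ → ℝ} {F : ℝ → ℂ} (hc : Continuous F) (hF : Fr f F)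
    (hi : ∀ n : ℕ, Integrable (fun ξ : ℝ => |ξ| ^ n * ‖F ξ‖)) : Fr (phi s f) (fun ξ => ((|ξ| ^ s : ℝ) : ℂ) * F ξ) := by
  have m0 : Measurable (fun ξ : ℝ => ((|ξ| ^ s : ℝ) : ℂ) * F ξ) := by
    have m1 : Measurable (fun ξ : ℝ => ((|ξ| ^ s : ℝ) : ℂ)) := by fun_prop
    exact m1.mul hc.measurable
  refine ⟨?_, ?_, fun y => phi_eq hs hs1 hc hF hi y⟩
  · refine Integrable.mono' ((hi 0).add (hi 1)) m0.aestronglyMeasurable (Filter.Eventually.of_forall fun ξ => ?_)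
    rw [norm_mul, Complex.norm_real, Real.norm_eq_abs, abs_of_nonneg (by positivity)]
    simp only [Pi.add_apply]
    nlinarith [mul_le_mul_of_nonneg_right (rpow_le_lin hs hs1 ξ) (norm_nonneg (F ξ))]
  · refine Integrable.mono' ((hi 1).add (hi 2)) (Complex.measurable_ofReal.mul m0).aestronglyMeasurable (Filter.Eventually.of_forall fun ξ => ?_)
    rw [norm_mul, norm_mul, Complex.norm_real, Complex.norm_real, Real.norm_eq_abs, Real.norm_eq_abs, abs_of_nonneg (show 0 ≤ |ξ| ^ s by positivity)]
    simp only [Pi.add_apply]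
    have := mul_le_mul_of_nonneg_left (mul_le_mul_of_nonneg_right (rpow_le_lin hs hs1 ξ) (norm_nonneg (F ξ))) (abs_nonneg ξ)
    nlinarith

lemma gam_int {s : ℝ} (hs : 0 < s) {ξ : ℝ} (hx : ξ ≠ 0) :
    ∫ σ in Set.Ioi (0 : ℝ), σ ^ (s / 2 - 1) * exp (-(σ * ξ ^ 2)) = Gamma (s / 2) * (|ξ| ^ s)⁻¹ := by
  have h := Real.integral_rpow_mul_exp_neg_mul_Ioi (a := s / 2) (r := ξ ^ 2) (by positivity) (by positivity)
  have e : (1 / ξ ^ 2) ^ (s / 2) = (|ξ| ^ s)⁻¹ := by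
    rw [one_div, ← sq_abs, Real.inv_rpow (by positivity), ← Real.rpow_natCast, ← Real.rpow_mul (abs_nonneg _)]
    congr 2; push_cast; ring
  rw [e] at h
  simp_rw [mul_comm _ (ξ ^ 2)]
  rw [h]; ring

lemma gam_intble {s : ℝ} (hs : 0 < s) {ξ : ℝ} (hx : ξ ≠ 0) :
    IntegrableOn (fun σ : ℝ => σ ^ (s / 2 - 1) * exp (-(σ * ξ ^ 2))) (Set.Ioi (0 : ℝ)) := by
  by_contra hcon
  have h := gam_int hs hx
  rw [integral_undef hcon] at h
  have h1 : 0 < Gamma (s / 2) := Gamma_pos_of_pos (by positivity)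
  have h2 : 0 < |ξ| ^ s := Real.rpow_pos_of_pos (abs_pos.2 hx) _
  have : 0 < Gamma (s / 2) * (|ξ| ^ s)⁻¹ := by positivity
  linarith

lemma sub_eq {s : ℝ} (hs : 0 < s) (hs1 : s < 1) {f : ℝ → ℝ} {F : ℝ → ℂ} (hf : Sm f) (hc : Continuous F) (hF : Fr f F)
    (hi : ∀ n : ℕ, Integrable (fun ξ : ℝ => |ξ| ^ n * ‖F ξ‖)) {t : ℝ} (ht : 0 < t) (x : ℝ) :
    Gamma (s / 2) * P 1 f t x = ∫ σ in Set.Ioi (0 : ℝ), σ ^ (s / 2 - 1) * P 1 (phi s f) (t + σ) x := by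
  have hG := phi_Fr hs hs1 hc hF hi
  have hN := phi_nice hs hs1 hf
  have hae : ∀ᵐ ξ : ℝ, ξ ≠ 0 := by
    simp [ae_iff, measure_singleton]
  apply Complex.ofReal_injective
  rw [← integral_complex_ofReal, Complex.ofReal_mul, Fr_P1 hf.nice.int hF ht]
  have h1 : ∀ σ > 0, ((σ ^ (s / 2 - 1) * P 1 (phi s f) (t + σ) x : ℝ) : ℂ) =
      ∫ ξ : ℝ, ((σ ^ (s / 2 - 1) * exp (-(σ * ξ ^ 2)) : ℝ) : ℂ) *
        ((Complex.I * ξ * (((|ξ| ^ s : ℝ) : ℂ) * F ξ)) * ee x ξ * ((exp (-(t * ξ ^ 2)) : ℝ) : ℂ)) := by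
    intro σ hσ
    rw [Complex.ofReal_mul, Fr_P1 hN.int hG (by positivity), ← integral_const_mul]
    congr 1; ext ξ
    have : exp (-((t + σ) * ξ ^ 2)) = exp (-(t * ξ ^ 2)) * exp (-(σ * ξ ^ 2)) := by
      rw [← exp_add]; congr 1; ring
    rw [this, Complex.ofReal_mul, Complex.ofReal_mul]; ring
  rw [setIntegral_congr_fun measurableSet_Ioi (fun t ht => h1 t ht)]
  rw [integral_integral_swap (f := fun σ (ξ : ℝ) => ((σ ^ (s / 2 - 1) * exp (-(σ * ξ ^ 2)) : ℝ) : ℂ) *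
        ((Complex.I * ξ * (((|ξ| ^ s : ℝ) : ℂ) * F ξ)) * ee x ξ * ((exp (-(t * ξ ^ 2)) : ℝ) : ℂ)))]
  · rw [← integral_const_mul]
    refine integral_congr_ae ?_
    filter_upwards [hae] with ξ hx
    rw [integral_mul_const, integral_complex_ofReal, gam_int hs hx]
    have h2 : 0 < |ξ| ^ s := Real.rpow_pos_of_pos (abs_pos.2 hx) _
    have h3 : (((|ξ| ^ s)⁻¹ : ℝ) : ℂ) * ((|ξ| ^ s : ℝ) : ℂ) = 1 := by
      rw [← Complex.ofReal_mul, inv_mul_cancel₀ h2.ne', Complex.ofReal_one]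
    rw [Complex.ofReal_mul]
    linear_combination (-(Gamma (s / 2) : ℂ) * (Complex.I * ξ * F ξ * ee x ξ * ((exp (-(t * ξ ^ 2)) : ℝ) : ℂ))) * h3
  · have hm : Measurable (Function.uncurry (fun σ (ξ : ℝ) => ((σ ^ (s / 2 - 1) * exp (-(σ * ξ ^ 2)) : ℝ) : ℂ) *
        ((Complex.I * ξ * (((|ξ| ^ s : ℝ) : ℂ) * F ξ)) * ee x ξ * ((exp (-(t * ξ ^ 2)) : ℝ) : ℂ)))) := by
      have m1 : Measurable (fun z : ℝ × ℝ => F z.2) := hc.measurable.comp measurable_snd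
      have m2 : Measurable (fun z : ℝ × ℝ => ee x z.2) := (ee_meas x).measurable.comp measurable_snd
      have m3 : Measurable (fun z : ℝ × ℝ => ((z.1 ^ (s / 2 - 1) * exp (-(z.1 * z.2 ^ 2)) : ℝ) : ℂ)) := by fun_prop
      have m4 : Measurable (fun z : ℝ × ℝ => ((|z.2| ^ s : ℝ) : ℂ)) := by fun_prop
      have m5 : Measurable (fun z : ℝ × ℝ => Complex.I * (z.2 : ℂ)) := by fun_prop
      have m6 : Measurable (fun z : ℝ × ℝ => ((exp (-(t * z.2 ^ 2)) : ℝ) : ℂ)) := by fun_prop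
      exact m3.mul (((m5.mul (m4.mul m1)).mul m2).mul m6)
    refine (integrable_prod_iff' hm.aestronglyMeasurable).2 ⟨?_, ?_⟩
    · filter_upwards [hae] with ξ hx
      have hh : Integrable (fun σ : ℝ => ((σ ^ (s / 2 - 1) * exp (-(σ * ξ ^ 2)) : ℝ) : ℂ)) (volume.restrict (Set.Ioi 0)) := (gam_intble hs hx).ofReal
      simp only [Function.uncurry]; exact hh.mul_const _
    · refine Integrable.mono' ((hi 1).const_mul (Gamma (s / 2))) ?_ ?_
      · exact (hm.norm.stronglyMeasurable.integral_prod_left' (μ := volume.restrict (Set.Ioi 0))).aestronglyMeasurable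
      · filter_upwards [hae] with ξ hx
        have hG0 : 0 < Gamma (s / 2) := Gamma_pos_of_pos (by positivity)
        have h2 : 0 < |ξ| ^ s := Real.rpow_pos_of_pos (abs_pos.2 hx) _
        rw [Real.norm_eq_abs, abs_of_nonneg (integral_nonneg fun _ => norm_nonneg _)]
        have e : ∫ σ in Set.Ioi (0 : ℝ), ‖Function.uncurry (fun σ (ξ : ℝ) => ((σ ^ (s / 2 - 1) * exp (-(σ * ξ ^ 2)) : ℝ) : ℂ) *
            ((Complex.I * ξ * (((|ξ| ^ s : ℝ) : ℂ) * F ξ)) * ee x ξ * ((exp (-(t * ξ ^ 2)) : ℝ) : ℂ))) (σ, ξ)‖ =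
            ∫ σ in Set.Ioi (0 : ℝ), (σ ^ (s / 2 - 1) * exp (-(σ * ξ ^ 2))) * (|ξ| * |ξ| ^ s * ‖F ξ‖ * exp (-(t * ξ ^ 2))) := by
          refine setIntegral_congr_fun measurableSet_Ioi fun σ hσ => ?_
          have hσp : 0 < σ := hσ
          simp only [Function.uncurry, norm_mul, ee_norm, Complex.norm_real, Complex.norm_I, Real.norm_eq_abs, abs_of_pos (exp_pos _), abs_of_pos h2]
          rw [abs_of_nonneg (show 0 ≤ σ ^ (s / 2 - 1) by positivity)]
          ring
        rw [e, integral_mul_const, gam_int hs hx, pow_one]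
        have h4 : Gamma (s / 2) * (|ξ| ^ s)⁻¹ * (|ξ| * |ξ| ^ s * ‖F ξ‖ * exp (-(t * ξ ^ 2))) = Gamma (s / 2) * (|ξ| * ‖F ξ‖) * exp (-(t * ξ ^ 2)) := by
          field_simp
        rw [h4]
        exact mul_le_of_le_one_right (by positivity) (exp_le1 ht.le ξ)

lemma schwartz_Sub {s : ℝ} (hs : 0 < s) (hs1 : s < 1) (f : SchwartzMap ℝ ℝ) : Sub s (Gamma (s / 2))⁻¹ f (phi s f) := by
  obtain ⟨F, hc, hF, hi, -⟩ := schwartz_F f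
  intro t ht x
  have hG0 : 0 < Gamma (s / 2) := Gamma_pos_of_pos (by positivity)
  have h := sub_eq hs hs1 (schwartz_Sm f) hc hF hi ht x
  have e : P 1 f t x = (Gamma (s / 2))⁻¹ * ∫ σ in Set.Ioi (0 : ℝ), σ ^ (s / 2 - 1) * P 1 (phi s f) (t + σ) x := by
    rw [← h, ← mul_assoc, inv_mul_cancel₀ hG0.ne', one_mul]
  rw [e, abs_mul, abs_of_pos (inv_pos.2 hG0), ENNReal.ofReal_mul (inv_pos.2 hG0).le]
  refine mul_le_mul' le_rfl ?_
  rw [← Real.enorm_eq_ofReal_abs]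
  refine (enorm_integral_le_lintegral_enorm _).trans (le_of_eq ?_)
  refine setLIntegral_congr_fun measurableSet_Ioi fun σ hσ => ?_
  have hσp : 0 < σ := hσ
  have hp : 0 ≤ σ ^ (s / 2 - 1) := by positivity
  rw [Real.enorm_eq_ofReal_abs, abs_mul, ENNReal.ofReal_mul (abs_nonneg _), abs_of_nonneg hp]

end KPV

namespace KPV

lemma Nice.mul {f g : ℝ → ℝ} (hf : Nice f) (hg : Nice g) : Nice (fun x => f x * g x) := by
  obtain ⟨A, hA⟩ := hf.bdd
  obtain ⟨B, hB⟩ := hg.bdd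
  refine ⟨hf.meas.mul hg.meas, hf.int.mul_bdd (c := B) hg.meas.aestronglyMeasurable (Filter.Eventually.of_forall hB), A * B, fun x => ?_⟩
  rw [abs_mul]
  exact mul_le_mul (hA x) (hB x) (abs_nonneg _) ((abs_nonneg _).trans (hA x))

lemma pair_int {s : ℝ} (hs : 0 < s) (hs1 : s < 1) {f u : ℝ → ℝ} (hf : Sm f) (hu : Nice u) :
    Integrable (fun z : ℝ × ℝ => u z.1 * (z.2 ^ (-1 - s / 2) * (f z.1 - P 0 f z.2 z.1))) (volume.prod (volume.restrict (Set.Ioi 0))) := by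
  obtain ⟨B, hB⟩ := hu.bdd
  exact (phi_prod_int hs hs1 hf).bdd_mul (c := B) (hu.meas.comp measurable_fst).aestronglyMeasurable (Filter.Eventually.of_forall fun z => hB z.1)

lemma pair_eq {s : ℝ} (hs : 0 < s) (hs1 : s < 1) {f u : ℝ → ℝ} (hf : Sm f) (hu : Nice u) :
    IntegrableOn (fun t : ℝ => t ^ (-1 - s / 2) * ∫ x, u x * (f x - P 0 f t x)) (Set.Ioi 0) ∧
    ∫ x, u x * phi s f x = (J s)⁻¹ * ∫ t in Set.Ioi (0 : ℝ), t ^ (-1 - s / 2) * ∫ x, u x * (f x - P 0 f t x) := by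
  have hi := pair_int hs hs1 hf hu
  have e : ∀ t : ℝ, ∫ x, u x * (t ^ (-1 - s / 2) * (f x - P 0 f t x)) = t ^ (-1 - s / 2) * ∫ x, u x * (f x - P 0 f t x) := by
    intro t
    rw [← integral_const_mul]; congr 1; ext x; ring
  constructor
  · have := hi.integral_prod_right
    simp only [e] at this
    exact this
  · have h2 : ∀ x, u x * phi s f x = (J s)⁻¹ * ∫ t in Set.Ioi (0 : ℝ), u x * (t ^ (-1 - s / 2) * (f x - P 0 f t x)) := by
      intro x
      rw [integral_const_mul]; unfold phi; ring
    simp_rw [h2]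
    rw [integral_const_mul, integral_integral_swap (f := fun x t => u x * (t ^ (-1 - s / 2) * (f x - P 0 f t x))) hi]
    simp_rw [e]

lemma E1_bound {s : ℝ} (hs : 0 < s) (hs1 : s < 1) {f g h : ℝ → ℝ} (hf : Sm f) (hg : Sm g) (hh : Sm h)
    (hfg : Sm (fun x => f x * g x)) :
    ENNReal.ofReal |(∫ x, h x * phi s (fun x => f x * g x) x) - ∫ x, (f x * h x) * phi s g x| ≤
      ENNReal.ofReal (J s)⁻¹ * ∫⁻ t in Set.Ioi (0 : ℝ), ENNReal.ofReal (t ^ (-1 - s / 2)) *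
        ENNReal.ofReal |(∫ x, f x * h x * P 0 g t x) - ∫ x, f x * g x * P 0 h t x| := by
  obtain ⟨i1, e1⟩ := pair_eq hs hs1 hfg hh.nice
  obtain ⟨i2, e2⟩ := pair_eq hs hs1 hg (hf.nice.mul hh.nice)
  have hJ : 0 < (J s)⁻¹ := inv_pos.2 (J_pos hs hs1)
  have e3 : (∫ x, h x * phi s (fun x => f x * g x) x) - ∫ x, (f x * h x) * phi s g x =
      (J s)⁻¹ * ∫ t in Set.Ioi (0 : ℝ), t ^ (-1 - s / 2) * ((∫ x, f x * h x * P 0 g t x) - ∫ x, f x * g x * P 0 h t x) := by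
    rw [e1, e2, ← mul_sub, ← integral_sub i1 i2]
    congr 1
    refine setIntegral_congr_fun measurableSet_Ioi fun t ht => ?_
    have ht' : 0 < t := ht
    have hgp : Nice (P 0 g t) := P_nice hg.nice (n := 0) (by omega) ht'
    have hfgp : Nice (P 0 (fun x => f x * g x) t) := P_nice hfg.nice (n := 0) (by omega) ht'
    have j1 : Integrable (fun x => h x * (f x * g x)) := (hh.nice.mul hfg.nice).int
    have j2 : Integrable (fun x => h x * P 0 (fun x => f x * g x) t x) := (hh.nice.mul hfgp).int
    have j3 : Integrable (fun x => f x * h x * g x) := ((hf.nice.mul hh.nice).mul hg.nice).int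
    have j4 : Integrable (fun x => f x * h x * P 0 g t x) := ((hf.nice.mul hh.nice).mul hgp).int
    have k1 : ∫ x, h x * (f x * g x - P 0 (fun x => f x * g x) t x) = (∫ x, h x * (f x * g x)) - ∫ x, h x * P 0 (fun x => f x * g x) t x := by
      rw [← integral_sub j1 j2]; congr 1; ext x; ring
    have k2 : ∫ x, f x * h x * (g x - P 0 g t x) = (∫ x, f x * h x * g x) - ∫ x, f x * h x * P 0 g t x := by
      rw [← integral_sub j3 j4]; congr 1; ext x; ring
    have k3 : ∫ x, h x * (f x * g x) = ∫ x, f x * h x * g x := by congr 1; ext x; ring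
    have k4 := P_symm hfg.nice.int hh.nice ht'
    beta_reduce
    rw [k1, k2, k3, k4]; ring
  rw [e3, abs_mul, abs_of_pos hJ, ENNReal.ofReal_mul hJ.le]
  refine mul_le_mul' le_rfl ?_
  rw [← Real.enorm_eq_ofReal_abs]
  refine (enorm_integral_le_lintegral_enorm _).trans (le_of_eq ?_)
  refine setLIntegral_congr_fun measurableSet_Ioi fun σ hσ => ?_
  have hσp : 0 < σ := hσ
  have hp : 0 ≤ σ ^ (-1 - s / 2) := by positivity
  rw [Real.enorm_eq_ofReal_abs, abs_mul, ENNReal.ofReal_mul (abs_nonneg _), abs_of_nonneg hp]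

/-- product of Schwartz functions -/
def smul2 (f g : SchwartzMap ℝ ℝ) : SchwartzMap ℝ ℝ := SchwartzMap.pairing (ContinuousLinearMap.mul ℝ ℝ) f g

lemma smul2_apply (f g : SchwartzMap ℝ ℝ) : (smul2 f g : ℝ → ℝ) = fun x => f x * g x := rfl

/-- the commutator, real form -/
def TT (s : ℝ) (f g : ℝ → ℝ) (x : ℝ) : ℝ := phi s (fun x => f x * g x) x - f x * phi s g x - g x * phi s f x

lemma Nice.sub {f g : ℝ → ℝ} (hf : Nice f) (hg : Nice g) : Nice (fun x => f x - g x) := by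
  obtain ⟨A, hA⟩ := hf.bdd
  obtain ⟨B, hB⟩ := hg.bdd
  exact ⟨hf.meas.sub hg.meas, hf.int.sub hg.int, A + B, fun x => (abs_sub _ _).trans (add_le_add (hA x) (hB x))⟩

lemma TT_nice {s : ℝ} (hs : 0 < s) (hs1 : s < 1) (f g : SchwartzMap ℝ ℝ) : Nice (TT s f g) := by
  have h1 : Nice (phi s (fun x => f x * g x)) := phi_nice hs hs1 (schwartz_Sm (smul2 f g))
  exact (h1.sub ((schwartz_nice f).mul (phi_nice hs hs1 (schwartz_Sm g)))).sub ((schwartz_nice g).mul (phi_nice hs hs1 (schwartz_Sm f)))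

lemma dual_bound {s p q : ℝ} (hs : 0 < s) (hs1 : s < 1) (hpq : p.HolderConjugate q) :
    ∃ C : ENNReal, C ≠ ⊤ ∧ ∀ f g h : SchwartzMap ℝ ℝ, (∀ x, |g x| ≤ 1) →
      ENNReal.ofReal |∫ x, h x * TT s f g x| ≤ C * (Np p (phi s f) ^ (1 / p) * Np q h ^ (1 / q)) := by
  obtain ⟨C, hC, ht⟩ := tri hs hs1 hpq (Gamma (s / 2))⁻¹
  refine ⟨ENNReal.ofReal (J s)⁻¹ * C + 1, by finiteness, fun f g h hg => ?_⟩
  have hfg : Sm (fun x => f x * g x) := schwartz_Sm (smul2 f g)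
  have nf := schwartz_nice f
  have ng := schwartz_nice g
  have nh := schwartz_nice h
  have b1 := E1_bound hs hs1 (schwartz_Sm f) (schwartz_Sm g) (schwartz_Sm h) hfg
  have b2 := ht f g h (phi s f) (schwartz_Sm f) (schwartz_Sm g) hg (schwartz_Sm h) (phi_nice hs hs1 (schwartz_Sm f)) (schwartz_Sub hs hs1 f)
  have pf := phi_nice hs hs1 (schwartz_Sm f)
  have pg := phi_nice hs hs1 (schwartz_Sm g)
  have pfg := phi_nice hs hs1 hfg
  have j1 : Integrable (fun x => h x * phi s (fun x => f x * g x) x) := (nh.mul pfg).int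
  have j2 : Integrable (fun x => f x * h x * phi s g x) := ((nf.mul nh).mul pg).int
  have j3 : Integrable (fun x => h x * (g x * phi s f x)) := (nh.mul (ng.mul pf)).int
  have e : ∫ x, h x * TT s f g x = ((∫ x, h x * phi s (fun x => f x * g x) x) - ∫ x, (f x * h x) * phi s g x) - ∫ x, h x * (g x * phi s f x) := by
    have j12 : Integrable (fun x => h x * phi s (fun x => f x * g x) x - f x * h x * phi s g x) := j1.sub j2
    rw [← integral_sub j1 j2, ← integral_sub j12 j3]
    congr 1; ext x; unfold TT; ring
  have b3 : ENNReal.ofReal |∫ x, h x * (g x * phi s f x)| ≤ Np p (phi s f) ^ (1 / p) * Np q h ^ (1 / q) := by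
    rw [← Real.enorm_eq_ofReal_abs]
    refine (enorm_integral_le_lintegral_enorm _).trans ?_
    refine le_trans (lintegral_mono (g := fun x => ENNReal.ofReal |phi s f x| * ENNReal.ofReal |h x|) fun x => ?_) ?_
    · beta_reduce
      rw [Real.enorm_eq_ofReal_abs, ← ENNReal.ofReal_mul (abs_nonneg _)]
      refine ENNReal.ofReal_le_ofReal ?_
      rw [abs_mul, abs_mul, mul_comm]
      exact mul_le_mul_of_nonneg_right (mul_le_of_le_one_left (abs_nonneg _) (hg x)) (abs_nonneg _)
    · exact ENNReal.lintegral_mul_le_Lp_mul_Lq _ hpq pf.meas.abs.ennreal_ofReal.aemeasurable nh.meas.abs.ennreal_ofReal.aemeasurable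
  rw [e]
  refine (ENNReal.ofReal_le_ofReal (abs_sub _ _)).trans ?_
  rw [ENNReal.ofReal_add (abs_nonneg _) (abs_nonneg _), add_mul, one_mul]
  refine add_le_add (b1.trans ?_) b3
  rw [mul_assoc]
  exact mul_le_mul' le_rfl b2

end KPV

namespace KPV

lemma holN {p q : ℝ} (hpq : p.HolderConjugate q) {u v : ℝ → ℝ} (hu : Measurable u) (hv : Measurable v) :
    ENNReal.ofReal |∫ x, u x * v x| ≤ Np q u ^ (1 / q) * Np p v ^ (1 / p) := by
  rw [← Real.enorm_eq_ofReal_abs]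
  refine (enorm_integral_le_lintegral_enorm _).trans ?_
  have e : ∀ x, ‖u x * v x‖ₑ = ENNReal.ofReal |u x| * ENNReal.ofReal |v x| := fun x => by
    rw [Real.enorm_eq_ofReal_abs, abs_mul, ENNReal.ofReal_mul (abs_nonneg _)]
  simp_rw [e]
  exact ENNReal.lintegral_mul_le_Lp_mul_Lq _ hpq.symm hu.abs.ennreal_ofReal.aemeasurable hv.abs.ennreal_ofReal.aemeasurable

lemma Np_eLp {q : ℝ} (hq : 0 < q) (u : ℝ → ℝ) : eLpNorm u (ENNReal.ofReal q) volume = Np q u ^ (1 / q) := by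
  rw [eLpNorm_eq_lintegral_rpow_enorm_toReal (by simpa using hq) ENNReal.ofReal_ne_top, ENNReal.toReal_ofReal hq.le]
  simp only [Real.enorm_eq_ofReal_abs]; rfl

lemma Np_int {p : ℝ} (hp : 1 ≤ p) {T : ℝ → ℝ} (hT : Nice T) : Integrable (fun x => |T x| ^ p) ∧ ∫ x, |T x| ^ p = (Np p T).toReal := by
  have e : ∀ x, ENNReal.ofReal (|T x| ^ p) = ENNReal.ofReal |T x| ^ p := fun x =>
    (ENNReal.ofReal_rpow_of_nonneg (abs_nonneg _) (by linarith)).symm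
  have m : Measurable (fun x => |T x| ^ p) := hT.meas.abs.pow_const _
  have h0 : 0 ≤ᵐ[volume] fun x => |T x| ^ p := Filter.Eventually.of_forall fun x => by positivity
  constructor
  · refine ⟨m.aestronglyMeasurable, ?_⟩
    rw [hasFiniteIntegral_iff_ofReal h0]
    simp_rw [e]
    exact (Np_fin hT hp).lt_top
  · rw [integral_eq_lintegral_of_nonneg_ae h0 m.aestronglyMeasurable]
    simp_rw [e]; rfl

lemma duality {p q : ℝ} (hpq : p.HolderConjugate q) {T : ℝ → ℝ} (hT : Nice T) {A : ENNReal} (hA : A ≠ ⊤)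
    (hd : ∀ h : SchwartzMap ℝ ℝ, ENNReal.ofReal |∫ x, h x * T x| ≤ A * Np q h ^ (1 / q)) :
    Np p T ^ (1 / p) ≤ A := by
  have hp1 := hpq.lt
  have hq1 := hpq.symm.lt
  have hp0 : 0 < p := by linarith
  have hq0 : 0 < q := by linarith
  obtain ⟨iT, eT⟩ := Np_int hp1.le hT
  have hN : Np p T ≠ ⊤ := Np_fin hT hp1.le
  set u : ℝ → ℝ := fun x => if 0 ≤ T x then |T x| ^ (p - 1) else -|T x| ^ (p - 1) with hu
  have mu : Measurable u := Measurable.ite (measurableSet_le measurable_const hT.meas) (hT.meas.abs.pow_const _) (hT.meas.abs.pow_const _).neg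
  have au : ∀ x, |u x| = |T x| ^ (p - 1) := by
    intro x
    have : 0 ≤ |T x| ^ (p - 1) := by positivity
    simp only [hu]; split_ifs
    · rw [abs_of_nonneg this]
    · rw [abs_neg, abs_of_nonneg this]
  have hpow : ∀ x, |T x| ^ (p - 1) * |T x| = |T x| ^ p := by
    intro x
    rcases (abs_nonneg (T x)).eq_or_lt with h | h
    · rw [← h, mul_zero, Real.zero_rpow hp0.ne']
    · nth_rw 2 [← Real.rpow_one |T x|]
      rw [← Real.rpow_add h]; congr 1; ring
  have uT : ∀ x, u x * T x = |T x| ^ p := by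
    intro x
    rw [← hpow]
    simp only [hu]; split_ifs with h
    · rw [abs_of_nonneg h]
    · rw [abs_of_neg (not_le.1 h)]; ring
  have Nu : Np q u = Np p T := by
    unfold Np; congr 1; ext x
    rw [au, ENNReal.ofReal_rpow_of_nonneg (by positivity) hq0.le, ENNReal.ofReal_rpow_of_nonneg (by positivity) hp0.le, ← Real.rpow_mul (abs_nonneg _), hpq.sub_one_mul_conj]
  have hmem : MemLp u (ENNReal.ofReal q) volume := by
    refine ⟨mu.aestronglyMeasurable, ?_⟩
    rw [Np_eLp hq0, Nu]
    exact ENNReal.rpow_lt_top_of_nonneg (by positivity) hN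
  set X := Np p T ^ (1 / q) with hX
  set Y := Np p T ^ (1 / p) with hY
  have hYf : Y ≠ ⊤ := (ENNReal.rpow_lt_top_of_nonneg (by positivity) hN).ne
  have key : ∀ ε : ℝ, 0 < ε → Np p T ≤ A * X + ENNReal.ofReal ε * (A + Y) := by
    intro ε hε
    obtain ⟨g, hg1, hg2, hg3⟩ := hmem.exist_eLpNorm_sub_le ENNReal.ofReal_ne_top (by simpa using hq1.le) hε
    have hgc : Measurable g := hg2.continuous.measurable
    have hd1 := hd (hg1.toSchwartzMap hg2)
    have hgs : ((hg1.toSchwartzMap hg2 : SchwartzMap ℝ ℝ) : ℝ → ℝ) = g := rfl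
    have hgn : Nice g := schwartz_nice (hg1.toSchwartzMap hg2)
    rw [hgs] at hd1
    have i1 : Integrable (fun x => u x * T x) := iT.congr (Filter.Eventually.of_forall fun x => (uT x).symm)
    have i2 : Integrable (fun x => g x * T x) := (hgn.mul hT).int
    have e1 : ∫ x, |T x| ^ p = (∫ x, g x * T x) + ∫ x, (u - g) x * T x := by
      have e0 : ∫ x, (u - g) x * T x = (∫ x, u x * T x) - ∫ x, g x * T x := by
        rw [← integral_sub i1 i2]; congr 1; ext x; simp only [Pi.sub_apply]; ring
      rw [e0]; simp_rw [uT]; ring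
    have b1 := holN hpq (mu.sub hgc) hT.meas
    rw [← Np_eLp hq0] at b1
    have b2 : Np q g ^ (1 / q) ≤ X + ENNReal.ofReal ε := by
      rw [← Np_eLp hq0, hX, ← Nu, ← Np_eLp hq0]
      have : g = u - (u - g) := by simp
      rw [this]
      exact (eLpNorm_sub_le mu.aestronglyMeasurable (mu.sub hgc).aestronglyMeasurable (by simpa using hq1.le)).trans (add_le_add le_rfl hg3)
    have e2 : Np p T = ENNReal.ofReal (∫ x, |T x| ^ p) := by rw [eT, ENNReal.ofReal_toReal hN]
    calc Np p T = ENNReal.ofReal ((∫ x, g x * T x) + ∫ x, (u - g) x * T x) := by rw [e2, e1]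
      _ ≤ ENNReal.ofReal (|∫ x, g x * T x| + |∫ x, (u - g) x * T x|) :=
        ENNReal.ofReal_le_ofReal (add_le_add (le_abs_self _) (le_abs_self _))
      _ = ENNReal.ofReal |∫ x, g x * T x| + ENNReal.ofReal |∫ x, (u - g) x * T x| := ENNReal.ofReal_add (abs_nonneg _) (abs_nonneg _)
      _ ≤ A * (X + ENNReal.ofReal ε) + ENNReal.ofReal ε * Y :=
        add_le_add (hd1.trans (mul_le_mul' le_rfl b2)) (b1.trans (mul_le_mul' hg3 le_rfl))
      _ = _ := by ring
  have lim : Np p T ≤ A * X := by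
    have h1 : Filter.Tendsto (fun ε : ℝ => A * X + ENNReal.ofReal ε * (A + Y)) (nhdsWithin 0 (Set.Ioi 0)) (nhds (A * X + ENNReal.ofReal 0 * (A + Y))) := by
      refine Filter.Tendsto.mono_left ?_ nhdsWithin_le_nhds
      exact tendsto_const_nhds.add (ENNReal.Tendsto.mul_const (ENNReal.continuous_ofReal.tendsto 0) (Or.inr (ENNReal.add_ne_top.2 ⟨hA, hYf⟩)))
    rw [ENNReal.ofReal_zero, zero_mul, add_zero] at h1
    refine ge_of_tendsto h1 ?_
    filter_upwards [self_mem_nhdsWithin] with ε hε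
    exact key ε hε
  by_cases h0 : Np p T = 0
  · rw [hY, h0, ENNReal.zero_rpow_of_pos (by positivity)]; exact zero_le
  have hX0 : X ≠ 0 := by
    rw [hX]; exact (ENNReal.rpow_pos (pos_iff_ne_zero.2 h0) hN).ne'
  have hXf : X ≠ ⊤ := (ENNReal.rpow_lt_top_of_nonneg (by positivity) hN).ne
  have hXY : Np p T = Y * X := by
    rw [hX, hY, ← ENNReal.rpow_add _ _ h0 hN, one_div, one_div, hpq.inv_add_inv_eq_one, ENNReal.rpow_one]
  rw [hXY] at lim
  exact (ENNReal.mul_le_mul_iff_left hX0 hXf).1 lim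

lemma phi_smul (s c : ℝ) (f : ℝ → ℝ) (x : ℝ) : phi s (fun x => c * f x) x = c * phi s f x := by
  unfold phi
  have : ∀ t : ℝ, t ^ (-1 - s / 2) * (c * f x - P 0 (fun x => c * f x) t x) = c * (t ^ (-1 - s / 2) * (f x - P 0 f t x)) := by
    intro t; rw [P_smul]; ring
  simp_rw [this]
  rw [integral_const_mul]; ring

lemma TT_smul (s c : ℝ) (f g : ℝ → ℝ) (x : ℝ) : TT s f (fun x => c * g x) x = c * TT s f g x := by
  unfold TT
  have : (fun x => f x * (c * g x)) = fun x => c * (f x * g x) := by ext x; ring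
  rw [this, phi_smul, phi_smul]; ring

lemma main_bound {s p : ℝ} (hs : 0 < s) (hs1 : s < 1) (hp : 1 < p) :
    ∃ C : ℝ, 0 < C ∧ ∀ f g : SchwartzMap ℝ ℝ,
      (∫ x, |TT s f g x| ^ p) ^ (1 / p) ≤ C * (⨆ x, |g x|) * (∫ x, |phi s f x| ^ p) ^ (1 / p) := by
  have hpq := Real.HolderConjugate.conjExponent hp
  obtain ⟨C, hC, hd⟩ := dual_bound hs hs1 hpq
  refine ⟨C.toReal + 1, by positivity, fun f g => ?_⟩
  have hp0 : 0 < p := by linarith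
  have nphi := phi_nice hs hs1 (schwartz_Sm f)
  rw [(Np_int hp.le nphi).2]
  obtain ⟨M, hM⟩ := (schwartz_nice g).bdd
  have hbdd : BddAbove (Set.range fun x => |g x|) := ⟨M, by rintro _ ⟨x, rfl⟩; exact hM x⟩
  set B := ⨆ x, |g x| with hB
  have hgB : ∀ x, |g x| ≤ B := fun x => le_ciSup hbdd x
  have hB0 : 0 ≤ B := (abs_nonneg _).trans (hgB 0)
  have hR0 : 0 ≤ (Np p (phi s f)).toReal ^ (1 / p) := by positivity
  rcases hB0.eq_or_lt with hBz | hBp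
  · have : ∀ x, TT s f g x = 0 := by
      intro x
      have h1 : (g : ℝ → ℝ) = fun x => 0 * g x := by
        ext x
        have := hgB x
        rw [← hBz] at this
        rw [zero_mul]; exact abs_eq_zero.1 (le_antisymm this (abs_nonneg _))
      rw [h1, TT_smul, zero_mul]
    simp only [this, abs_zero]
    rw [Real.zero_rpow hp0.ne', integral_zero, Real.zero_rpow (by positivity)]
    positivity
  · set g' : SchwartzMap ℝ ℝ := B⁻¹ • g with hg'
    have hga : (g' : ℝ → ℝ) = fun x => B⁻¹ * g x := rfl
    have hg1 : ∀ x, |g' x| ≤ 1 := by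
      intro x
      rw [hga]; simp only [abs_mul, abs_of_pos (inv_pos.2 hBp)]
      rw [inv_mul_le_iff₀ hBp, mul_one]; exact hgB x
    have hNf := Np_fin nphi hp.le
    have hYf : Np p (phi s f) ^ (1 / p) ≠ ⊤ := (ENNReal.rpow_lt_top_of_nonneg (by positivity) hNf).ne
    have nT := TT_nice hs hs1 f g'
    have h1 := duality hpq nT (A := C * Np p (phi s f) ^ (1 / p)) (ENNReal.mul_ne_top hC hYf) (fun h => by
      rw [mul_assoc]; exact hd f g' h hg1)
    have h2 : (∫ x, |TT s f g' x| ^ p) ^ (1 / p) ≤ C.toReal * (Np p (phi s f)).toReal ^ (1 / p) := by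
      rw [(Np_int hp.le nT).2, ENNReal.toReal_rpow, ENNReal.toReal_rpow, ← ENNReal.toReal_mul]
      exact ENNReal.toReal_mono (ENNReal.mul_ne_top hC hYf) h1
    have h3 : (∫ x, |TT s f g' x| ^ p) ^ (1 / p) = B⁻¹ * (∫ x, |TT s f g x| ^ p) ^ (1 / p) := by
      have e : ∀ x, |TT s f g' x| ^ p = (B⁻¹) ^ p * |TT s f g x| ^ p := by
        intro x
        rw [hga, TT_smul, abs_mul, abs_of_pos (inv_pos.2 hBp), Real.mul_rpow (by positivity) (abs_nonneg _)]
      simp_rw [e]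
      rw [integral_const_mul, Real.mul_rpow (by positivity) (integral_nonneg fun x => by positivity), ← Real.rpow_mul (by positivity), mul_one_div_cancel hp0.ne', Real.rpow_one]
    rw [h3, inv_mul_le_iff₀ hBp] at h2
    refine h2.trans ?_
    have : 0 ≤ B * (Np p (phi s f)).toReal ^ (1 / p) := by positivity
    nlinarith

end KPV

/-- Kenig–Ponce–Vega commutator estimate on ℝ (Remark 2.8):
    ‖Λˢ(fg) − fΛˢg − gΛˢf‖_{Lᵖ(ℝ)} ≤ C ‖g‖_{L^∞(ℝ)} ‖Λˢf‖_{Lᵖ(ℝ)}, 0 < s < 1. -/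
theorem kenig_ponce_vega_commutator
    (s : ℝ) (hs1 : 0 < s) (hs2 : s < 1) (p : ℝ) (hp1 : 1 < p) :
    ∃ C : ℝ, 0 < C ∧
      ∀ f g : SchwartzMap ℝ ℝ,
        (∫ x : ℝ,
            ‖Lam1 s (fun y => ((f y : ℝ) : ℂ) * ((g y : ℝ) : ℂ)) x
              - ((f x : ℝ) : ℂ) * Lam1 s (fun y => ((g y : ℝ) : ℂ)) x
              - ((g x : ℝ) : ℂ) * Lam1 s (fun y => ((f y : ℝ) : ℂ)) x‖ ^ p) ^ (1 / p)
          ≤ C * (⨆ x : ℝ, |g x|)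
              * (∫ x : ℝ, ‖Lam1 s (fun y => ((f y : ℝ) : ℂ)) x‖ ^ p) ^ (1 / p) := by
  obtain ⟨C, hC, hb⟩ := KPV.main_bound hs1 hs2 hp1
  refine ⟨C, hC, fun f g => ?_⟩
  have e1 : ∀ x, ‖Lam1 s (fun y => ((f y : ℝ) : ℂ)) x‖ = |KPV.phi s f x| := by
    intro x
    rw [KPV.Lam_eq hs1 hs2, Complex.norm_real, Real.norm_eq_abs]
  have e2 : ∀ x, ‖Lam1 s (fun y => ((f y : ℝ) : ℂ) * ((g y : ℝ) : ℂ)) x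
              - ((f x : ℝ) : ℂ) * Lam1 s (fun y => ((g y : ℝ) : ℂ)) x
              - ((g x : ℝ) : ℂ) * Lam1 s (fun y => ((f y : ℝ) : ℂ)) x‖ = |KPV.TT s f g x| := by
    intro x
    have h := KPV.Lam_eq hs1 hs2 (KPV.smul2 f g) x
    rw [KPV.smul2_apply] at h
    simp only [Complex.ofReal_mul] at h
    rw [h, KPV.Lam_eq hs1 hs2, KPV.Lam_eq hs1 hs2, ← Real.norm_eq_abs, ← Complex.norm_real]
    unfold KPV.TT
    push_cast; rfl
  simp_rw [e1, e2]
  exact hb f g
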